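/- arXiv:1505.04161 — 3 statements merged into one kernel-verified Lean document; each statement's English description precedes it below -/
import Mathlib

section
/- Let C₃, C₆ ≥ 2 be real constants, B₁ ∈ (0, 1/16], B₃ ∈ (0, (32 C₆)^{−4/3}], and let T, M > 0 and H ≥ 1 satisfy H > 32 C₃^{1/3} M T^{−1/3}. Let E₁, E₂ ∈ [1/16, 16], let Ñ, R̃ > 0 and ν ≥ 6 be real numbers with E₁ Ñ R̃² = C₃ M³ / (2T) and E₂ B₁ Ñ^{(ν−2)/(2ν−6)} R̃^{(ν−4)/(2ν−6)} ≥ H. Put Ṽ₀ := (H/R̃)^{18/17}, Ṽ₁ := R̃⁴/(H Ñ) and Ṽ₂ := M²/(H Ñ³). Suppose that either E₂ · min{Ṽ₁, Ṽ₂} ≥ Ṽ₀, or both M ≤ C₆ T^{1/2} and Ñ³ ≤ E₂ B₃³ M⁶ / (T² H). Then: (a) H Ñ² / (M R̃²) < 1; (b) max{H/R̃², R̃/H, H/Ñ, Ñ/M} ≤ B₁; (c) Ṽ₀² < Ñ (Ṽ₁ Ṽ₂)^{1/2}; and (d) R̃ (R̃/H)^{130/357} ≥ 1 + M²/T. -/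
open Real

set_option linter.unusedSimpArgs false

/-- The logarithmic (linear) form of the lemma; `w` encodes the exponent through `α = 1/2 + w`. -/
theorem lemma12_1_linear (L c3 c6 b1 b3 t m h e1 e2 n r w : ℝ)
    (hL : 0 < L) (hc3 : L ≤ c3) (hc6 : L ≤ c6) (hb1 : b1 ≤ -(4 * L))
    (hb3 : b3 ≤ -4 / 3 * (5 * L + c6)) (hh : 0 ≤ h)
    (h71 : 5 * L + 1 / 3 * c3 + m + -1 / 3 * t < h)
    (e1l : -(4 * L) ≤ e1) (e1u : e1 ≤ 4 * L) (e2l : -(4 * L) ≤ e2) (e2u : e2 ≤ 4 * L)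
    (heq : e1 + n + 2 * r = c3 + 3 * m - (L + t))
    (hw0 : 0 ≤ w) (hw1 : w ≤ 1 / 6)
    (hs : h ≤ e2 + b1 + (1 / 2 + w) * n + (1 / 2 - w) * r)
    (ho : (18 / 17 * (h - r) ≤ e2 + (4 * r - (h + n)) ∧
        18 / 17 * (h - r) ≤ e2 + (2 * m - (h + 3 * n))) ∨
      (m ≤ c6 + 1 / 2 * t ∧ 3 * n ≤ e2 + 3 * b3 + 6 * m - (2 * t + h))) :
    h + 2 * n - (m + 2 * r) < 0 ∧
    (h - 2 * r ≤ b1 ∧ r - h ≤ b1 ∧ h - n ≤ b1 ∧ n - m ≤ b1) ∧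
    2 * (18 / 17 * (h - r)) < n + 1 / 2 * ((4 * r - (h + n)) + (2 * m - (h + 3 * n))) ∧
    L ≤ r + 130 / 357 * (r - h) ∧ L + (2 * m - t) ≤ r + 130 / 357 * (r - h) := by
  rcases le_total n r with hnr | hnr
  · have hs' : h ≤ e2 + b1 + 1 / 2 * n + 1 / 2 * r := by nlinarith
    clear hs hw0 hw1
    rcases ho with ⟨o1, o2⟩ | ⟨o1, o2⟩
    · refine ⟨?_, ⟨?_, ?_, ?_, ?_⟩, ?_, ?_, ?_⟩ <;> linarith
    · refine ⟨?_, ⟨?_, ?_, ?_, ?_⟩, ?_, ?_, ?_⟩ <;> linarith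
  · have hs' : h ≤ e2 + b1 + 2 / 3 * n + 1 / 3 * r := by nlinarith
    clear hs hw0 hw1
    rcases ho with ⟨o1, o2⟩ | ⟨o1, o2⟩
    · refine ⟨?_, ⟨?_, ?_, ?_, ?_⟩, ?_, ?_, ?_⟩ <;> linarith
    · refine ⟨?_, ⟨?_, ?_, ?_, ?_⟩, ?_, ?_, ?_⟩ <;> linarith

/-- Lemma 12.1. -/
theorem lemma12_1 (C₃ C₆ B₁ B₃ T M H E₁ E₂ Ntil Rtil ν : ℝ)
    (hC₃ : 2 ≤ C₃) (hC₆ : 2 ≤ C₆)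
    (hB₁ : 0 < B₁) (hB₁' : B₁ ≤ 1/16)
    (hB₃ : 0 < B₃) (hB₃' : B₃ ≤ (32*C₆) ^ (-(4:ℝ)/3))
    (hT : 0 < T) (hM : 0 < M) (hH : 1 ≤ H)
    (h71 : 32 * C₃ ^ ((1:ℝ)/3) * M * T ^ (-(1:ℝ)/3) < H)
    (hE₁ : E₁ ∈ Set.Icc (1/16 : ℝ) 16) (hE₂ : E₂ ∈ Set.Icc (1/16 : ℝ) 16)
    (hN : 0 < Ntil) (hR : 0 < Rtil) (hν : 6 ≤ ν)
    (h1220 : E₁ * Ntil * Rtil^2 = C₃ * M^3 / (2*T))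
    (h1221 : H ≤ E₂ * B₁ * Ntil ^ ((ν-2)/(2*ν-6)) * Rtil ^ ((ν-4)/(2*ν-6)))
    (hOr : (H/Rtil) ^ ((18:ℝ)/17) ≤ E₂ * min (Rtil^4/(H*Ntil)) (M^2/(H*Ntil^3)) ∨
           (M ≤ C₆ * T ^ ((1:ℝ)/2) ∧ Ntil^3 ≤ E₂ * B₃^3 * M^6 / (T^2 * H))) :
    H * Ntil^2 / (M * Rtil^2) < 1 ∧
    max (max (H/Rtil^2) (Rtil/H)) (max (H/Ntil) (Ntil/M)) ≤ B₁ ∧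
    ((H/Rtil) ^ ((18:ℝ)/17))^2 <
      Ntil * ((Rtil^4/(H*Ntil)) * (M^2/(H*Ntil^3))) ^ ((1:ℝ)/2) ∧
    1 + M^2/T ≤ Rtil * (Rtil/H) ^ ((130:ℝ)/357) := by
  obtain ⟨e1l, e1u⟩ := hE₁
  obtain ⟨e2l, e2u⟩ := hE₂
  have hC₃0 : 0 < C₃ := by linarith
  have hC₆0 : 0 < C₆ := by linarith
  have hH0 : 0 < H := by linarith
  have hE₁0 : 0 < E₁ := by linarith
  have hE₂0 : 0 < E₂ := by linarith
  have l16 : Real.log 16 = 4 * Real.log 2 := by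
    rw [show (16 : ℝ) = 2 ^ 4 by norm_num, Real.log_pow]; norm_num
  have l32 : Real.log 32 = 5 * Real.log 2 := by
    rw [show (32 : ℝ) = 2 ^ 5 by norm_num, Real.log_pow]; norm_num
  have k0 := Real.log_pos (show (1 : ℝ) < 2 by norm_num)
  have k1 := Real.log_le_log (by norm_num) hC₃
  have k2 := Real.log_le_log (by norm_num) hC₆
  have k3 := Real.log_le_log hB₁ hB₁'
  have k4 := Real.log_le_log hB₃ hB₃'
  have k5 := Real.log_nonneg hH
  have k6 := Real.log_lt_log (by positivity) h71
  have k7 := Real.log_le_log (by norm_num) e1l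
  have k8 := Real.log_le_log hE₁0 e1u
  have k9 := Real.log_le_log (by norm_num) e2l
  have k10 := Real.log_le_log hE₂0 e2u
  have k11 := congrArg Real.log h1220
  have k12 := Real.log_le_log hH0 h1221
  have k13 : (18 / 17 * (Real.log H - Real.log Rtil) ≤ Real.log E₂ +
        (4 * Real.log Rtil - (Real.log H + Real.log Ntil)) ∧
      18 / 17 * (Real.log H - Real.log Rtil) ≤ Real.log E₂ +
        (2 * Real.log M - (Real.log H + 3 * Real.log Ntil))) ∨
      (Real.log M ≤ Real.log C₆ + 1 / 2 * Real.log T ∧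
        3 * Real.log Ntil ≤ Real.log E₂ + 3 * Real.log B₃ + 6 * Real.log M -
          (2 * Real.log T + Real.log H)) := by
    rcases hOr with ho | ⟨o1, o2⟩
    · left
      have p1 := ho.trans (mul_le_mul_of_nonneg_left (min_le_left _ _) hE₂0.le)
      have p2 := ho.trans (mul_le_mul_of_nonneg_left (min_le_right _ _) hE₂0.le)
      have q1 := Real.log_le_log (by positivity) p1
      have q2 := Real.log_le_log (by positivity) p2
      simp (disch := positivity) only [Real.log_mul, Real.log_div, Real.log_pow, Real.log_rpow, l16, l32, Real.log_one, Nat.cast_ofNat] at q1 q2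
      exact ⟨q1, q2⟩
    · right
      have q1 := Real.log_le_log (by positivity) o1
      have q2 := Real.log_le_log (by positivity) o2
      simp (disch := positivity) only [Real.log_mul, Real.log_div, Real.log_pow, Real.log_rpow, l16, l32, Real.log_one, Nat.cast_ofNat] at q1 q2
      exact ⟨q1, q2⟩
  simp (disch := positivity) only [Real.log_mul, Real.log_div, Real.log_pow, Real.log_rpow, l16, l32, Real.log_one, Nat.cast_ofNat] at k3 k4 k6 k7 k8 k9 k10 k11 k12
  have hd : 0 < 2 * ν - 6 := by linarith
  have hα : (ν - 2) / (2 * ν - 6) = 1 / 2 + 1 / (2 * ν - 6) := by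
    rw [div_add_div _ _ two_ne_zero hd.ne', div_eq_div_iff hd.ne' (by positivity)]; ring
  have hβ : (ν - 4) / (2 * ν - 6) = 1 / 2 - 1 / (2 * ν - 6) := by
    rw [div_sub_div _ _ two_ne_zero hd.ne', div_eq_div_iff hd.ne' (by positivity)]; ring
  rw [hα, hβ] at k12
  obtain ⟨ga, ⟨gb1, gb2, gb3, gb4⟩, gc, gd1, gd2⟩ := lemma12_1_linear (Real.log 2) (Real.log C₃)
    (Real.log C₆) (Real.log B₁) (Real.log B₃) (Real.log T) (Real.log M) (Real.log H)
    (Real.log E₁) (Real.log E₂) (Real.log Ntil) (Real.log Rtil) (1 / (2 * ν - 6))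
    k0 k1 k2 (by linarith) k4 k5 k6 (by linarith) k8 (by linarith) k10 k11 (by positivity)
    (one_div_le_one_div_of_le (by norm_num) (by linarith)) k12 k13
  refine ⟨?_, max_le (max_le ?_ ?_) (max_le ?_ ?_), ?_, ?_⟩
  · refine (Real.log_lt_log_iff (by positivity) (by positivity)).1 ?_
    simp (disch := positivity) only [Real.log_mul, Real.log_div, Real.log_pow, Real.log_rpow, l16, l32, Real.log_one, Nat.cast_ofNat]
    linarith
  · refine (Real.log_le_log_iff (by positivity) (by positivity)).1 ?_
    simp (disch := positivity) only [Real.log_mul, Real.log_div, Real.log_pow, Real.log_rpow, l16, l32, Real.log_one, Nat.cast_ofNat]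
    linarith
  · refine (Real.log_le_log_iff (by positivity) (by positivity)).1 ?_
    simp (disch := positivity) only [Real.log_mul, Real.log_div, Real.log_pow, Real.log_rpow, l16, l32, Real.log_one, Nat.cast_ofNat]
    linarith
  · refine (Real.log_le_log_iff (by positivity) (by positivity)).1 ?_
    simp (disch := positivity) only [Real.log_mul, Real.log_div, Real.log_pow, Real.log_rpow, l16, l32, Real.log_one, Nat.cast_ofNat]
    linarith
  · refine (Real.log_le_log_iff (by positivity) (by positivity)).1 ?_
    simp (disch := positivity) only [Real.log_mul, Real.log_div, Real.log_pow, Real.log_rpow, l16, l32, Real.log_one, Nat.cast_ofNat]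
    linarith
  · refine (Real.log_lt_log_iff (by positivity) (by positivity)).1 ?_
    simp (disch := positivity) only [Real.log_mul, Real.log_div, Real.log_pow, Real.log_rpow, l16, l32, Real.log_one, Nat.cast_ofNat]
    linarith
  · have x1 : 2 ≤ Rtil * (Rtil / H) ^ ((130 : ℝ) / 357) := by
      refine (Real.log_le_log_iff (by positivity) (by positivity)).1 ?_
      simp (disch := positivity) only [Real.log_mul, Real.log_div, Real.log_pow, Real.log_rpow, l16, l32, Real.log_one, Nat.cast_ofNat]
      linarith
    have x2 : 2 * (M ^ 2 / T) ≤ Rtil * (Rtil / H) ^ ((130 : ℝ) / 357) := by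
      refine (Real.log_le_log_iff (by positivity) (by positivity)).1 ?_
      simp (disch := positivity) only [Real.log_mul, Real.log_div, Real.log_pow, Real.log_rpow, l16, l32, Real.log_one, Nat.cast_ofNat]
      linarith
    linarith
end

section
/- Let C₃, C₆ ≥ 2 be real constants, B₁ ∈ (0, 1/16], B₃ ∈ (0, (32 C₆)^{−4/3}], and let T, M > 0 and H ≥ 1 satisfy H > 32 C₃^{1/3} M T^{−1/3}. Let Ñ, R̃ > 0 and ν ≥ 6 be real numbers with Ñ R̃² = C₃ M³ / (2T) and B₁ Ñ^{(ν−2)/(2ν−6)} R̃^{(ν−4)/(2ν−6)} ≥ H, and suppose that either min{R̃⁴/(H Ñ), M²/(H Ñ³)} ≥ (H/R̃)^{18/17}, or both M ≤ C₆ T^{1/2} and Ñ³ ≤ B₃³ M⁶ / (T² H). Set N := ⌈Ñ⌉ and R := ⌈(C₃ M³/(2NT))^{1/2}⌉. Then: Ñ ≤ N < 2Ñ; R̃/√2 < R < 2R̃; 1/(R−1)² > 2NT/(C₃M³) ≥ 1/R²; H N²/(M R²) < 1; max{H/R², R/H, H/N, N/M} ≤ B₁; (H/R)^{36/17} < N ·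 (R⁴/(HN))^{1/2} · (M²/(HN³))^{1/2}; H ≤ 2^{1/4} B₁ N^{(ν−2)/(2ν−6)} R^{(ν−4)/(2ν−6)}; and R (R/H)^{130/357} ≥ 1 + M²/T. -/
open Real

lemma aux_core (B n r H M : ℝ) (hB : 0 < B) (hB' : B ≤ 1/16) (hn : 0 < n) (hr : 0 < r)
    (hH : 1 ≤ H) (hM : 0 < M)
    (ha : 2^16 * (n * r^2) < H^3) (hb : 2^16 * r < B^3 * n) (hc : H^3 ≤ B^3 * (n^2 * r))
    (hd : 2^14 * (H * n) ≤ r^4) (he : 2^14 * (H * n^3) ≤ M^2) :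
    2^20 < B^2 * r ∧ 2^9 * H ≤ B * r^2 ∧ 2^15 * n ≤ B * M ∧ 2^9 * (H * n) ≤ M ∧
    2^14 * (H * n^2) ≤ r^2 * M ∧ H^5 ≤ n^2 * r^5 ∧ H ≤ B * n ∧ 2^10 * r ≤ B * H ∧ r ≤ n ∧ 1 < r
    := by
  have hH0 : 0 < H := by linarith
  have hB1 : B ≤ 1 := by linarith
  have hB3 : B^3 ≤ 1 := pow_le_one₀ hB.le hB1
  have hrn : r ≤ n := by
    have : B^3 * n ≤ 1 * n := by gcongr
    linarith
  have hf : 2^58 * n^4 < r^10 := by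
    have h1 : (2^14 * (H * n))^3 ≤ (r^4)^3 := by gcongr
    have h2 : n^3 * (2^16 * (n * r^2)) < n^3 * H^3 := by gcongr
    have h3 : r^2 * (2^58 * n^4) < r^2 * r^10 := by nlinarith
    exact lt_of_mul_lt_mul_left h3 (by positivity)
  have hg : 2^20 < B^2 * r := by
    have h1 : (2^16 * r)^4 < (B^3 * n)^4 := by gcongr
    have h2 : B^12 * (2^58 * n^4) < B^12 * r^10 := by gcongr
    have h3 : r^4 * 2^122 < r^4 * (B^12 * r^6) := by nlinarith
    have h4 := lt_of_mul_lt_mul_left h3 (by positivity)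
    refine lt_of_pow_lt_pow_left₀ 6 (by positivity) ?_
    calc ((2:ℝ)^20)^6 < 2^122 := by norm_num
      _ < _ := h4
      _ = _ := by ring
  have hr1 : 1 < r := by
    have : B^2 ≤ 1 := pow_le_one₀ hB.le hB1
    have : B^2 * r ≤ 1 * r := by gcongr
    linarith
  have hh : 2^9 * H ≤ B * r^2 := by
    have h1 : (2^14 * (H * n))^2 ≤ (r^4)^2 := by gcongr
    have h2 : H^3 * (2^14 * (H * n))^2 ≤ B^3 * (n^2 * r) * (r^4)^2 := by gcongr
    have h3 : n^2 * (2^28 * H^5) ≤ n^2 * (B^3 * r^9) := by nlinarith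
    have h4 := le_of_mul_le_mul_left h3 (by positivity)
    have h5 : B^3 * r^9 * 2^20 ≤ B^3 * r^9 * (B^2 * r) := by gcongr
    refine le_of_pow_le_pow_left₀ (n := 5) (by norm_num) (by positivity) ?_
    have h6 : 0 < H^5 := by positivity
    nlinarith
  have hBn : 2^16 ≤ B^2 * n := by
    have h1 : B^3 * n = B * (B^2 * n) := by ring
    have h2 : B * (B^2 * n) ≤ 1 * (B^2 * n) := by gcongr
    linarith
  have hHn : H ≤ B * n := by
    refine le_of_pow_le_pow_left₀ (n := 3) (by norm_num) (by positivity) ?_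
    calc H^3 ≤ _ := hc
      _ ≤ B^3 * (n^2 * n) := by gcongr
      _ = _ := by ring
  have h16 : 16 * H ≤ n := by
    have : B * n ≤ 1/16 * n := by gcongr
    linarith
  refine ⟨hg, hh, ?_, ?_, ?_, ?_, hHn, ?_, hrn, hr1⟩
  · refine le_of_pow_le_pow_left₀ (n := 2) (by norm_num) (by positivity) ?_
    have h1 : B^2 * (2^14 * (1 * n^3)) ≤ B^2 * M^2 := by
      have : 2^14 * (1 * n^3) ≤ 2^14 * (H * n^3) := by gcongr
      gcongr
      linarith
    have h2 : 2^14 * n^2 * 2^16 ≤ 2^14 * n^2 * (B^2 * n) := by gcongr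
    nlinarith
  · refine le_of_pow_le_pow_left₀ (n := 2) (by norm_num) (by positivity) ?_
    have h2 : 2^14 * H * n^2 * (16 * H) ≤ 2^14 * H * n^2 * n := by gcongr
    nlinarith
  · refine le_of_pow_le_pow_left₀ (n := 2) (by norm_num) (by positivity) ?_
    have := mul_le_mul hd he (by positivity) (by positivity)
    nlinarith
  · refine le_of_pow_le_pow_left₀ (n := 3) (by norm_num) (by positivity) ?_
    have h0 : H^3 ≤ n^2 * r := by
      calc H^3 ≤ _ := hc
        _ ≤ 1 * (n^2 * r) := by gcongr
        _ = _ := by ring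
    have h1 : n^4 ≤ r^10 := by
      have : 0 < n^4 := by positivity
      linarith
    calc (H^5)^3 = (H^3)^5 := by ring
      _ ≤ (n^2 * r)^5 := by gcongr
      _ = n^6 * r^5 * n^4 := by ring
      _ ≤ n^6 * r^5 * r^10 := by gcongr
      _ = _ := by ring
  · refine le_of_pow_le_pow_left₀ (n := 3) (by norm_num) (by positivity) ?_
    have h1 : 2^16 * r^2 * (2^16 * r) ≤ 2^16 * r^2 * (B^3 * n) := by gcongr
    have h2 : B^3 * (2^16 * (n * r^2)) ≤ B^3 * H^3 := by gcongr
    have h3 : 0 < r^3 := by positivity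
    nlinarith

lemma aux_K (B n r H ν : ℝ) (hB : 0 < B) (hB' : B ≤ 1/16) (hn : 0 < n) (hr : 0 < r)
    (hH : 1 ≤ H) (hν : 6 ≤ ν)
    (ha : 2^16 * (n * r^2) < H^3)
    (h : H ≤ B * n ^ ((ν-2)/(2*ν-6)) * r ^ ((ν-4)/(2*ν-6))) :
    2^16 * r < B^3 * n ∧ H^3 ≤ B^3 * (n^2 * r) := by
  have hd : 0 < 2*ν-6 := by linarith
  set a := (ν-2)/(2*ν-6) with hadef
  have hb : (ν-4)/(2*ν-6) = 1 - a := by rw [hadef, eq_sub_iff_add_eq, ← add_div, div_eq_one_iff_eq hd.ne']; ring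
  have ha1 : 1/3 ≤ a := by rw [hadef, le_div_iff₀ hd]; linarith
  have ha2 : a ≤ 2/3 := by rw [hadef, div_le_iff₀ hd]; linarith
  rw [hb] at h
  have hB3 : B^3 ≤ 1 := pow_le_one₀ hB.le (by linarith)
  have e : n ^ a * r ^ (1-a) = r * (n/r)^a := by
    rw [Real.rpow_sub hr, Real.div_rpow hn.le hr.le, Real.rpow_one]; field_simp
  rw [mul_assoc, e] at h
  have hq : 0 < n/r := by positivity
  have c3 : ((n/r)^((1:ℝ)/3))^3 = n/r := by
    rw [← Real.rpow_natCast, ← Real.rpow_mul hq.le]; norm_num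
  have c2 : ((n/r)^((2:ℝ)/3))^3 = (n/r)^2 := by
    rw [← Real.rpow_natCast, ← Real.rpow_mul hq.le, ← Real.rpow_natCast]; norm_num
  have hc : H^3 ≤ B^3 * (n^2 * r) := by
    rcases le_total (n/r) 1 with h1 | h1
    · exfalso
      have h2 : (n/r)^a ≤ (n/r)^((1:ℝ)/3) := Real.rpow_le_rpow_of_exponent_ge hq h1 ha1
      have h3 : H ≤ B * (r * (n/r)^((1:ℝ)/3)) := h.trans (by gcongr)
      have h4 : H^3 ≤ (B * (r * (n/r)^((1:ℝ)/3)))^3 := by gcongr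
      have h5 : (B * (r * (n/r)^((1:ℝ)/3)))^3 = B^3 * (n * r^2) := by
        rw [mul_pow, mul_pow, c3]; field_simp
      have h6 : B^3 * (n * r^2) ≤ 1 * (n * r^2) := by gcongr
      have : 0 < n * r^2 := by positivity
      linarith
    · have h2 : (n/r)^a ≤ (n/r)^((2:ℝ)/3) := Real.rpow_le_rpow_of_exponent_le h1 ha2
      have h3 : H ≤ B * (r * (n/r)^((2:ℝ)/3)) := h.trans (by gcongr)
      have h4 : H^3 ≤ (B * (r * (n/r)^((2:ℝ)/3)))^3 := by gcongr
      have h5 : (B * (r * (n/r)^((2:ℝ)/3)))^3 = B^3 * (n^2 * r) := by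
        rw [mul_pow, mul_pow, c2]; field_simp
      linarith
  refine ⟨?_, hc⟩
  have h7 : (n * r) * (2^16 * r) < (n * r) * (B^3 * n) := by nlinarith
  exact lt_of_mul_lt_mul_left h7 (by positivity)

lemma aux_A (B n r H M : ℝ) (hB : 0 < B) (hB' : B ≤ 1/16) (hn : 0 < n) (hr : 0 < r)
    (hH : 1 ≤ H)
    (ha : 2^16 * (n * r^2) < H^3) (hb : 2^16 * r < B^3 * n)
    (h : (H/r) ^ ((18:ℝ)/17) ≤ min (r^4/(H*n)) (M^2/(H*n^3))) :
    2^14 * (H * n) ≤ r^4 ∧ 2^14 * (H * n^3) ≤ M^2 := by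
  have hH0 : 0 < H := by linarith
  have hB3 : B^3 ≤ (1/16)^3 := by gcongr
  have h1 : 2^28 * r < n := by
    have : B^3 * n ≤ (1/16)^3 * n := by gcongr
    linarith
  have h2 : 2^14 * r ≤ H := by
    refine le_of_pow_le_pow_left₀ (n := 3) (by norm_num) (by positivity) ?_
    have h3 : r^2 * (2^28 * r) < r^2 * n := by gcongr
    have : 0 < r^3 := by positivity
    nlinarith
  have h3 : 2^14 ≤ H/r := by rw [le_div_iff₀ hr]; exact h2
  have h4 : (H/r)^(1:ℝ) ≤ (H/r) ^ ((18:ℝ)/17) :=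
    Real.rpow_le_rpow_of_exponent_le (by linarith) (by norm_num)
  rw [Real.rpow_one] at h4
  have h5 := h3.trans (h4.trans (h.trans (min_le_left _ _)))
  have h6 := h3.trans (h4.trans (h.trans (min_le_right _ _)))
  rw [le_div_iff₀ (by positivity)] at h5 h6
  exact ⟨h5, h6⟩

lemma aux_B (C₃ C₆ B₃ T n r H M : ℝ) (hC₃ : 2 ≤ C₃) (hC₆ : 2 ≤ C₆)
    (hB₃ : 0 < B₃) (hB₃' : B₃ ≤ (32*C₆) ^ (-(4:ℝ)/3))
    (hT : 0 < T) (hM : 0 < M) (hn : 0 < n) (hr : 0 < r)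
    (hH : 1 ≤ H) (h1220 : n * r^2 = C₃ * M^3 / (2*T))
    (h1 : M ≤ C₆ * T ^ ((1:ℝ)/2)) (h2 : n^3 ≤ B₃^3 * M^6 / (T^2 * H)) :
    2^14 * (H * n) ≤ r^4 ∧ 2^14 * (H * n^3) ≤ M^2 := by
  have hH0 : 0 < H := by linarith
  have hC0 : 0 < C₆ := by linarith
  have hb : B₃^3 * (32*C₆)^4 ≤ 1 := by
    have h3 : B₃^3 ≤ ((32*C₆) ^ (-(4:ℝ)/3))^3 := by gcongr
    have h4 : ((32*C₆) ^ (-(4:ℝ)/3))^3 = ((32*C₆)^4)⁻¹ := by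
      rw [← Real.rpow_natCast, ← Real.rpow_mul (by positivity), ← Real.rpow_natCast (32*C₆) 4,
        ← Real.rpow_neg (by positivity)]
      norm_num
    rw [h4] at h3
    calc B₃^3 * (32*C₆)^4 ≤ ((32*C₆)^4)⁻¹ * (32*C₆)^4 := by gcongr
      _ = 1 := inv_mul_cancel₀ (by positivity)
  have hM4 : M^4 ≤ C₆^4 * T^2 := by
    have h3 : M^4 ≤ (C₆ * T ^ ((1:ℝ)/2))^4 := by gcongr
    have h4 : (T ^ ((1:ℝ)/2))^4 = T^2 := by
      rw [← Real.rpow_natCast, ← Real.rpow_mul hT.le, ← Real.rpow_natCast T 2]; norm_num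
    rwa [mul_pow, h4] at h3
  rw [le_div_iff₀ (by positivity)] at h2
  have hb24 : B₃^3 * 2^24 ≤ 1 := by
    have h3 : B₃^3 * (32*2)^4 ≤ B₃^3 * (32*C₆)^4 := by gcongr
    norm_num at h3 ⊢
    linarith
  constructor
  · rw [eq_div_iff (by positivity)] at h1220
    have h3 : 2 * M^3 ≤ n * r^2 * (2*T) := by rw [h1220]; gcongr
    have h4 : M^3 ≤ n * r^2 * T := by linarith
    have h5 : (M^3)^2 ≤ (n * r^2 * T)^2 := by gcongr
    have h6 : B₃^3 * M^6 ≤ B₃^3 * (n * r^2 * T)^2 := by gcongr; linarith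
    have h7 : (n^2*T^2) * (H * n) ≤ (n^2*T^2) * (B₃^3 * r^4) := by nlinarith
    have h8 := le_of_mul_le_mul_left h7 (by positivity)
    have h9 : r^4 * (B₃^3 * 2^24) ≤ r^4 * 1 := by gcongr
    have : 0 < H * n := by positivity
    linarith
  · have h6 : B₃^3 * M^2 * M^4 ≤ B₃^3 * M^2 * (C₆^4 * T^2) := by gcongr
    have h7 : T^2 * (H * n^3) ≤ T^2 * (B₃^3 * C₆^4 * M^2) := by nlinarith
    have h8 := le_of_mul_le_mul_left h7 (by positivity)
    have h9 : M^2 * (B₃^3 * (32*C₆)^4) ≤ M^2 * 1 := by gcongr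
    have : 0 < H * n^3 := by positivity
    nlinarith

set_option maxHeartbeats 2000000 in
/-- Corollary 12.1.1, with `N = ⌈Ñ⌉` and `R = ⌈(C₃M³/(2NT))^{1/2}⌉`. -/
theorem corollary12_1_1 (C₃ C₆ B₁ B₃ T M H Ntil Rtil ν : ℝ)
    (hC₃ : 2 ≤ C₃) (hC₆ : 2 ≤ C₆)
    (hB₁ : 0 < B₁) (hB₁' : B₁ ≤ 1/16)
    (hB₃ : 0 < B₃) (hB₃' : B₃ ≤ (32*C₆) ^ (-(4:ℝ)/3))
    (hT : 0 < T) (hM : 0 < M) (hH : 1 ≤ H)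
    (h71 : 32 * C₃ ^ ((1:ℝ)/3) * M * T ^ (-(1:ℝ)/3) < H)
    (hN : 0 < Ntil) (hR : 0 < Rtil) (hν : 6 ≤ ν)
    (h1220 : Ntil * Rtil^2 = C₃ * M^3 / (2*T))
    (h1221 : H ≤ B₁ * Ntil ^ ((ν-2)/(2*ν-6)) * Rtil ^ ((ν-4)/(2*ν-6)))
    (hOr : (H/Rtil) ^ ((18:ℝ)/17) ≤ min (Rtil^4/(H*Ntil)) (M^2/(H*Ntil^3)) ∨
           (M ≤ C₆ * T ^ ((1:ℝ)/2) ∧ Ntil^3 ≤ B₃^3 * M^6 / (T^2 * H))) :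
    Ntil ≤ (⌈Ntil⌉₊ : ℝ) ∧ (⌈Ntil⌉₊ : ℝ) < 2 * Ntil ∧
    Rtil / Real.sqrt 2 < (⌈Real.sqrt (C₃ * M^3 / (2 * ⌈Ntil⌉₊ * T))⌉₊ : ℝ) ∧
    (⌈Real.sqrt (C₃ * M^3 / (2 * ⌈Ntil⌉₊ * T))⌉₊ : ℝ) < 2 * Rtil ∧
    (1 / ((⌈Real.sqrt (C₃ * M^3 / (2 * ⌈Ntil⌉₊ * T))⌉₊ : ℝ) - 1)^2 >
      2 * ⌈Ntil⌉₊ * T / (C₃ * M^3) ∧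
      2 * ⌈Ntil⌉₊ * T / (C₃ * M^3) ≥
        1 / ((⌈Real.sqrt (C₃ * M^3 / (2 * ⌈Ntil⌉₊ * T))⌉₊ : ℝ))^2) ∧
    H * (⌈Ntil⌉₊ : ℝ)^2 /
      (M * ((⌈Real.sqrt (C₃ * M^3 / (2 * ⌈Ntil⌉₊ * T))⌉₊ : ℝ))^2) < 1 ∧
    max (max (H/((⌈Real.sqrt (C₃ * M^3 / (2 * ⌈Ntil⌉₊ * T))⌉₊ : ℝ))^2)
             (((⌈Real.sqrt (C₃ * M^3 / (2 * ⌈Ntil⌉₊ * T))⌉₊ : ℝ))/H))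
        (max (H/(⌈Ntil⌉₊ : ℝ)) ((⌈Ntil⌉₊ : ℝ)/M)) ≤ B₁ ∧
    (H/((⌈Real.sqrt (C₃ * M^3 / (2 * ⌈Ntil⌉₊ * T))⌉₊ : ℝ))) ^ ((36:ℝ)/17) <
      (⌈Ntil⌉₊ : ℝ) *
        (((⌈Real.sqrt (C₃ * M^3 / (2 * ⌈Ntil⌉₊ * T))⌉₊ : ℝ))^4 /
          (H * (⌈Ntil⌉₊ : ℝ))) ^ ((1:ℝ)/2) *
        (M^2 / (H * (⌈Ntil⌉₊ : ℝ)^3)) ^ ((1:ℝ)/2) ∧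
    H ≤ 2 ^ ((1:ℝ)/4) * B₁ * (⌈Ntil⌉₊ : ℝ) ^ ((ν-2)/(2*ν-6)) *
      ((⌈Real.sqrt (C₃ * M^3 / (2 * ⌈Ntil⌉₊ * T))⌉₊ : ℝ)) ^ ((ν-4)/(2*ν-6)) ∧
    1 + M^2/T ≤ (⌈Real.sqrt (C₃ * M^3 / (2 * ⌈Ntil⌉₊ * T))⌉₊ : ℝ) *
      ((⌈Real.sqrt (C₃ * M^3 / (2 * ⌈Ntil⌉₊ * T))⌉₊ : ℝ)/H) ^ ((130:ℝ)/357) := by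
  have hH0 : 0 < H := by linarith
  have hC0 : 0 < C₃ := by linarith
  have ha : 2^16 * (Ntil * Rtil^2) < H^3 := by
    have h1 : (32 * C₃ ^ ((1:ℝ)/3) * M * T ^ (-(1:ℝ)/3))^3 < H^3 := by gcongr
    have h2 : (C₃ ^ ((1:ℝ)/3))^3 = C₃ := by
      rw [← Real.rpow_natCast, ← Real.rpow_mul hC0.le]; norm_num
    have h3 : (T ^ (-(1:ℝ)/3))^3 = T⁻¹ := by
      rw [← Real.rpow_natCast, ← Real.rpow_mul hT.le, ← Real.rpow_neg_one]; norm_num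
    rw [mul_pow, mul_pow, mul_pow, h2, h3] at h1
    rw [h1220]
    calc _ = (32:ℝ)^3 * C₃ * M^3 * T⁻¹ := by field_simp; norm_num
      _ < _ := h1
  obtain ⟨hb, hc⟩ := aux_K B₁ Ntil Rtil H ν hB₁ hB₁' hN hR hH hν ha h1221
  obtain ⟨hd, he⟩ : 2^14 * (H * Ntil) ≤ Rtil^4 ∧ 2^14 * (H * Ntil^3) ≤ M^2 := by
    rcases hOr with h | ⟨h1, h2⟩
    · exact aux_A B₁ Ntil Rtil H M hB₁ hB₁' hN hR hH ha hb h
    · exact aux_B C₃ C₆ B₃ T Ntil Rtil H M hC₃ hC₆ hB₃ hB₃' hT hM hN hR hH h1220 h1 h2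
  obtain ⟨hg, hh, hi, hj, hk, hl, hHn, hrH, hrn, hr1⟩ :=
    aux_core B₁ Ntil Rtil H M hB₁ hB₁' hN hR hH hM ha hb hc hd he
  have hn16 : 16 ≤ Ntil := by
    have : B₁ * Ntil ≤ 1/16 * Ntil := by gcongr
    linarith
  have hN1 : Ntil ≤ (⌈Ntil⌉₊ : ℝ) := Nat.le_ceil _
  have hN2 : (⌈Ntil⌉₊ : ℝ) < 2 * Ntil := by
    have := Nat.ceil_lt_add_one hN.le
    linarith
  generalize (⌈Ntil⌉₊ : ℝ) = N at *
  have hN0 : 0 < N := by linarith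
  have hs0 : 0 < C₃ * M^3 / (2 * N * T) := by positivity
  have hss : Real.sqrt (C₃ * M^3 / (2 * N * T)) ^ 2 = C₃ * M^3 / (2 * N * T) :=
    Real.sq_sqrt hs0.le
  have hsp : 0 < Real.sqrt (C₃ * M^3 / (2 * N * T)) := Real.sqrt_pos.2 hs0
  have hinv : 2 * N * T / (C₃ * M^3) = 1 / (Real.sqrt (C₃ * M^3 / (2 * N * T)) ^ 2) := by
    rw [hss]; field_simp
  have hNs : N * Real.sqrt (C₃ * M^3 / (2 * N * T)) ^ 2 = Ntil * Rtil^2 := by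
    rw [hss, h1220]; field_simp
  rw [hinv]
  generalize Real.sqrt (C₃ * M^3 / (2 * N * T)) = s at *
  have hR1 : s ≤ (⌈s⌉₊ : ℝ) := Nat.le_ceil _
  have hR2 : (⌈s⌉₊ : ℝ) < s + 1 := Nat.ceil_lt_add_one hsp.le
  generalize (⌈s⌉₊ : ℝ) = R at *
  have hsr : s ≤ Rtil := by
    refine le_of_pow_le_pow_left₀ (n := 2) (by norm_num) hR.le ?_
    have : Ntil * s^2 ≤ Ntil * Rtil^2 := by rw [← hNs]; gcongr
    exact le_of_mul_le_mul_left this hN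
  have hsr2 : Rtil^2 < 2 * s^2 := by
    have : Ntil * Rtil^2 < Ntil * (2 * s^2) := by
      rw [← hNs]
      have : N * s^2 < 2 * Ntil * s^2 := by gcongr
      linarith
    exact lt_of_mul_lt_mul_left this hN.le
  have hR0 : 0 < R := by linarith
  have hRlt : R < 2 * Rtil := by linarith
  have hsR2 : s^2 ≤ R^2 := by gcongr
  have hRR : Rtil^2 < 2 * R^2 := by linarith
  have hrbig : 2^20 < Rtil := by
    have : B₁^2 ≤ 1 := pow_le_one₀ hB₁.le (by linarith)
    have : B₁^2 * Rtil ≤ 1 * Rtil := by gcongr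
    linarith
  have hs1 : 1 < s := by
    have h1 : (2:ℝ)^2 < Rtil^2 := by gcongr; linarith
    refine lt_of_pow_lt_pow_left₀ 2 hsp.le ?_
    linarith
  have hq2 : Rtil / Real.sqrt 2 < R := by
    rw [div_lt_iff₀ (by positivity)]
    refine lt_of_pow_lt_pow_left₀ 2 (by positivity) ?_
    rw [mul_pow, Real.sq_sqrt (by norm_num)]
    linarith
  have hRH : R / H ≤ B₁ := by rw [div_le_iff₀ hH0]; linarith
  refine ⟨hN1, hN2, hq2, hRlt, ⟨?_, ?_⟩, ?_, ?_, ?_, ?_, ?_⟩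
  · have h1 : 0 < R - 1 := by linarith
    have h2 : R - 1 < s := by linarith
    exact one_div_lt_one_div_of_lt (by positivity) (by gcongr)
  · exact one_div_le_one_div_of_le (by positivity) hsR2
  · rw [div_lt_one (by positivity)]
    have h1 : H * N^2 ≤ H * (2*Ntil)^2 := by gcongr
    have h2 : M * Rtil^2 < M * (2 * R^2) := by gcongr
    have : 0 < H * Ntil^2 := by positivity
    nlinarith
  · refine max_le (max_le ?_ hRH) (max_le ?_ ?_)
    · rw [div_le_iff₀ (by positivity)]
      have h2 : B₁ * Rtil^2 < B₁ * (2 * R^2) := by gcongr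
      linarith
    · rw [div_le_iff₀ hN0]
      have h2 : B₁ * Ntil ≤ B₁ * N := by gcongr
      linarith
    · rw [div_le_iff₀ hM]
      linarith
  · have e1 : N * (R^4 / (H * N)) ^ ((1:ℝ)/2) * (M^2 / (H * N^3)) ^ ((1:ℝ)/2)
        = R^2 * M / (H * N) := by
      rw [mul_assoc, ← Real.mul_rpow (by positivity) (by positivity), ← Real.sqrt_eq_rpow]
      have : R^4 / (H * N) * (M^2 / (H * N^3)) = (R^2 * M / (H * N^2))^2 := by
        field_simp
      rw [this, Real.sqrt_sq (by positivity)]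
      field_simp
    rw [e1]
    have hx0 : 0 < H / Rtil := by positivity
    have hx1 : 1 ≤ H / Rtil := by
      rw [le_div_iff₀ hR]
      have : B₁ * H ≤ 1 * H := by gcongr; linarith
      linarith
    have h1 : (H/Rtil)^((5:ℝ)/2) ≤ Ntil := by
      refine le_of_pow_le_pow_left₀ (n := 2) (by norm_num) hN.le ?_
      have : ((H/Rtil)^((5:ℝ)/2))^2 = (H/Rtil)^5 := by
        rw [← Real.rpow_natCast, ← Real.rpow_mul hx0.le, ← Real.rpow_natCast (H/Rtil) 5]; norm_num
      rw [this, div_pow, div_le_iff₀ (by positivity)]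
      exact hl
    have h2 : (H/Rtil)^((36:ℝ)/17) ≤ (H/Rtil)^((5:ℝ)/2) :=
      Real.rpow_le_rpow_of_exponent_le hx1 (by norm_num)
    have h3 : H / R ≤ 2 * (H / Rtil) := by
      rw [← mul_div_assoc, div_le_div_iff₀ hR0 hR]
      have h0 : Rtil ≤ 2 * R := by
        refine le_of_pow_le_pow_left₀ (n := 2) (by norm_num) (by positivity) ?_
        have : 0 < R^2 := by positivity
        linarith
      have : H * Rtil ≤ H * (2 * R) := by gcongr
      linarith
    have h4 : (H/R)^((36:ℝ)/17) ≤ (2 * (H/Rtil))^((36:ℝ)/17) :=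
      Real.rpow_le_rpow (by positivity) h3 (by norm_num)
    rw [Real.mul_rpow (by norm_num) hx0.le] at h4
    have h5 : (2:ℝ)^((36:ℝ)/17) ≤ 2^(3:ℝ) :=
      Real.rpow_le_rpow_of_exponent_le (by norm_num) (by norm_num)
    have h6 : (2:ℝ)^(3:ℝ) = 8 := by norm_num
    have h7 : (H/R)^((36:ℝ)/17) ≤ 8 * Ntil := by
      calc _ ≤ _ := h4
        _ ≤ 8 * Ntil := mul_le_mul (h5.trans h6.le) (h2.trans h1) (by positivity) (by norm_num)
    refine h7.trans_lt ?_
    rw [lt_div_iff₀ (by positivity)]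
    have h8 : 8 * Ntil * (H * N) ≤ 8 * Ntil * (H * (2 * Ntil)) := by gcongr
    have h9 : M * Rtil^2 < M * (2 * R^2) := by gcongr
    have : 0 < H * Ntil^2 := by positivity
    nlinarith
  · have hdn : 0 < 2*ν-6 := by linarith
    have ha0 : 0 ≤ (ν-2)/(2*ν-6) := div_nonneg (by linarith) hdn.le
    have hb0 : 0 ≤ (ν-4)/(2*ν-6) := div_nonneg (by linarith) hdn.le
    have hb1 : (ν-4)/(2*ν-6) ≤ 1/2 := by rw [div_le_iff₀ hdn]; linarith
    generalize (ν-2)/(2*ν-6) = a at *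
    generalize (ν-4)/(2*ν-6) = b at *
    have h1 : Ntil ^ a ≤ N ^ a := Real.rpow_le_rpow hN.le hN1 ha0
    have h2 : Rtil ≤ Real.sqrt 2 * R := by
      rw [div_lt_iff₀ (by positivity)] at hq2
      linarith
    have h3 : Rtil ^ b ≤ (Real.sqrt 2 * R) ^ b := Real.rpow_le_rpow hR.le h2 hb0
    rw [Real.mul_rpow (by positivity) hR0.le] at h3
    have h4 : (Real.sqrt 2)^b ≤ 2^((1:ℝ)/4) := by
      rw [Real.sqrt_eq_rpow, ← Real.rpow_mul (by norm_num)]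
      exact Real.rpow_le_rpow_of_exponent_le (by norm_num) (by linarith)
    calc H ≤ _ := h1221
      _ ≤ B₁ * N^a * (2^((1:ℝ)/4) * R^b) := by
        gcongr
        exact h3.trans (by gcongr)
      _ = _ := by ring
  · have hRH0 : 0 < R / H := by positivity
    have h1 : (R/H)^(1:ℝ) ≤ (R/H)^((130:ℝ)/357) :=
      Real.rpow_le_rpow_of_exponent_ge hRH0 (by linarith) (by norm_num)
    rw [Real.rpow_one] at h1
    have h2 : R * (R/H) ≤ R * (R/H)^((130:ℝ)/357) := by gcongr
    refine le_trans ?_ h2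
    have h3 : M^2 / T ≤ Ntil * Rtil^2 / M := by
      rw [h1220, div_div, div_le_div_iff₀ hT (by positivity)]
      have : 2 * (M^3 * T) ≤ C₃ * (M^3 * T) := by gcongr
      linarith
    have h4 : Ntil * Rtil^2 / M ≤ Rtil^2 / (2^9 * H) := by
      rw [div_le_div_iff₀ hM (by positivity)]
      have : Rtil^2 * (2^9 * (H * Ntil)) ≤ Rtil^2 * M := by gcongr
      linarith
    have h5 : 1 ≤ Rtil^2 / (2^9 * H) := by
      rw [le_div_iff₀ (by positivity)]
      have : B₁ * Rtil^2 ≤ 1 * Rtil^2 := by gcongr; linarith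
      linarith
    have h6 : 2 * (Rtil^2 / (2^9 * H)) ≤ R * (R/H) := by
      rw [← mul_div_assoc, ← mul_div_assoc, div_le_div_iff₀ (by positivity) hH0]
      have : H * Rtil^2 ≤ H * (2 * R^2) := by gcongr
      have : 0 < H * R^2 := by positivity
      linarith
    linarith
end

section
/- There exist absolute constants C₁ > 0 and c₂ > 0 such that for all t, U > 0 with (πt)^{1/2} ≤ U² ≤ t/(2π), at least one of the following holds: (i) I(t,U) ≤ C₁ log t; or (ii) there exist T ∈ [t/(4π), 3t/(4π)], M ∈ [1, (2T)^{1/2}] and M₁ ∈ [M/2, M] such that |S₍*₎(T;U;M,M₁)| / M ≥ c₂ · I(t,U)/log t, where S₍*₎(T;U;M,M₁) := Σ_{0<h≤(e^{1/U}−1)M/2} Σ_{M₁<m≤M} ((m+h)/(m−h))^{2πiT}, the sums being over positive integers h and m (note that the stated hypotheses force h < M/2 < m, so every summand is well defined). -/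
open MeasureTheory Real

/-- The sum `S₊(T;U;M,M₁) = Σ_{0<h≤(e^{1/U}−1)M/2} Σ_{M₁<m≤M} ((m+h)/(m−h))^{2πiT}`,
where `x^{iθ} = exp(iθ log x)`. -/
noncomputable def Sstar (T U M M₁ : ℝ) : ℂ :=
  ∑ h ∈ Finset.Ioc 0 ⌊(Real.exp (1/U) - 1) * M / 2⌋₊,
    ∑ m ∈ Finset.Ioc ⌊M₁⌋₊ ⌊M⌋₊,
      Complex.exp (2 * Real.pi * T * Complex.I *
        Real.log (((m:ℝ) + h) / ((m:ℝ) - h)))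

noncomputable def bet (u : ℝ) : ℝ := ∑' ν : ℕ, Real.cos (2*π*((ν:ℝ)+1)*u)/(π^2*((ν:ℝ)+1)^2)

lemma bet_summable_bd : Summable (fun ν : ℕ => 1/(π^2*((ν:ℝ)+1)^2)) := by
  have h := (summable_nat_add_iff 1).mpr (Real.summable_one_div_nat_pow.mpr (one_lt_two : 1 < 2))
  have := h.mul_left (1/π^2)
  refine this.congr ?_
  intro ν
  push_cast
  field_simp

lemma bet_term_bd (u : ℝ) (ν : ℕ) :
    ‖Real.cos (2*π*((ν:ℝ)+1)*u)/(π^2*((ν:ℝ)+1)^2)‖ ≤ 1/(π^2*((ν:ℝ)+1)^2) := by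
  rw [norm_div, Real.norm_eq_abs, Real.norm_eq_abs (π^2*((ν:ℝ)+1)^2), abs_of_nonneg (a := π^2*((ν:ℝ)+1)^2) (by positivity)]
  gcongr
  exact Real.abs_cos_le_one _

lemma bet_continuous : Continuous bet :=
  continuous_tsum (fun ν => by fun_prop) bet_summable_bd (fun ν u => bet_term_bd u ν)

lemma bet_bound : ∃ B : ℝ, 0 ≤ B ∧ ∀ u, |bet u| ≤ B :=
  ⟨_, tsum_nonneg (fun ν => by positivity), fun u => tsum_of_norm_bounded bet_summable_bd.hasSum (bet_term_bd u)⟩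

lemma bet_poly (n : ℤ) (u : ℝ) (h1 : n ≤ u) (h2 : u ≤ n + 1) :
    bet u = (u-n)^2 - (u-n) + 1/6 := by
  have h := hasSum_one_div_nat_pow_mul_cos (k := 1) one_ne_zero (x := u - n) ⟨by linarith, by linarith⟩
  have h0 := (hasSum_nat_add_iff' 1).mpr h
  simp only [Finset.range_one, Finset.sum_singleton] at h0
  have h3 := h0.mul_left (1/π^2)
  have e : bet u = ∑' ν : ℕ, 1 / π ^ 2 * (1 / ((ν + 1 : ℕ):ℝ) ^ (2 * 1) * cos (2 * π * ((ν + 1 : ℕ):ℝ) * (u - n))) := by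
    unfold bet
    refine tsum_congr fun ν => ?_
    have : 2*π*((ν+1:ℕ):ℝ)*(u-n) = 2*π*((ν:ℝ)+1)*u - ((((ν:ℤ)+1)*n : ℤ):ℝ)*(2*π) := by
      push_cast; ring
    rw [this, Real.cos_sub_int_mul_two_pi]
    push_cast
    field_simp
  rw [e, h3.tsum_eq]
  have := bernoulliFun_two (u - n)
  unfold bernoulliFun at this
  simp only [mul_one] at *
  rw [this]
  norm_num
  field_simp

noncomputable def xh (N : ℕ) : ℝ := N + 1/2

lemma xh_pos (N : ℕ) : 0 < xh N := by unfold xh; positivity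

noncomputable def RN (s : ℂ) (N : ℕ) : ℂ :=
  (xh N : ℂ)^(1-s)/(s-1) - (s/24)*(xh N : ℂ)^(-s-1)
   - s*(s+1)/2 * ∫ u in Set.Ioi (xh N), (bet u : ℂ)*(u:ℂ)^(-s-2)

lemma cpow_hasDeriv (c : ℂ) (u : ℝ) (hu : 0 < u) :
    HasDerivAt (fun u : ℝ => (u:ℂ)^c) (c * (u:ℂ)^(c-1)) u := by
  have h0 : HasDerivAt (fun z : ℂ => z^c) (c * (u:ℂ)^(c-1)) (u:ℂ) := by
    simpa using (hasDerivAt_id (u:ℂ)).cpow_const (c := c) (by left; simpa using hu)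
  exact h0.comp_ofReal

lemma bet_integrableOn {s : ℂ} (hs : 0 < s.re) {x : ℝ} (hx : 0 < x) :
    IntegrableOn (fun u : ℝ => (bet u : ℂ)*(u:ℂ)^(-s-2)) (Set.Ioi x) := by
  obtain ⟨B, hB, hb⟩ := bet_bound
  have h1 : IntegrableOn (fun u : ℝ => (u:ℂ)^(-s-2)) (Set.Ioi x) :=
    integrableOn_Ioi_cpow_of_lt (by simp; linarith) hx
  refine Integrable.bdd_mul (c := B) h1 ?_ ?_
  · exact (Complex.continuous_ofReal.comp bet_continuous).aestronglyMeasurable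
  · exact Filter.Eventually.of_forall fun u => by simpa using hb u

lemma E_piece (s : ℂ) (hs1 : s ≠ 1) (n : ℤ) (a b : ℝ) (ha : 0 < a) (hab : a ≤ b) (h1 : n ≤ a) (h2 : b ≤ n+1) :
    (s*(s+1)/2) * ∫ u in a..b, (bet u : ℂ)*(u:ℂ)^(-s-2) =
      (-(s/2)*((b-n)^2-(b-n)+1/6)*(b:ℂ)^(-s-1) - (b-n-1/2)*(b:ℂ)^(-s) + (b:ℂ)^(1-s)/(1-s))
      - (-(s/2)*((a-n)^2-(a-n)+1/6)*(a:ℂ)^(-s-1) - (a-n-1/2)*(a:ℂ)^(-s) + (a:ℂ)^(1-s)/(1-s)) := by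
  rw [← intervalIntegral.integral_const_mul]
  have hcongr : ∫ u in a..b, (s*(s+1)/2) * ((bet u : ℂ)*(u:ℂ)^(-s-2)) =
     ∫ u in a..b, (s*(s+1)/2) * (((u-n:ℂ)^2-(u-n)+1/6)*(u:ℂ)^(-s-2)) := by
    refine intervalIntegral.integral_congr fun u hu => ?_
    rw [Set.uIcc_of_le hab] at hu
    have := bet_poly n u (h1.trans hu.1) (hu.2.trans h2)
    simp only [this]; push_cast; ring
  rw [hcongr]
  have hpos : ∀ u ∈ Set.uIcc a b, 0 < u := by
    intro u hu; rw [Set.uIcc_of_le hab] at hu; exact ha.trans_le hu.1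
  have hs1' : (1:ℂ) - s ≠ 0 := sub_ne_zero.mpr (Ne.symm hs1)
  rw [intervalIntegral.integral_eq_sub_of_hasDerivAt (f := fun u : ℝ =>
    (-(s/2)*(((u:ℂ)-n)^2-((u:ℂ)-n)+1/6)*(u:ℂ)^(-s-1) - ((u:ℂ)-n-1/2)*(u:ℂ)^(-s) + (u:ℂ)^(1-s)/(1-s)))]
  · intro u hu
    have hu0 := hpos u hu
    have hu0' : (u:ℂ) ≠ 0 := by exact_mod_cast hu0.ne'
    have d1 := cpow_hasDeriv (-s-1) u hu0
    have d2 := cpow_hasDeriv (-s) u hu0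
    have d3 := cpow_hasDeriv (1-s) u hu0
    have d0 : HasDerivAt (fun u : ℝ => (u:ℂ)) 1 u := (hasDerivAt_id u).ofReal_comp
    have dn : HasDerivAt (fun u : ℝ => (u:ℂ)-n) 1 u := d0.sub_const _
    have D := (((((dn.pow 2).sub dn).add_const (1/6)).const_mul (-(s/2))).mul d1).sub
      ((dn.sub_const (1/2)).mul d2) |>.add (d3.div_const (1-s))
    refine D.congr_deriv ?_
    simp only [Pi.sub_apply, Pi.pow_apply]
    rw [show -s-1-1 = -s-2 by ring, show (1-s-1) = -s by ring]
    have e : (u:ℂ)^(-s) = (u:ℂ)^(-s-1) * u := by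
      rw [show -s = (-s-1)+1 by ring, Complex.cpow_add _ _ hu0', Complex.cpow_one]; ring_nf
    field_simp
    simp
    ring
  · apply ContinuousOn.intervalIntegrable
    apply ContinuousOn.mul continuousOn_const
    apply ContinuousOn.mul
    · fun_prop
    · intro u hu
      exact (cpow_hasDeriv _ u (hpos u hu)).continuousAt.continuousWithinAt

lemma RN_diff {s : ℂ} (hs : 0 < s.re) (hs1 : s ≠ 1) (N : ℕ) :
    RN s N - RN s (N+1) = ((N+1:ℕ):ℂ)^(-s) := by
  have hI : ∀ a b : ℝ, 0 < a → a ≤ b →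
      IntervalIntegrable (fun u : ℝ => (bet u : ℂ)*(u:ℂ)^(-s-2)) volume a b := by
    intro a b ha hab
    rw [intervalIntegrable_iff_integrableOn_Ioc_of_le hab]
    exact (bet_integrableOn hs ha).mono_set Set.Ioc_subset_Ioi_self
  have hx := xh_pos N
  have hsplit : (∫ u in Set.Ioi (xh N), (bet u : ℂ)*(u:ℂ)^(-s-2))
    = (∫ u in (xh N)..((N:ℝ)+1), (bet u : ℂ)*(u:ℂ)^(-s-2)) +
      (∫ u in ((N:ℝ)+1)..(xh (N+1)), (bet u : ℂ)*(u:ℂ)^(-s-2)) +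
      ∫ u in Set.Ioi (xh (N+1)), (bet u : ℂ)*(u:ℂ)^(-s-2) := by
    rw [intervalIntegral.integral_add_adjacent_intervals]
    rotate_left
    · apply hI _ _ hx; unfold xh; linarith
    · apply hI _ _ (by positivity); unfold xh; push_cast; linarith
    rw [← intervalIntegral.integral_Ioi_sub_Ioi (bet_integrableOn hs hx) (by unfold xh; push_cast; linarith)]
    ring
  have p1 := E_piece s hs1 N (xh N) ((N:ℝ)+1) hx (by unfold xh; linarith) (by unfold xh; push_cast; linarith) (by push_cast; linarith)
  have p2 := E_piece s hs1 (N+1) ((N:ℝ)+1) (xh (N+1)) (by positivity) (by unfold xh; push_cast; linarith) (by push_cast; linarith) (by unfold xh; push_cast; linarith)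
  unfold RN
  rw [hsplit, mul_add, mul_add, p1, p2]
  have hs1' : (1:ℂ) - s ≠ 0 := sub_ne_zero.mpr (Ne.symm hs1)
  have hs1b : s - 1 ≠ 0 := sub_ne_zero.mpr hs1
  have e1 : ∀ z : ℂ, z/(s-1) = - (z/(1-s)) := by
    intro z; rw [← neg_sub 1 s, div_neg]
  rw [e1, e1]
  have e3 : ((xh N : ℝ):ℂ) - ((N:ℤ):ℂ) = 1/2 := by unfold xh; push_cast; ring
  have e4 : ((xh (N+1) : ℝ):ℂ) - (((N:ℤ)+1 : ℤ):ℂ) = 1/2 := by unfold xh; push_cast; ring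
  rw [e3, e4]
  push_cast
  ring

lemma tendsto_xh_cpow {c : ℂ} (hc : c.re < 0) :
    Filter.Tendsto (fun N : ℕ => (xh N : ℂ)^c) Filter.atTop (nhds 0) := by
  rw [tendsto_zero_iff_norm_tendsto_zero]
  have : (fun N : ℕ => ‖(xh N : ℂ)^c‖) = fun N : ℕ => (xh N)^(-(-c.re)) := by
    funext N; rw [Complex.norm_cpow_eq_rpow_re_of_pos (xh_pos N), neg_neg]
  rw [this]
  have h : Filter.Tendsto xh Filter.atTop Filter.atTop :=
    Filter.tendsto_atTop_add_const_right _ _ tendsto_natCast_atTop_atTop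
  exact (tendsto_rpow_neg_atTop (by linarith)).comp h

lemma RN_tendsto {s : ℂ} (hs : 1 < s.re) :
    Filter.Tendsto (fun N => RN s N) Filter.atTop (nhds 0) := by
  have h1 : Filter.Tendsto (fun N : ℕ => (xh N : ℂ)^(1-s)) Filter.atTop (nhds 0) :=
    tendsto_xh_cpow (by simp; linarith)
  have h2 : Filter.Tendsto (fun N : ℕ => (xh N : ℂ)^(-s-1)) Filter.atTop (nhds 0) :=
    tendsto_xh_cpow (by simp; linarith)
  have hxt : Filter.Tendsto xh Filter.atTop Filter.atTop :=
    Filter.tendsto_atTop_add_const_right _ _ tendsto_natCast_atTop_atTop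
  have h3 : Filter.Tendsto (fun N : ℕ => ∫ u in Set.Ioi (xh N), (bet u : ℂ)*(u:ℂ)^(-s-2)) Filter.atTop (nhds 0) := by
    have hintg := bet_integrableOn (s := s) (by linarith) (xh_pos 0)
    have h := (intervalIntegral_tendsto_integral_Ioi (xh 0) hintg hxt)
    have h' := h.const_sub (∫ u in Set.Ioi (xh 0), (bet u : ℂ)*(u:ℂ)^(-s-2))
    rw [sub_self] at h'
    refine h'.congr fun N => ?_
    rw [← intervalIntegral.integral_Ioi_sub_Ioi hintg (by unfold xh; push_cast; linarith [(Nat.cast_nonneg N : (0:ℝ) ≤ N)])]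
    ring
  have := ((h1.div_const (s-1)).sub (h2.const_mul (s/24))).sub (h3.const_mul (s*(s+1)/2))
  simpa [RN] using this

lemma zeta_RN_gt {s : ℂ} (hs : 1 < s.re) (N : ℕ) :
    riemannZeta s = ∑ n ∈ Finset.range N, ((n+1:ℕ):ℂ)^(-s) + RN s N := by
  have hs1 : s ≠ 1 := by rintro rfl; simp at hs
  have h0 : ∀ K, ∑ n ∈ Finset.range K, ((n+1:ℕ):ℂ)^(-s) + RN s K = RN s 0 := by
    intro K
    induction K with
    | zero => simp
    | succ K ih =>
      rw [Finset.sum_range_succ, ← RN_diff (by linarith) hs1 K, ← ih]; ring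
  rw [h0, zeta_eq_tsum_one_div_nat_add_one_cpow hs]
  have hsum : Summable (fun n : ℕ => 1 / ((n:ℂ)+1)^s) := by
    have := (summable_nat_add_iff 1).mpr (Complex.summable_one_div_nat_cpow.mpr hs)
    simpa using this
  have t1 := hsum.hasSum.tendsto_sum_nat
  have t2 : Filter.Tendsto (fun K => ∑ n ∈ Finset.range K, 1 / ((n:ℂ)+1)^s) Filter.atTop (nhds (RN s 0)) := by
    have := (RN_tendsto hs).const_sub (RN s 0)
    rw [sub_zero] at this
    refine this.congr fun K => ?_
    rw [← h0 K, add_sub_cancel_right]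
    refine Finset.sum_congr rfl fun n _ => ?_
    rw [Complex.cpow_neg]; push_cast; rw [one_div]
  exact tendsto_nhds_unique t1 t2

lemma zeta_RN {s : ℂ} (hs : 0 < s.re) (him : 0 < s.im) (N : ℕ) :
    riemannZeta s = ∑ n ∈ Finset.range N, ((n+1:ℕ):ℂ)^(-s) + RN s N := by
  set V : Set ℂ := {z | 0 < z.re} ∩ {z | 0 < z.im} with hV
  have hVo : IsOpen V := (isOpen_lt continuous_const Complex.continuous_re).inter (isOpen_lt continuous_const Complex.continuous_im)
  have hVc : Convex ℝ V := (convex_halfSpace_re_gt 0).inter (convex_halfSpace_im_gt 0)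
  have hne : ∀ z ∈ V, z ≠ 1 := by rintro z ⟨_, h⟩ rfl; simp at h
  have hx := xh_pos N
  have hx0 : (xh N : ℂ) ≠ 0 := by exact_mod_cast hx.ne'
  have a1 : AnalyticOnNhd ℂ riemannZeta V :=
    DifferentiableOn.analyticOnNhd (fun z hz => (differentiableAt_riemannZeta (hne z hz)).differentiableWithinAt) hVo
  have a2 : AnalyticOnNhd ℂ (fun s => ∑ n ∈ Finset.range N, ((n+1:ℕ):ℂ)^(-s) + RN s N) V := by
    refine DifferentiableOn.analyticOnNhd (fun z hz => DifferentiableAt.differentiableWithinAt ?_) hVo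
    have hz1 : z - 1 ≠ 0 := sub_ne_zero.mpr (hne z hz)
    obtain ⟨B, hB, hb⟩ := bet_bound
    have hm : (fun s : ℂ => ∫ u in Set.Ioi (xh N), (bet u : ℂ)*(u:ℂ)^(-s-2))
       = fun s => mellin (Set.indicator (Set.Ioi (xh N)) (fun u => (bet u:ℂ))) (-s-1) := by
      funext s
      unfold mellin
      rw [← integral_indicator measurableSet_Ioi, ← integral_indicator measurableSet_Ioi]
      congr 1; funext u
      by_cases hu : xh N < u
      · have : 0 < u := hx.trans hu
        simp [Set.indicator, hu, this]
        rw [mul_comm]; congr 2; ring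
      · simp [Set.indicator, hu]
    have hmd : DifferentiableAt ℂ (fun s : ℂ => ∫ u in Set.Ioi (xh N), (bet u : ℂ)*(u:ℂ)^(-s-2)) z := by
      rw [hm]
      have hd : DifferentiableAt ℂ (fun s : ℂ => -s-1) z := by fun_prop
      refine DifferentiableAt.comp z (f := fun s : ℂ => -s-1) (g := mellin (Set.indicator (Set.Ioi (xh N)) (fun u => (bet u:ℂ)))) ?_ hd
      refine mellin_differentiableAt_of_isBigO_rpow (a := 0) (b := -z.re-2) ?_ ?_ ?_ ?_ ?_
      · apply LocallyIntegrable.locallyIntegrableOn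
        apply LocallyIntegrable.indicator _ measurableSet_Ioi
        exact (Complex.continuous_ofReal.comp bet_continuous).locallyIntegrable
      · refine Asymptotics.IsBigO.of_bound B (Filter.Eventually.of_forall fun u => ?_)
        simp only [neg_zero, Real.rpow_zero, norm_one, mul_one]
        refine (norm_indicator_le_norm_self _ _).trans ?_
        simpa using hb u
      · have := hz.1; simp at this ⊢; linarith
      · have : (Set.indicator (Set.Ioi (xh N)) (fun u => (bet u:ℂ))) =ᶠ[nhdsWithin 0 (Set.Ioi 0)] fun _ => 0 := by
          have : ∀ᶠ u : ℝ in nhdsWithin 0 (Set.Ioi 0), u < xh N :=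
            mem_nhdsWithin_of_mem_nhds (Iio_mem_nhds hx)
          filter_upwards [this] with u hu
          simp [Set.indicator, hu.le]
        exact this.trans_isBigO (Asymptotics.isBigO_zero _ _)
      · simp
    unfold RN
    have hn : ∀ n : ℕ, ((n:ℂ)+1) ≠ 0 := fun n => Nat.cast_add_one_ne_zero n
    have hp : ∀ (c : ℂ) (f : ℂ → ℂ), c ≠ 0 → DifferentiableAt ℂ f z → DifferentiableAt ℂ (fun s => c^(f s)) z :=
      fun c f hc hf => hf.const_cpow (Or.inl hc)
    refine DifferentiableAt.add ?_ (DifferentiableAt.sub (DifferentiableAt.sub ?_ ?_) ?_)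
    · refine DifferentiableAt.fun_sum fun n _ => ?_
      exact hp _ _ (by push_cast; exact hn n) (by fun_prop)
    · exact (hp _ _ hx0 (by fun_prop)).div (by fun_prop) hz1
    · exact DifferentiableAt.mul (by fun_prop) (hp _ _ hx0 (by fun_prop))
    · exact DifferentiableAt.mul (by fun_prop) hmd
  have h2 : (2 + Complex.I) ∈ V := by simp [hV]
  refine a1.eqOn_of_preconnected_of_eventuallyEq a2 hVc.isPreconnected h2 ?_ ⟨hs, him⟩
  have : ∀ᶠ z : ℂ in nhds (2 + Complex.I), 1 < z.re :=
    (isOpen_lt continuous_const Complex.continuous_re).mem_nhds (by simp)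
  filter_upwards [this] with z hz
  exact zeta_RN_gt hz N

noncomputable def ee (ν u : ℝ) : ℂ := Complex.exp (2*π*ν*u*Complex.I)

lemma ee_norm (ν u : ℝ) : ‖ee ν u‖ = 1 := by
  have : ee ν u = Complex.exp (((2*π*ν*u : ℝ):ℂ)*Complex.I) := by unfold ee; push_cast; rfl
  rw [this, Complex.norm_exp_ofReal_mul_I]

lemma ee_hasDeriv (ν u : ℝ) : HasDerivAt (fun u : ℝ => ee ν u) (2*π*ν*Complex.I * ee ν u) u := by
  have h : HasDerivAt (fun z : ℂ => Complex.exp (2*π*ν*z*Complex.I)) (2*π*ν*Complex.I * ee ν u) (u:ℂ) := by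
    have := (((hasDerivAt_id (u:ℂ)).const_mul (2*π*ν:ℂ)).mul_const Complex.I).cexp
    refine this.congr_deriv ?_
    simp [ee]; ring
  exact h.comp_ofReal

lemma ee_cont (ν : ℝ) : Continuous (fun u : ℝ => ee ν u) := by unfold ee; fun_prop

noncomputable def JJ (ν : ℝ) (c : ℂ) (x : ℝ) : ℂ := ∫ u in Set.Ioi x, ee ν u * (u:ℂ)^c

lemma JJ_int (ν : ℝ) {c : ℂ} (hc : c.re < -1) {x : ℝ} (hx : 0 < x) :
    IntegrableOn (fun u : ℝ => ee ν u * (u:ℂ)^c) (Set.Ioi x) := by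
  refine Integrable.bdd_mul (c := 1) (integrableOn_Ioi_cpow_of_lt hc hx) (ee_cont ν).aestronglyMeasurable ?_
  exact Filter.Eventually.of_forall fun u => (ee_norm ν u).le

lemma JJ_parts (ν : ℝ) {c : ℂ} (hc : c.re < -1) {x : ℝ} (hx : 0 < x) :
    2*π*ν*Complex.I * JJ ν c x + c * JJ ν (c-1) x = - (ee ν x * (x:ℂ)^c) := by
  have hd : ∀ u ∈ Set.Ici x, HasDerivAt (fun u : ℝ => ee ν u * (u:ℂ)^c)
      (2*π*ν*Complex.I * (ee ν u * (u:ℂ)^c) + c * (ee ν u * (u:ℂ)^(c-1))) u := by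
    intro u hu
    have hu0 : 0 < u := hx.trans_le hu
    refine ((ee_hasDeriv ν u).mul (cpow_hasDeriv c u hu0)).congr_deriv ?_
    ring
  have hi1 := (JJ_int ν hc hx).const_mul (2*π*ν*Complex.I)
  have hi2 := (JJ_int ν (c := c-1) (by simp; linarith) hx).const_mul c
  have ht : Filter.Tendsto (fun u : ℝ => ee ν u * (u:ℂ)^c) Filter.atTop (nhds 0) := by
    rw [tendsto_zero_iff_norm_tendsto_zero]
    have h := tendsto_rpow_neg_atTop (y := -c.re) (by linarith)
    refine h.congr' ?_
    filter_upwards [Filter.eventually_gt_atTop 0] with u hu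
    rw [norm_mul, ee_norm, one_mul, Complex.norm_cpow_eq_rpow_re_of_pos hu, neg_neg]
  have := integral_Ioi_of_hasDerivAt_of_tendsto' hd (hi1.add hi2) ht
  rw [integral_add hi1 hi2, integral_const_mul, integral_const_mul, zero_sub] at this
  exact this

noncomputable def AA (s : ℂ) (ν x : ℝ) : ℂ := s/(2*π*ν*Complex.I) * JJ ν (-s-1) x

lemma AA_hasSum {s : ℂ} (hs : 0 < s.re) (N : ℕ) :
    HasSum (fun ν : ℕ => AA s ((ν:ℝ)+1) (xh N) + AA s (-((ν:ℝ)+1)) (xh N))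
      (RN s N - (xh N : ℂ)^(1-s)/(s-1)) := by
  set x := xh N with hxd
  have hx : 0 < x := xh_pos N
  let F : ℕ → ℝ → ℂ := fun ν u => ((Real.cos (2*π*((ν:ℝ)+1)*u)/(π^2*((ν:ℝ)+1)^2) : ℝ):ℂ) * (u:ℂ)^(-s-2)
  have hcos : ∀ (ν : ℕ) (u : ℝ), ((Real.cos (2*π*((ν:ℝ)+1)*u)/(π^2*((ν:ℝ)+1)^2) : ℝ):ℂ)
      = (1/(2*π^2*((ν:ℂ)+1)^2)) * (ee ((ν:ℝ)+1) u + ee (-((ν:ℝ)+1)) u) := by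
    intro ν u
    have : ((Real.cos (2*π*((ν:ℝ)+1)*u) : ℝ):ℂ) = (ee ((ν:ℝ)+1) u + ee (-((ν:ℝ)+1)) u)/2 := by
      rw [Complex.ofReal_cos, Complex.cos]
      unfold ee
      push_cast
      ring_nf
    rw [Complex.ofReal_div, this]
    have : ((ν:ℂ)+1) ≠ 0 := Nat.cast_add_one_ne_zero ν
    have hpi : (π:ℂ) ≠ 0 := by exact_mod_cast Real.pi_ne_zero
    push_cast
    field_simp
  have hre : (-s-2).re < -1 := by simp; linarith
  have hre1 : (-s-1).re < -1 := by simp; linarith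
  have hci : IntegrableOn (fun u : ℝ => (u:ℂ)^(-s-2)) (Set.Ioi x) := integrableOn_Ioi_cpow_of_lt hre hx
  have hFi : ∀ ν, Integrable (F ν) (volume.restrict (Set.Ioi x)) := by
    intro ν
    refine Integrable.bdd_mul (c := 1/(π^2*((ν:ℝ)+1)^2)) hci (by fun_prop) ?_
    refine Filter.Eventually.of_forall fun u => ?_
    rw [Complex.norm_real]; exact bet_term_bd u ν
  have hFs : Summable fun ν => ∫ u in Set.Ioi x, ‖F ν u‖ := by
    refine Summable.of_nonneg_of_le (fun ν => integral_nonneg fun u => norm_nonneg _) (fun ν => ?_)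
      (bet_summable_bd.mul_right (∫ u in Set.Ioi x, ‖(u:ℂ)^(-s-2)‖))
    rw [← integral_const_mul]
    refine integral_mono (hFi ν).norm (hci.norm.const_mul _) fun u => ?_
    simp only [F]
    rw [norm_mul, Complex.norm_real]
    gcongr
    exact bet_term_bd u ν
  have H2 := hasSum_integral_of_summable_integral_norm hFi hFs
  have e2 : ∀ u, ∑' ν, F ν u = (bet u:ℂ) * (u:ℂ)^(-s-2) := by
    intro u
    simp only [F]
    rw [tsum_mul_right]
    congr 1
    unfold bet
    rw [Complex.ofReal_tsum]
  simp only [e2] at H2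
  have H1 : HasSum (fun ν : ℕ => ((Real.cos (2*π*((ν:ℝ)+1)*x)/(π^2*((ν:ℝ)+1)^2) : ℝ):ℂ)) ((bet x : ℝ):ℂ) := by
    have : Summable (fun ν : ℕ => Real.cos (2*π*((ν:ℝ)+1)*x)/(π^2*((ν:ℝ)+1)^2)) :=
      Summable.of_norm_bounded bet_summable_bd (bet_term_bd x)
    exact Complex.hasSum_ofReal.mpr this.hasSum
  have hb : bet x = -1/12 := by
    rw [bet_poly N x (by rw [hxd, xh]; push_cast; linarith) (by rw [hxd, xh]; push_cast; linarith)]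
    rw [hxd, xh]; push_cast; ring
  have H := (H1.mul_left (s/2*(x:ℂ)^(-s-1))).sub (H2.mul_left (s*(s+1)/2))
  convert H using 1
  · rfl
  · funext ν
    have hν : ((ν:ℂ)+1) ≠ 0 := Nat.cast_add_one_ne_zero ν
    have hpi : (π:ℂ) ≠ 0 := by exact_mod_cast Real.pi_ne_zero
    have p1 := JJ_parts ((ν:ℝ)+1) hre1 hx
    have p2 := JJ_parts (-((ν:ℝ)+1)) hre1 hx
    rw [show -s-1-1 = -s-2 by ring] at p1 p2
    have eF : ∫ u in Set.Ioi x, F ν u = (1/(2*π^2*((ν:ℂ)+1)^2)) *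
        (JJ ((ν:ℝ)+1) (-s-2) x + JJ (-((ν:ℝ)+1)) (-s-2) x) := by
      unfold JJ
      rw [← integral_add (JJ_int _ hre hx) (JJ_int _ hre hx), ← integral_const_mul]
      congr 1; funext u
      simp only [F]
      rw [hcos]; ring
    rw [eF, hcos]
    unfold AA
    push_cast at p1 p2 ⊢
    have hI2 : Complex.I^2 = -1 := Complex.I_sq
    have q1 : ee ((ν:ℝ)+1) x * (x:ℂ)^(-s-1) - (s+1) * JJ ((ν:ℝ)+1) (-s-2) x
       = - (2*π*(ν+1)*Complex.I * JJ ((ν:ℝ)+1) (-s-1) x) := by linear_combination p1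
    have q2 : ee (-((ν:ℝ)+1)) x * (x:ℂ)^(-s-1) - (s+1) * JJ (-((ν:ℝ)+1)) (-s-2) x
       = (2*π*(ν+1)*Complex.I * JJ (-((ν:ℝ)+1)) (-s-1) x) := by linear_combination p2
    trans s/(4*π^2*((ν:ℂ)+1)^2) * ((ee ((ν:ℝ)+1) x * (x:ℂ)^(-s-1) - (s+1) * JJ ((ν:ℝ)+1) (-s-2) x)
      + (ee (-((ν:ℝ)+1)) x * (x:ℂ)^(-s-1) - (s+1) * JJ (-((ν:ℝ)+1)) (-s-2) x))
    · rw [q1, q2]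
      have hI : 1/Complex.I = -Complex.I := by simp
      have a1 : ∀ z : ℂ, s/(2*π*z*Complex.I) = -(s*Complex.I/(2*π*z)) := by
        intro z
        rw [← div_div, div_eq_mul_one_div _ Complex.I, hI]; ring
      rw [a1, a1]
      field_simp
      ring
    · field_simp
      ring
  · rw [hb]
    unfold RN
    push_cast
    ring

lemma fdt (h h' F F' : ℝ → ℝ) (a b : ℝ) (hab : a ≤ b)
    (hh : ∀ u ∈ Set.Icc a b, HasDerivAt h (h' u) u)
    (hF : ∀ u ∈ Set.Icc a b, HasDerivAt F (F' u) u)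
    (hneg : ∀ u ∈ Set.Icc a b, h' u ≤ 0)
    (ch : ContinuousOn h' (Set.Icc a b)) (cF : ContinuousOn F' (Set.Icc a b)) :
    ‖∫ u in a..b, ((h u * F' u : ℝ):ℂ) * Complex.exp ((F u : ℝ) * Complex.I)‖ ≤ |h a| + |h b| + (h a - h b) := by
  have hu : Set.uIcc a b = Set.Icc a b := Set.uIcc_of_le hab
  have ch0 : ContinuousOn h (Set.Icc a b) := fun u hu => (hh u hu).continuousAt.continuousWithinAt
  have cF0 : ContinuousOn F (Set.Icc a b) := fun u hu => (hF u hu).continuousAt.continuousWithinAt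
  have ce : ContinuousOn (fun u => Complex.exp ((F u : ℝ) * Complex.I)) (Set.Icc a b) := by fun_prop
  have i1 : IntervalIntegrable (fun u => ((h' u : ℝ):ℂ) * Complex.exp ((F u : ℝ) * Complex.I)) volume a b := by
    apply ContinuousOn.intervalIntegrable; rw [hu]; fun_prop
  have i2 : IntervalIntegrable (fun u => ((h u * F' u : ℝ):ℂ) * Complex.exp ((F u : ℝ) * Complex.I)) volume a b := by
    apply ContinuousOn.intervalIntegrable; rw [hu]; fun_prop
  have key := intervalIntegral.integral_eq_sub_of_hasDerivAt
    (f := fun u => ((h u : ℝ):ℂ) * Complex.exp ((F u : ℝ) * Complex.I))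
    (f' := fun u => ((h' u : ℝ):ℂ) * Complex.exp ((F u : ℝ) * Complex.I) + Complex.I * (((h u * F' u : ℝ):ℂ) * Complex.exp ((F u : ℝ) * Complex.I)))
    (a := a) (b := b) (by
      intro u hu'
      rw [hu] at hu'
      have d1 := (hh u hu').ofReal_comp
      have d2 := ((hF u hu').ofReal_comp.mul_const Complex.I).cexp
      refine (d1.mul d2).congr_deriv ?_
      push_cast; ring) (i1.add (i2.const_mul _))
  rw [intervalIntegral.integral_add i1 (i2.const_mul _), intervalIntegral.integral_const_mul] at key
  have hI : ‖Complex.I‖ = 1 := Complex.norm_I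
  have hn1 : ‖∫ u in a..b, ((h' u : ℝ):ℂ) * Complex.exp ((F u : ℝ) * Complex.I)‖ ≤ h a - h b := by
    have hi : IntervalIntegrable (fun u => -h' u) volume a b := by
      apply ContinuousOn.intervalIntegrable; rw [hu]; exact ch.neg
    have := intervalIntegral.norm_integral_le_of_norm_le (f := fun u => ((h' u : ℝ):ℂ) * Complex.exp ((F u : ℝ) * Complex.I)) (g := fun u => - h' u) (μ := volume) hab
      (by
        refine Filter.Eventually.of_forall fun u hu' => ?_
        rw [norm_mul, Complex.norm_exp_ofReal_mul_I, mul_one, Complex.norm_real, Real.norm_eq_abs,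
          abs_of_nonpos (hneg u ⟨hu'.1.le, hu'.2⟩)]) hi
    refine this.trans (le_of_eq ?_)
    rw [intervalIntegral.integral_neg, intervalIntegral.integral_eq_sub_of_hasDerivAt (f := h)]
    · ring
    · intro u hu'; rw [hu] at hu'; exact hh u hu'
    · apply ContinuousOn.intervalIntegrable; rw [hu]; exact ch
  have hb : ∀ v, ‖((h v : ℝ):ℂ) * Complex.exp ((F v : ℝ) * Complex.I)‖ = |h v| := by
    intro v; rw [norm_mul, Complex.norm_exp_ofReal_mul_I, mul_one, Complex.norm_real, Real.norm_eq_abs]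
  rw [← one_mul ‖∫ u in a..b, ((h u * F' u : ℝ):ℂ) * Complex.exp ((F u : ℝ) * Complex.I)‖, ← hI, ← norm_mul,
    eq_sub_of_add_eq' key]
  refine (norm_sub_le _ _).trans ?_
  refine add_le_add ?_ hn1
  refine (norm_sub_le _ _).trans ?_
  rw [hb, hb, add_comm]

lemma cpow_split (a q : ℝ) {u : ℝ} (hu : 0 < u) :
    (u:ℂ)^((a:ℂ) - q*Complex.I) = ((u^a : ℝ):ℂ) * Complex.exp ((-(q * Real.log u) : ℝ) * Complex.I) := by
  have hu0 : (u:ℂ) ≠ 0 := by exact_mod_cast hu.ne'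
  rw [Complex.cpow_sub _ _ hu0, div_eq_mul_inv, ← Complex.cpow_neg, Complex.ofReal_cpow hu.le]
  congr 1
  rw [Complex.cpow_def_of_ne_zero hu0, ← Complex.ofReal_log hu.le]
  congr 1; push_cast; ring

lemma osc (p q σ a x b : ℝ) (hσ : σ = 1 ∨ σ = -1) (hx : 0 < x) (hxb : x ≤ b)
    (hD : ∀ u ∈ Set.Icc x b, 2*π*p*u - q ≠ 0)
    (hn : ∀ u ∈ Set.Icc x b, a*(2*π*p*u) - (a+1)*q ≤ 0) :
    ‖∫ u in x..b, ee (σ*p) u * (u:ℂ)^((a:ℂ) - ((σ*q : ℝ):ℂ)*Complex.I)‖ ≤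
      |x^(a+1)/(2*π*p*x-q)| + |b^(a+1)/(2*π*p*b-q)| + (x^(a+1)/(2*π*p*x-q) - b^(a+1)/(2*π*p*b-q)) := by
  have hpos : ∀ u ∈ Set.Icc x b, 0 < u := fun u hu => hx.trans_le hu.1
  have key := fdt (fun u => u^(a+1)/(2*π*p*u-q)) (fun u => u^a*(a*(2*π*p*u) - (a+1)*q)/(2*π*p*u-q)^2)
    (fun u => 2*π*(σ*p)*u - σ*q*Real.log u) (fun u => 2*π*(σ*p) - σ*q*u⁻¹) x b hxb ?_ ?_ ?_ ?_ ?_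
  · have e : ∫ u in x..b, ee (σ*p) u * (u:ℂ)^((a:ℂ) - ((σ*q : ℝ):ℂ)*Complex.I) =
      σ * ∫ u in x..b, ((u^(a+1)/(2*π*p*u-q) * (2*π*(σ*p) - σ*q*u⁻¹) : ℝ):ℂ) * Complex.exp (((2*π*(σ*p)*u - σ*q*Real.log u : ℝ):ℂ) * Complex.I) := by
      rw [← intervalIntegral.integral_const_mul]
      refine intervalIntegral.integral_congr fun u hu => ?_
      rw [Set.uIcc_of_le hxb] at hu
      have hu0 := hpos u hu
      have hD' := hD u hu
      have e1 : u^(a+1)/(2*π*p*u-q) * (2*π*(σ*p) - σ*q*u⁻¹) = σ * u^a := by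
        rw [Real.rpow_add_one hu0.ne']
        have e0 : 2*π*(σ*p) - σ*q*u⁻¹ = σ*(2*π*p*u-q)*u⁻¹ := by field_simp
        rw [e0]
        calc u^a*u/(2*π*p*u-q)*(σ*(2*π*p*u-q)*u⁻¹) = σ*u^a*((2*π*p*u-q)/(2*π*p*u-q))*(u*u⁻¹) := by ring
          _ = σ * u^a := by rw [div_self hD', mul_inv_cancel₀ hu0.ne', mul_one, mul_one]
      beta_reduce
      rw [e1, cpow_split a (σ*q) hu0]
      have e2 : ((σ*σ : ℝ):ℂ) = 1 := by rcases hσ with h | h <;> simp [h]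
      have e3 : ee (σ*p) u = Complex.exp (((2*π*(σ*p)*u : ℝ):ℂ)*Complex.I) := by
        unfold ee; push_cast; rfl
      rw [e3, mul_left_comm, ← Complex.exp_add]
      push_cast at e2 ⊢
      rw [mul_assoc (σ:ℂ) ((u^a:ℝ):ℂ) _, ← mul_assoc (σ:ℂ) (σ:ℂ) _, e2, one_mul]
      congr 2; ring
    rw [e, norm_mul]
    have : ‖(σ:ℂ)‖ = 1 := by rcases hσ with h | h <;> simp [h]
    rw [this, one_mul]
    exact key
  · intro u hu
    have hu0 := hpos u hu
    have hD' := hD u hu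
    have d1 := Real.hasDerivAt_rpow_const (x := u) (p := a+1) (Or.inl hu0.ne')
    have d2 : HasDerivAt (fun u : ℝ => 2*π*p*u-q) (2*π*p) u := by
      simpa using ((hasDerivAt_id u).const_mul (2*π*p)).sub_const q
    refine (d1.div d2 hD').congr_deriv ?_
    rw [Real.rpow_add_one hu0.ne', add_sub_cancel_right]
    ring
  · intro u hu
    have hu0 := hpos u hu
    have d1 := (Real.hasDerivAt_log hu0.ne').const_mul (σ*q)
    have d2 : HasDerivAt (fun u : ℝ => 2*π*(σ*p)*u) (2*π*(σ*p)) u := by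
      simpa using ((hasDerivAt_id u).const_mul (2*π*(σ*p)))
    exact d2.sub d1
  · intro u hu
    have hu0 := hpos u hu
    apply div_nonpos_of_nonpos_of_nonneg _ (sq_nonneg _)
    exact mul_nonpos_of_nonneg_of_nonpos (Real.rpow_nonneg hu0.le _) (hn u hu)
  · intro u hu
    have hu0 := hpos u hu
    have hD' := hD u hu
    apply ContinuousAt.continuousWithinAt
    refine ContinuousAt.div (f := fun u => u ^ a * (a * (2 * π * p * u) - (a + 1) * q)) (g := fun u => (2*π*p*u-q)^2) ?_ (by fun_prop) (pow_ne_zero _ hD')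
    exact (Real.continuousAt_rpow_const _ _ (Or.inl hu0.ne')).mul (by fun_prop)
  · intro u hu
    have hu0 := hpos u hu
    apply ContinuousAt.continuousWithinAt
    have := continuousAt_inv₀ hu0.ne'
    fun_prop

/-- critical-line point -/
noncomputable def sc (τ : ℝ) : ℂ := 1/2 + τ*Complex.I

lemma JJ_bound (p q σ x : ℝ) (hσ : σ = 1 ∨ σ = -1) (hx : 0 < x) (hp : 0 < p) (hq : q < 2*π*p*x) :
    ‖JJ (σ*p) (-(sc (σ*q))-1) x‖ ≤ 2*(x^(-(1/2):ℝ)/(2*π*p*x-q)) := by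
  have hre : (-(sc (σ*q))-1).re < -1 := by simp [sc]; norm_num
  have hc : (-(sc (σ*q))-1) = (((-3/2:ℝ)):ℂ) - ((σ*q : ℝ):ℂ)*Complex.I := by
    simp [sc]; ring
  have h := intervalIntegral_tendsto_integral_Ioi x (JJ_int (σ*p) hre hx) Filter.tendsto_id
  refine le_of_tendsto h.norm ?_
  filter_upwards [Filter.eventually_ge_atTop x] with b hb
  have hpi := Real.pi_pos
  have hm : ∀ u ∈ Set.Icc x b, 2*π*p*x ≤ 2*π*p*u := fun u hu => by
    have := hu.1; gcongr
  have o := osc p q σ (-3/2) x b hσ hx hb (fun u hu => by have := hm u hu; linarith)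
    (fun u hu => by have := hm u hu; have : 0 < 2*π*p*u := by have := hx.trans_le hu.1; positivity
                    linarith)
  simp only [id]
  rw [hc]
  refine o.trans ?_
  have h1 : (-3/2:ℝ)+1 = -(1/2) := by norm_num
  rw [h1]
  have hb0 : 0 < b := hx.trans_le hb
  have := hm b ⟨hb, le_rfl⟩
  rw [abs_of_nonneg (div_nonneg (Real.rpow_nonneg hx.le _) (by linarith)), abs_of_nonneg (div_nonneg (Real.rpow_nonneg hb0.le _) (by linarith))]
  linarith

lemma sc_re (τ : ℝ) : (sc τ).re = 1/2 := by simp [sc]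
lemma sc_im (τ : ℝ) : (sc τ).im = τ := by simp [sc]

lemma sc_norm {τ : ℝ} (h : 1/2 ≤ τ) : ‖sc τ‖ ≤ 2*τ := by
  refine (Complex.norm_le_abs_re_add_abs_im _).trans ?_
  rw [sc_re, sc_im, abs_of_pos (by norm_num : (0:ℝ)<1/2), abs_of_nonneg (by linarith)]
  linarith

lemma Abd (y p σ x : ℝ) (hσ : σ = 1 ∨ σ = -1) (hx : 0 < x) (hp : 0 < p) (hy : 1 ≤ y) (hq : σ*y < p*x) :
    ‖AA (sc (2*π*y)) (σ*p) x‖ ≤ y/p * (x^(-(1/2):ℝ) / (p*x - σ*y)) := by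
  have hpi := Real.pi_gt_three
  have hss : σ*σ = 1 := by rcases hσ with h | h <;> simp [h]
  have h := JJ_bound p (σ*(2*π*y)) σ x hσ hx hp (by nlinarith)
  rw [← mul_assoc, hss, one_mul] at h
  have hns := sc_norm (τ := 2*π*y) (by nlinarith)
  unfold AA
  rw [norm_mul, norm_div]
  have hσn : ‖(σ:ℂ)‖ = 1 := by rcases hσ with h | h <;> simp [h]
  have e1 : ‖(2*π*((σ*p:ℝ):ℂ)*Complex.I)‖ = 2*π*p := by
    push_cast
    simp only [norm_mul, hσn, Complex.norm_I, Complex.norm_real, Real.norm_eq_abs, abs_of_pos hp, abs_of_pos Real.pi_pos]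
    simp
  rw [e1]
  have hX : 0 ≤ x^(-(1/2):ℝ) := Real.rpow_nonneg hx.le _
  have hd : 0 < p*x-σ*y := by linarith
  calc ‖sc (2*π*y)‖/(2*π*p) * ‖JJ (σ*p) (-sc (2*π*y) - 1) x‖
      ≤ (2*(2*π*y))/(2*π*p) * (2 * (x^(-(1/2):ℝ)/(2*π*p*x - σ*(2*π*y)))) := by
        gcongr
    _ = (4/(2*π)) * (y/p * (x^(-(1/2):ℝ) / (p*x - σ*y))) := by
        have : 2*π*p*x - σ*(2*π*y) = 2*π*(p*x-σ*y) := by ring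
        rw [this]
        field_simp; norm_num
    _ ≤ 1 * (y/p * (x^(-(1/2):ℝ) / (p*x - σ*y))) := by
        gcongr
        rw [div_le_one (by positivity)]; linarith
    _ = _ := one_mul _

lemma AA_scale (s : ℂ) {ν x : ℝ} (hν : 0 < ν) (hx : 0 < x) :
    AA s ν x = (ν:ℂ)^(s-1) * AA s 1 (ν*x) := by
  have hν0 : (ν:ℂ) ≠ 0 := by exact_mod_cast hν.ne'
  have hJ : JJ ν (-s-1) x = (ν:ℂ)^s * JJ 1 (-s-1) (ν*x) := by
    unfold JJ
    have h := integral_comp_mul_left_Ioi (fun u : ℝ => ee 1 u * (u:ℂ)^(-s-1)) x hν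
    have e : ∫ u in Set.Ioi (ν*x), ee 1 u * (u:ℂ)^(-s-1) = (ν:ℂ) * ∫ u in Set.Ioi x, ee 1 (ν*u) * ((ν*u:ℝ):ℂ)^(-s-1) := by
      rw [h, Complex.real_smul]; push_cast; rw [← mul_assoc, mul_inv_cancel₀ hν0, one_mul]
    rw [e, ← mul_assoc, ← integral_const_mul]
    refine setIntegral_congr_fun measurableSet_Ioi fun u hu => ?_
    have hu0 : 0 < u := hx.trans hu
    beta_reduce
    rw [show ee 1 (ν*u) = ee ν u by unfold ee; push_cast; congr 1; ring]
    push_cast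
    rw [Complex.mul_cpow_ofReal_nonneg hν.le hu0.le]
    have : (ν:ℂ)^s * ν * (ν:ℂ)^(-s-1) = 1 := by
      nth_rewrite 2 [← Complex.cpow_one (ν:ℂ)]
      rw [← Complex.cpow_add _ _ hν0, ← Complex.cpow_add _ _ hν0]
      simp
    calc ee ν u * (u:ℂ)^(-s-1) = ((ν:ℂ)^s * ν * (ν:ℂ)^(-s-1)) * (ee ν u * (u:ℂ)^(-s-1)) := by rw [this, one_mul]
      _ = _ := by ring
  unfold AA
  rw [hJ, Complex.cpow_sub _ _ hν0, Complex.cpow_one]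
  push_cast
  ring

noncomputable def BB (s : ℂ) (z : ℝ) : ℂ := AA s 1 z - ee 1 z * (z:ℂ)^(-s) / (2*π*Complex.I)

lemma BB_sub {s : ℂ} (hs : 0 < s.re) {z z' : ℝ} (hz : 0 < z) (hzz : z ≤ z') :
    BB s z - BB s z' = ∫ u in z..z', ee 1 u * (u:ℂ)^(-s) := by
  have hre : (-s-1).re < -1 := by simp; linarith
  have h1 := intervalIntegral.integral_Ioi_sub_Ioi (JJ_int 1 hre hz) hzz
  have hpos : ∀ u ∈ Set.uIcc z z', 0 < u := by
    intro u hu; rw [Set.uIcc_of_le hzz] at hu; exact hz.trans_le hu.1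
  have cc : ∀ c : ℂ, IntervalIntegrable (fun u : ℝ => ee 1 u * (u:ℂ)^c) volume z z' := by
    intro c
    apply ContinuousOn.intervalIntegrable
    intro u hu
    exact ((ee_cont 1).continuousAt.mul (cpow_hasDeriv c u (hpos u hu)).continuousAt).continuousWithinAt
  have key := intervalIntegral.integral_eq_sub_of_hasDerivAt
    (f := fun u : ℝ => ee 1 u * (u:ℂ)^(-s))
    (f' := fun u => 2*π*Complex.I * (ee 1 u * (u:ℂ)^(-s)) + (-s) * (ee 1 u * (u:ℂ)^(-s-1)))
    (a := z) (b := z') (by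
      intro u hu
      refine ((ee_hasDeriv 1 u).mul (cpow_hasDeriv (-s) u (hpos u hu))).congr_deriv ?_
      push_cast; ring) (((cc _).const_mul _).add ((cc _).const_mul _))
  rw [intervalIntegral.integral_add ((cc _).const_mul _) ((cc _).const_mul _), intervalIntegral.integral_const_mul,
    intervalIntegral.integral_const_mul, ← h1] at key
  have hpi : (2*π*Complex.I : ℂ) ≠ 0 := by simp [Real.pi_ne_zero]
  apply mul_left_cancel₀ hpi
  rw [eq_sub_of_add_eq key]
  unfold BB AA JJ
  push_cast
  field_simp
  ring

lemma cpow_norm_half {u : ℝ} (hu : 0 < u) (τ : ℝ) : ‖(u:ℂ)^(-(sc τ))‖ = u^(-(1/2):ℝ) := by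
  rw [Complex.norm_cpow_eq_rpow_re_of_pos hu]; simp [sc]

lemma BB_triv (τ : ℝ) {z z' : ℝ} (hz : 0 < z) (hzz : z ≤ z') :
    ‖BB (sc τ) z - BB (sc τ) z'‖ ≤ z^(-(1/2):ℝ) * (z'-z) := by
  rw [BB_sub (by rw [sc_re]; norm_num) hz hzz]
  have := intervalIntegral.norm_integral_le_of_norm_le_const (a := z) (b := z') (C := z^(-(1/2):ℝ)) (f := fun u : ℝ => ee 1 u * (u:ℂ)^(-sc τ)) (by
    intro u hu
    rw [Set.uIoc_of_le hzz] at hu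
    rw [norm_mul, ee_norm, one_mul, cpow_norm_half (hz.trans hu.1)]
    exact Real.rpow_le_rpow_of_nonpos hz hu.1.le (by norm_num))
  rwa [abs_of_nonneg (by linarith)] at this

lemma BB_osc (y : ℝ) {z z' : ℝ} (hz : 0 < z) (hzz : z ≤ z') (hy : z' < y) :
    ‖BB (sc (2*π*y)) z - BB (sc (2*π*y)) z'‖ ≤ z'^(1/2:ℝ)/(y-z') := by
  rw [BB_sub (by rw [sc_re]; norm_num) hz hzz]
  have hpi := Real.pi_gt_three
  have o := osc 1 (2*π*y) 1 (-1/2) z z' (Or.inl rfl) hz hzz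
    (fun u hu => by have := hu.2; have : 2*π*1*u - 2*π*y < 0 := by nlinarith
                    exact this.ne)
    (fun u hu => by have h0 : 0 < u := hz.trans_le hu.1
                    have : 0 < π*u := by positivity
                    have : 0 < π*y := mul_pos Real.pi_pos (by linarith)
                    linarith)
  have e : ∀ u : ℝ, ee (1*1) u * (u:ℂ)^(((-1/2:ℝ):ℂ) - ((1*(2*π*y):ℝ):ℂ)*Complex.I) = ee 1 u * (u:ℂ)^(-sc (2*π*y)) := by
    intro u; rw [mul_one]; congr 2; simp [sc]; ring
  simp only [e] at o
  refine o.trans ?_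
  have hz' : 0 < z' := hz.trans_le hzz
  rw [show (-1/2:ℝ)+1 = 1/2 by norm_num]
  have d1 : 2*π*1*z - 2*π*y < 0 := by nlinarith
  have d2 : 2*π*1*z' - 2*π*y < 0 := by nlinarith
  rw [abs_of_nonpos (div_nonpos_of_nonneg_of_nonpos (Real.rpow_nonneg hz.le _) d1.le), abs_of_nonpos (div_nonpos_of_nonneg_of_nonpos (Real.rpow_nonneg hz'.le _) d2.le)]
  have hyz : 0 < y - z' := by linarith
  have : z'^(1/2:ℝ)/(2*π*1*z' - 2*π*y) = -((1/(2*π)) * (z'^(1/2:ℝ)/(y-z'))) := by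
    rw [show 2*π*1*z' - 2*π*y = -(2*π*(y-z')) by ring, div_neg]
    field_simp
  rw [this]
  have h0 : 0 ≤ z'^(1/2:ℝ)/(y-z') := div_nonneg (Real.rpow_nonneg hz'.le _) hyz.le
  have : 1/(2*π) ≤ 1/2 := by gcongr; linarith
  nlinarith

lemma rph {u : ℝ} (hu : 0 < u) : u^(-(1/2):ℝ) = (√u)⁻¹ := by
  rw [Real.rpow_neg hu.le, Real.sqrt_eq_rpow]

lemma AB_diff (τ : ℝ) {z : ℝ} (hz : 0 < z) : ‖AA (sc τ) 1 z - BB (sc τ) z‖ ≤ (√z)⁻¹ := by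
  unfold BB
  rw [sub_sub_cancel, norm_div, norm_mul, ee_norm, one_mul, cpow_norm_half hz, rph hz]
  apply div_le_self (by positivity)
  have := Real.pi_gt_three
  simp only [norm_mul, Complex.norm_I, Complex.norm_real, Real.norm_eq_abs, abs_of_pos Real.pi_pos]
  simp; linarith

lemma near_B {n x y z : ℝ} (hn : 4 ≤ n) (hx : x = n + 1/2) (hy1 : x*(n-1) ≤ y) (hy2 : y ≤ x*(n+2))
    (hz1 : x*(n-2) ≤ z) (hz2 : z ≤ x*(n+2)) : ‖BB (sc (2*π*y)) z‖ ≤ 13 := by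
  have hx0 : 0 < x := by linarith
  have hy : 1 ≤ y := by nlinarith
  have hzx : x^2/4 ≤ z := by nlinarith
  have hz0 : 0 < z := by nlinarith
  set Z := x*(n+3) with hZ
  have hZ0 : 0 < Z := by positivity
  have hA := Abd y 1 1 Z (Or.inl rfl) hZ0 one_pos hy (by nlinarith)
  have hZx : x ≤ √Z := Real.le_sqrt_of_sq_le (by nlinarith)
  have hA2 : ‖AA (sc (2*π*y)) 1 Z‖ ≤ 2 := by
    rw [mul_one] at hA
    refine hA.trans ?_
    rw [rph hZ0]
    have hd : x ≤ 1*Z-1*y := by nlinarith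
    have hd0 : 0 ≤ 1*Z-1*y := by linarith
    calc y/1*((√Z)⁻¹/(1*Z-1*y)) ≤ (2*x^2)/1*(x⁻¹/x) := by
          gcongr
          nlinarith
      _ = 2 := by field_simp
  have h1 := AB_diff (2*π*y) hZ0
  have hs1 : (√Z)⁻¹ ≤ 1 := inv_le_one_of_one_le₀ (by linarith)
  have h2 := BB_triv (2*π*y) hz0 (show z ≤ Z by nlinarith)
  have hsz : x/2 ≤ √z := Real.le_sqrt_of_sq_le (by nlinarith)
  have h3 : z^(-(1/2):ℝ) * (Z-z) ≤ 10 := by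
    rw [rph hz0]
    calc (√z)⁻¹*(Z-z) ≤ (x/2)⁻¹*(5*x) := by
          gcongr
          · nlinarith
          · nlinarith
      _ = 10 := by field_simp; norm_num
  have e : BB (sc (2*π*y)) z = (BB (sc (2*π*y)) z - BB (sc (2*π*y)) Z) - (AA (sc (2*π*y)) 1 Z - BB (sc (2*π*y)) Z) + AA (sc (2*π*y)) 1 Z := by ring
  rw [e]
  refine (norm_add_le _ _).trans ?_
  have := norm_sub_le (BB (sc (2*π*y)) z - BB (sc (2*π*y)) Z) (AA (sc (2*π*y)) 1 Z - BB (sc (2*π*y)) Z)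
  linarith

lemma near_A {n x y ν : ℝ} (hn : 4 ≤ n) (hx : x = n + 1/2) (hy1 : x*(n-1) ≤ y) (hy2 : y ≤ x*(n+2))
    (hz1 : n-2 ≤ ν) (hz2 : ν ≤ n+2) : ‖AA (sc (2*π*y)) ν x‖ ≤ 14 := by
  have hx0 : 0 < x := by linarith
  have hν : 0 < ν := by linarith
  rw [AA_scale _ hν hx0, norm_mul]
  have h1 : ‖(ν:ℂ)^(sc (2*π*y) - 1)‖ ≤ 1 := by
    rw [Complex.norm_cpow_eq_rpow_re_of_pos hν]
    apply Real.rpow_le_one_of_one_le_of_nonpos (by linarith)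
    simp [sc]; norm_num
  have h2 := near_B hn hx hy1 hy2 (z := ν*x) (by nlinarith) (by nlinarith)
  have h3 := AB_diff (2*π*y) (z := ν*x) (by positivity)
  have : (√(ν*x))⁻¹ ≤ 1 := by
    apply inv_le_one_of_one_le₀
    apply Real.le_sqrt_of_sq_le; nlinarith
  have h4 : ‖AA (sc (2*π*y)) 1 (ν*x)‖ ≤ 14 := by
    have e : AA (sc (2*π*y)) 1 (ν*x) = (AA (sc (2*π*y)) 1 (ν*x) - BB (sc (2*π*y)) (ν*x)) + BB (sc (2*π*y)) (ν*x) := by ring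
    rw [e]; refine (norm_add_le _ _).trans ?_; linarith
  have h5 := norm_nonneg (AA (sc (2*π*y)) 1 (ν*x))
  nlinarith

lemma negA {n x y ν : ℝ} (hn : 4 ≤ n) (hx : x = n + 1/2) (hy1 : x*(n-1) ≤ y) (hy2 : y ≤ x*(n+2))
    (hν : 0 < ν) : ‖AA (sc (2*π*y)) (-ν) x‖ ≤ 1/(ν*√ν) := by
  have hx0 : 0 < x := by linarith
  have hy : 1 ≤ y := by nlinarith
  have h := Abd y ν (-1) x (Or.inr rfl) hx0 hν hy (by have : 0 < ν*x := by positivity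
                                                      linarith)
  rw [neg_one_mul, rph hx0] at h
  refine h.trans ?_
  have hden : 2*(√ν*√x*√y) ≤ ν*x - -1*y := by
    have a1 := Real.sq_sqrt hν.le
    have a2 := Real.sq_sqrt hx0.le
    have a3 := Real.sq_sqrt (by linarith : 0 ≤ y)
    nlinarith [sq_nonneg (√ν*√x - √y)]
  have p1 : 0 < √ν := Real.sqrt_pos.2 hν
  have p2 : 0 < √x := Real.sqrt_pos.2 hx0
  have p3 : 0 < √y := Real.sqrt_pos.2 (by linarith)
  have hyx : √y ≤ 2*x := by
    rw [Real.sqrt_le_left (by linarith)]; nlinarith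
  calc y/ν*((√x)⁻¹/(ν*x - -1*y)) ≤ y/ν*((√x)⁻¹/(2*(√ν*√x*√y))) := by gcongr
    _ = (√y*√y)/ν*((√x)⁻¹/(2*(√ν*√x*√y))) := by rw [Real.mul_self_sqrt (by linarith)]
    _ = (√y/(2*(√x*√x))) * (1/(ν*√ν)) := by field_simp
    _ ≤ 1 * (1/(ν*√ν)) := by
        gcongr
        rw [Real.mul_self_sqrt hx0.le, div_le_one (by positivity)]; exact hyx
    _ = _ := one_mul _

lemma farA {n x y k : ℝ} (hn : 4 ≤ n) (hx : x = n + 1/2) (hy1 : x*(n-1) ≤ y) (hy2 : y ≤ x*(n+2))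
    (hk : 0 < k) : ‖AA (sc (2*π*y)) (n+2+k) x‖ ≤ 1/(k*√k) := by
  have hx0 : 0 < x := by linarith
  have hy : 1 ≤ y := by nlinarith
  have h := Abd y (n+2+k) 1 x (Or.inl rfl) hx0 (by linarith) hy (by nlinarith)
  rw [one_mul, rph hx0] at h
  refine h.trans ?_
  have p1 : 0 < √k := Real.sqrt_pos.2 hk
  have p2 : 0 < √x := Real.sqrt_pos.2 hx0
  have hν : 2*(√x*√k) ≤ n+2+k := by
    nlinarith [sq_nonneg (√x-√k), Real.sq_sqrt hk.le, Real.sq_sqrt hx0.le]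
  have hd : k*x ≤ (n+2+k)*x-1*y := by nlinarith
  have hd0 : 0 ≤ (n+2+k)*x-1*y := le_trans (by positivity) hd
  calc y/(n+2+k)*((√x)⁻¹/((n+2+k)*x-1*y)) ≤ (2*x^2)/(2*(√x*√k))*((√x)⁻¹/(k*x)) := by
        gcongr
        nlinarith
    _ = (x/(√x*√x)) * (1/(k*√k)) := by field_simp
    _ = _ := by rw [Real.mul_self_sqrt hx0.le, div_self hx0.ne', one_mul]

lemma G_bd {n x y : ℝ} (hn : 4 ≤ n) (hx : x = n + 1/2) (hy1 : x*(n-1) ≤ y) (hy2 : y ≤ x*(n+2)) :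
    ‖BB (sc (2*π*y)) x‖ ≤ 14 := by
  have hx0 : 0 < x := by linarith
  have h2 := near_B hn hx hy1 hy2 (z := x*(n-2)) le_rfl (by nlinarith)
  have h3 := BB_osc y (z := x) (z' := x*(n-2)) hx0 (by nlinarith) (by nlinarith)
  have h4 : (x*(n-2))^(1/2:ℝ)/(y-x*(n-2)) ≤ 1 := by
    rw [← Real.sqrt_eq_rpow, div_le_one (by nlinarith), Real.sqrt_le_left (by nlinarith)]
    nlinarith
  have e : BB (sc (2*π*y)) x = (BB (sc (2*π*y)) x - BB (sc (2*π*y)) (x*(n-2))) + BB (sc (2*π*y)) (x*(n-2)) := by ring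
  rw [e]; refine (norm_add_le _ _).trans ?_; linarith

lemma lowA {n x y ν : ℝ} (hn : 4 ≤ n) (hx : x = n + 1/2) (hy1 : x*(n-1) ≤ y)
    (hν : 1 ≤ ν) (hν2 : ν ≤ n-2) :
    ‖AA (sc (2*π*y)) ν x - (ν:ℂ)^(sc (2*π*y) - 1) * BB (sc (2*π*y)) x‖ ≤ (√x)⁻¹ * (1/(n-1-ν) + 1/ν) := by
  have hx0 : 0 < x := by linarith
  have hν0 : 0 < ν := by linarith
  rw [AA_scale _ hν0 hx0, ← mul_sub, norm_mul]
  have h1 : ‖(ν:ℂ)^(sc (2*π*y) - 1)‖ = (√ν)⁻¹ := by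
    rw [Complex.norm_cpow_eq_rpow_re_of_pos hν0, ← rph hν0]
    congr 1; simp [sc]; norm_num
  rw [h1]
  have h3 := AB_diff (2*π*y) (z := ν*x) (by positivity)
  have h4 := BB_osc y (z := x) (z' := ν*x) hx0 (by nlinarith) (by nlinarith)
  have e : AA (sc (2*π*y)) 1 (ν*x) - BB (sc (2*π*y)) x = (AA (sc (2*π*y)) 1 (ν*x) - BB (sc (2*π*y)) (ν*x)) - (BB (sc (2*π*y)) x - BB (sc (2*π*y)) (ν*x)) := by ring
  rw [e]
  have p1 : 0 < √ν := Real.sqrt_pos.2 hν0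
  have p2 : 0 < √x := Real.sqrt_pos.2 hx0
  have h5 : (ν*x)^(1/2:ℝ)/(y-ν*x) ≤ √ν*√x/(x*(n-1-ν)) := by
    rw [← Real.sqrt_eq_rpow, Real.sqrt_mul hν0.le]
    have : 0 < n-1-ν := by linarith
    gcongr
    nlinarith
  calc (√ν)⁻¹ * _ ≤ (√ν)⁻¹ * ((√(ν*x))⁻¹ + √ν*√x/(x*(n-1-ν))) := by
        gcongr
        refine (norm_sub_le _ _).trans ?_; linarith
    _ = (√ν)⁻¹ * ((√ν*√x)⁻¹ + √ν*√x/((√x*√x)*(n-1-ν))) := by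
        rw [Real.sqrt_mul hν0.le, Real.mul_self_sqrt hx0.le]
    _ = (√x)⁻¹ * (1/(n-1-ν) + 1/(√ν*√ν)) := by
        have : n-1-ν ≠ 0 := by linarith
        field_simp
        ring
    _ = _ := by rw [Real.mul_self_sqrt hν0.le]

lemma harm_sqrt (n : ℕ) : ∑ k ∈ Finset.range n, 1/((k:ℝ)+1) ≤ 2*√n := by
  induction n with
  | zero => simp
  | succ n ih =>
    rw [Finset.sum_range_succ]
    push_cast
    have hn : (0:ℝ) ≤ n := by positivity
    have a1 := Real.sq_sqrt hn
    have a2 := Real.sq_sqrt (by linarith : (0:ℝ) ≤ n+1)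
    have a3 : √(n:ℝ) ≤ √((n:ℝ)+1) := Real.sqrt_le_sqrt (by linarith)
    have a4 : 1 ≤ √((n:ℝ)+1) := Real.one_le_sqrt.2 (by linarith)
    have a0 := Real.sqrt_nonneg (n:ℝ)
    have : 1/((n:ℝ)+1) ≤ 2*(√((n:ℝ)+1) - √n) := by
      rw [div_le_iff₀ (by linarith)]
      nlinarith
    linarith

noncomputable def DN (N : ℕ) (τ : ℝ) : ℂ := ∑ n ∈ Finset.range N, ((n+1:ℕ):ℂ)^(-(sc τ))

lemma summ32 : Summable (fun i : ℕ => 1/(((i:ℝ)+1)*√((i:ℝ)+1))) := by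
  have h : Summable (fun i : ℕ => 1/((i:ℝ))^(3/2:ℝ)) := Real.summable_one_div_nat_rpow.2 (by norm_num)
  have h2 := (summable_nat_add_iff 1).2 h
  refine h2.congr fun i => ?_
  have : (0:ℝ) < (i:ℝ)+1 := by positivity
  rw [show (3/2:ℝ) = 1/2+1 by norm_num]
  push_cast
  rw [Real.rpow_add_one this.ne', Real.sqrt_eq_rpow, mul_comm]

lemma DN_conj (N : ℕ) (τ : ℝ) : ‖∑ n ∈ Finset.range N, (((n:ℝ)+1:ℝ):ℂ)^(sc τ - 1)‖ = ‖DN N τ‖ := by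
  rw [← Complex.norm_conj (DN N τ)]
  congr 1
  unfold DN
  rw [map_sum]
  refine Finset.sum_congr rfl fun n _ => ?_
  have e1 : ((n+1:ℕ):ℂ) = (((n:ℝ)+1:ℝ):ℂ) := by push_cast; rfl
  have e2 : sc τ - 1 = (starRingEnd ℂ) (-(sc τ)) := by
    apply Complex.ext <;> simp [sc]; norm_num
  rw [e1, e2, Complex.cpow_conj, Complex.conj_ofReal]
  rw [Complex.arg_ofReal_of_nonneg (by positivity)]
  exact Real.pi_pos.ne

lemma term_le_one (n : ℕ) (τ : ℝ) : ‖((n+1:ℕ):ℂ)^(-(sc τ))‖ ≤ 1 := by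
  have e1 : ((n+1:ℕ):ℂ) = (((n:ℝ)+1:ℝ):ℂ) := by push_cast; rfl
  rw [e1, cpow_norm_half (by positivity)]
  exact Real.rpow_le_one_of_one_le_of_nonpos (by have : (0:ℝ) ≤ n := by positivity
                                                 linarith) (by norm_num)

lemma afe : ∃ C : ℝ, 0 < C ∧ ∀ (N : ℕ) (y : ℝ), 4 ≤ N → xh N * ((N:ℝ)-1) ≤ y → y ≤ xh N * ((N:ℝ)+2) →
    ‖riemannZeta (sc (2*π*y))‖ ≤ C * (‖DN N (2*π*y)‖ + 1) := by
  set Z := ∑' i : ℕ, 1/(((i:ℝ)+1)*√((i:ℝ)+1)) with hZ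
  have hZ0 : 0 ≤ Z := tsum_nonneg fun i => by positivity
  refine ⟨2*Z+200, by linarith, ?_⟩
  intro N y hN hy1 hy2
  set s := sc (2*π*y) with hs
  have hn : (4:ℝ) ≤ N := by exact_mod_cast hN
  have hx : xh N = (N:ℝ) + 1/2 := rfl
  have hx0 : 0 < xh N := by linarith
  have hy : 1 ≤ y := by nlinarith
  have hpi := Real.pi_gt_three
  have hsre : 0 < s.re := by rw [hs, sc_re]; norm_num
  have hz := zeta_RN (s := s) hsre (by rw [hs, sc_im]; positivity) N
  have hsum := AA_hasSum (s := s) hsre N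
  set x := xh N with hxd
  have hneg : ∀ i : ℕ, ‖AA s (-((i:ℝ)+1)) x‖ ≤ 1/(((i:ℝ)+1)*√((i:ℝ)+1)) := fun i =>
    negA hn hx hy1 hy2 (by positivity)
  have sneg : Summable (fun i : ℕ => AA s (-((i:ℝ)+1)) x) := Summable.of_norm_bounded summ32 hneg
  have bneg : ‖∑' i : ℕ, AA s (-((i:ℝ)+1)) x‖ ≤ Z := tsum_of_norm_bounded summ32.hasSum hneg
  have hpos : HasSum (fun i : ℕ => AA s ((i:ℝ)+1) x) (RN s N - (x:ℂ)^(1-s)/(s-1) - ∑' i : ℕ, AA s (-((i:ℝ)+1)) x) := by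
    refine (hsum.sub sneg.hasSum).congr_fun ?_
    intro i; ring
  have hfar : ∀ j : ℕ, ‖AA s (((j+(N+2):ℕ):ℝ)+1) x‖ ≤ 1/(((j:ℝ)+1)*√((j:ℝ)+1)) := by
    intro j
    have := farA hn hx hy1 hy2 (k := (j:ℝ)+1) (by positivity)
    convert this using 3
    push_cast; ring
  have bfar : ‖∑' j : ℕ, AA s (((j+(N+2):ℕ):ℝ)+1) x‖ ≤ Z := tsum_of_norm_bounded summ32.hasSum hfar
  have hsplit := hpos.summable.sum_add_tsum_nat_add (N+2)
  rw [hpos.tsum_eq] at hsplit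
  obtain ⟨n, rfl⟩ : ∃ n, N = n + 2 := ⟨N-2, by omega⟩
  have hfour : ∑ i ∈ Finset.range (n+2+2), AA s ((i:ℝ)+1) x = ∑ i ∈ Finset.range n, AA s ((i:ℝ)+1) x + (AA s ((n:ℝ)+1) x + AA s (((n+1:ℕ):ℝ)+1) x + AA s (((n+2:ℕ):ℝ)+1) x + AA s (((n+3:ℕ):ℝ)+1) x) := by
    rw [Finset.sum_range_succ, Finset.sum_range_succ, Finset.sum_range_succ, Finset.sum_range_succ]; ring
  have n1 : ‖AA s ((n:ℝ)+1) x‖ ≤ 14 := near_A hn hx hy1 hy2 (by push_cast; linarith) (by push_cast; linarith)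
  have n2 : ‖AA s (((n+1:ℕ):ℝ)+1) x‖ ≤ 14 := near_A hn hx hy1 hy2 (by push_cast; linarith) (by push_cast; linarith)
  have n3 : ‖AA s (((n+2:ℕ):ℝ)+1) x‖ ≤ 14 := near_A hn hx hy1 hy2 (by push_cast; linarith) (by push_cast; linarith)
  have n4 : ‖AA s (((n+3:ℕ):ℝ)+1) x‖ ≤ 14 := near_A hn hx hy1 hy2 (by push_cast; linarith) (by push_cast; linarith)
  have hG := G_bd hn hx hy1 hy2
  have hlow : ‖∑ i ∈ Finset.range n, AA s ((i:ℝ)+1) x - (∑ i ∈ Finset.range n, (((i:ℝ)+1:ℝ):ℂ)^(s-1)) * BB s x‖ ≤ 4 := by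
    rw [Finset.sum_mul, ← Finset.sum_sub_distrib]
    calc _ ≤ ∑ i ∈ Finset.range n, (√x)⁻¹ * (1/(((n+2:ℕ):ℝ)-1-((i:ℝ)+1)) + 1/((i:ℝ)+1)) := by
          refine norm_sum_le_of_le _ fun i hi => ?_
          have hi' : (i:ℝ)+1 ≤ n := by exact_mod_cast Finset.mem_range.1 hi
          exact lowA hn hx hy1 (by have : (0:ℝ) ≤ i := by positivity
                                   linarith) (by push_cast; linarith)
      _ = (√x)⁻¹ * (∑ i ∈ Finset.range n, 1/(((n-1-i:ℕ):ℝ)+1) + ∑ i ∈ Finset.range n, 1/((i:ℝ)+1)) := by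
          rw [← Finset.sum_add_distrib, Finset.mul_sum]
          refine Finset.sum_congr rfl fun i hi => ?_
          have hi' := Finset.mem_range.1 hi
          have : ((n-1-i:ℕ):ℝ) = (n:ℝ)-1-i := by
            rw [Nat.sub_sub, Nat.cast_sub (by omega)]; push_cast; ring
          rw [this]; push_cast; congr 4; ring
      _ ≤ (√x)⁻¹ * (2*√n + 2*√n) := by
          rw [Finset.sum_range_reflect (fun k : ℕ => 1/((k:ℝ)+1)) n]
          have := harm_sqrt n
          gcongr
      _ ≤ (√x)⁻¹ * (2*√x + 2*√x) := by
          have : (n:ℝ) ≤ x := by rw [hx]; push_cast; linarith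
          gcongr
      _ = 4 := by
          have := Real.sqrt_pos.2 hx0
          field_simp; norm_num
  have hD : ‖∑ i ∈ Finset.range n, (((i:ℝ)+1:ℝ):ℂ)^(s-1)‖ ≤ ‖DN (n+2) (2*π*y)‖ + 2 := by
    rw [DN_conj]
    have : DN n (2*π*y) = DN (n+2) (2*π*y) - ((n+1:ℕ):ℂ)^(-(sc (2*π*y))) - ((n+1+1:ℕ):ℂ)^(-(sc (2*π*y))) := by
      unfold DN; rw [Finset.sum_range_succ, Finset.sum_range_succ]; ring
    rw [this]
    refine (norm_sub_le _ _).trans ?_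
    have a := norm_sub_le (DN (n+2) (2*π*y)) (((n+1:ℕ):ℂ)^(-(sc (2*π*y))))
    have b := term_le_one n (2*π*y)
    have c := term_le_one (n+1) (2*π*y)
    linarith
  have hpole : ‖(x:ℂ)^(1-s)/(s-1)‖ ≤ 1 := by
    rw [norm_div, Complex.norm_cpow_eq_rpow_re_of_pos hx0]
    have e : (1-s).re = 1/2 := by simp [hs, sc]; norm_num
    rw [e, ← Real.sqrt_eq_rpow]
    have h1 : 2*π*y ≤ ‖s-1‖ := by
      have := Complex.abs_im_le_norm (s-1)
      simp only [Complex.sub_im, hs, sc_im, Complex.one_im, sub_zero] at this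
      exact (le_abs_self _).trans this
    have h2 : √x ≤ y := by
      rw [Real.sqrt_le_left (by linarith)]
      nlinarith
    apply div_le_one_of_le₀ _ (norm_nonneg _)
    nlinarith
  have hDN : 0 ≤ ‖DN (n+2) (2*π*y)‖ := norm_nonneg _
  have e : riemannZeta s = DN (n+2) (2*π*y) + (x:ℂ)^(1-s)/(s-1) + (∑' i : ℕ, AA s (-((i:ℝ)+1)) x) +
      (∑' j : ℕ, AA s (((j+(n+2+2):ℕ):ℝ)+1) x) + (AA s ((n:ℝ)+1) x + AA s (((n+1:ℕ):ℝ)+1) x + AA s (((n+2:ℕ):ℝ)+1) x + AA s (((n+3:ℕ):ℝ)+1) x)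
      + (∑ i ∈ Finset.range n, AA s ((i:ℝ)+1) x - (∑ i ∈ Finset.range n, (((i:ℝ)+1:ℝ):ℂ)^(s-1)) * BB s x)
      + (∑ i ∈ Finset.range n, (((i:ℝ)+1:ℝ):ℂ)^(s-1)) * BB s x := by
    rw [hz]
    rw [hfour] at hsplit
    have : RN s (n+2) = _ := (sub_eq_iff_eq_add.1 (sub_eq_iff_eq_add.1 hsplit.symm))
    rw [this]
    unfold DN
    ring
  rw [e]
  have hmul : ‖(∑ i ∈ Finset.range n, (((i:ℝ)+1:ℝ):ℂ)^(s-1)) * BB s x‖ ≤ (‖DN (n+2) (2*π*y)‖ + 2) * 14 := by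
    rw [norm_mul]; gcongr
  refine (norm_add_le_of_le (norm_add_le_of_le (norm_add_le_of_le (norm_add_le_of_le (norm_add_le_of_le (norm_add_le_of_le le_rfl hpole) bneg) bfar)
    (norm_add_le_of_le (norm_add_le_of_le (norm_add_le_of_le n1 n2) n3) n4)) hlow) hmul).trans ?_
  nlinarith

/-- Fejer weight -/
noncomputable def ww (ξ : ℝ) : ℝ := (Real.sinc (π*ξ))^2
noncomputable def fj (u : ℝ) : ℝ := max 0 (1-|u|)

lemma ww_cont : Continuous ww := by
  unfold ww; exact (Real.continuous_sinc.comp (continuous_const.mul continuous_id)).pow 2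
lemma ww_nonneg (ξ : ℝ) : 0 ≤ ww ξ := sq_nonneg _
lemma ww_le_one (ξ : ℝ) : ww ξ ≤ 1 := by
  unfold ww; rw [sq_le_one_iff_abs_le_one]; exact Real.abs_sinc_le_one _

lemma ww_eq {ξ : ℝ} (h : ξ ≠ 0) : ww ξ = (Real.sin (π*ξ))^2/(π^2*ξ^2) := by
  unfold ww
  rw [Real.sinc_of_ne_zero (mul_ne_zero Real.pi_ne_zero h), div_pow, mul_pow]

lemma ww_sq_le (ξ : ℝ) : ξ^2 * ww ξ ≤ 1 := by
  by_cases h : ξ = 0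
  · simp [h]
  rw [ww_eq h]
  have h1 := Real.sin_sq_le_one (π*ξ)
  have hpi := Real.pi_gt_three
  have : 0 < ξ^2 := by positivity
  rw [mul_div_assoc', div_le_one (by positivity)]
  have h3 : 1 ≤ π^2 := by nlinarith
  nlinarith

lemma ww_le (ξ : ℝ) : ww ξ ≤ 2*(1+ξ^2)⁻¹ := by
  rw [← div_eq_mul_inv, le_div_iff₀ (by positivity)]
  have := ww_sq_le ξ
  have := ww_le_one ξ
  nlinarith

lemma ww_tail {R : ℝ} (hR : 0 < R) (ξ : ℝ) (h : R ≤ |ξ|) : ww ξ ≤ 2/R^2 * (1+(ξ/R)^2)⁻¹ := by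
  have h1 : R^2 ≤ ξ^2 := by rw [← sq_abs ξ]; gcongr
  have := ww_sq_le ξ
  have h0 := ww_nonneg ξ
  have e : 2/R^2 * (1+(ξ/R)^2)⁻¹ = 2/(R^2+ξ^2) := by field_simp
  rw [e, le_div_iff₀ (by positivity)]
  nlinarith

lemma ww_int : Integrable ww :=
  (integrable_inv_one_add_sq.const_mul 2).mono' ww_cont.aestronglyMeasurable
    (Filter.Eventually.of_forall fun ξ => by rw [Real.norm_of_nonneg (ww_nonneg ξ)]; exact ww_le ξ)

lemma tail_int {R : ℝ} (hR : 0 < R) : Integrable (fun ξ : ℝ => 2/R^2 * (1+(ξ/R)^2)⁻¹) :=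
  (integrable_inv_one_add_sq.comp_div hR.ne').const_mul _

lemma tail_val {R : ℝ} (hR : 0 < R) : ∫ ξ : ℝ, 2/R^2 * (1+(ξ/R)^2)⁻¹ = 2*π/R := by
  rw [integral_const_mul, Measure.integral_comp_div (fun ξ : ℝ => (1+ξ^2)⁻¹), integral_univ_inv_one_add_sq, abs_of_pos hR, smul_eq_mul]
  field_simp

lemma ww_ge {ξ : ℝ} (h : |2*π*ξ| ≤ 1) : 1/2 ≤ ww ξ := by
  by_cases h0 : ξ = 0
  · simp [ww, h0]; norm_num
  have key : ∀ x : ℝ, 0 < x → x ≤ 1/2 → 23/24 ≤ Real.sinc x := by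
    intro x hx hx2
    rw [Real.sinc_of_ne_zero hx.ne', le_div_iff₀ hx]
    have := Real.sin_gt_sub_cube hx
    nlinarith [mul_pos hx hx]
  have hpi := Real.pi_pos
  have h2 : |π*ξ| ≤ 1/2 := by
    rw [show 2*π*ξ = 2*(π*ξ) by ring, abs_mul, abs_two] at h; linarith
  have h3 : 23/24 ≤ Real.sinc (π*ξ) := by
    rcases lt_or_gt_of_ne (mul_ne_zero hpi.ne' h0) with h4 | h4
    · rw [← Real.sinc_neg]; rw [abs_of_neg h4] at h2; exact key _ (by linarith) h2
    · rw [abs_of_pos h4] at h2; exact key _ h4 h2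
  unfold ww; nlinarith

lemma fj_cont : Continuous fj := by unfold fj; fun_prop

lemma fj_zero {u : ℝ} (h : 1 ≤ |u|) : fj u = 0 := by unfold fj; exact max_eq_left (by linarith)

lemma fj_int : Integrable (fun u => ((fj u:ℝ):ℂ)) := by
  apply Continuous.integrable_of_hasCompactSupport
  · exact Complex.continuous_ofReal.comp fj_cont
  · apply HasCompactSupport.intro (isCompact_Icc (a := (-1:ℝ)) (b := 1))
    intro u hu
    have : 1 ≤ |u| := by
      by_contra hc; push Not at hc; rw [abs_lt] at hc; exact hu ⟨hc.1.le, hc.2.le⟩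
    simp [fj_zero this]

lemma fj_fourier {ξ : ℝ} (h : ξ ≠ 0) :
    ∫ u : ℝ, Complex.exp (((-2*π*u*ξ : ℝ):ℂ)*Complex.I) • ((fj u:ℝ):ℂ) = (ww ξ : ℂ) := by
  set k : ℂ := ((-2*π*ξ:ℝ):ℂ)*Complex.I with hk
  have hk0 : k ≠ 0 := by
    rw [hk]; apply mul_ne_zero _ Complex.I_ne_zero
    have : -2*π*ξ ≠ 0 := by have := Real.pi_ne_zero; positivity
    exact_mod_cast this
  set g : ℝ → ℂ := fun u => Complex.exp (k*u) * ((fj u:ℝ):ℂ) with hg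
  have gcont : Continuous g := by
    have := fj_cont
    fun_prop
  have e1 : ∫ u : ℝ, Complex.exp (((-2*π*u*ξ : ℝ):ℂ)*Complex.I) • ((fj u:ℝ):ℂ) = ∫ u in (-1:ℝ)..1, g u := by
    rw [intervalIntegral.integral_of_le (by norm_num), setIntegral_eq_integral_of_forall_compl_eq_zero]
    · refine integral_congr_ae (Filter.Eventually.of_forall fun u => ?_)
      simp only [hg, smul_eq_mul, hk]
      congr 2; push_cast; ring
    · intro u hu
      have : 1 ≤ |u| := by
        by_contra hc; push Not at hc; rw [abs_lt] at hc; exact hu ⟨hc.1, hc.2.le⟩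
      simp [hg, fj_zero this]
  have de : ∀ u : ℝ, HasDerivAt (fun u : ℝ => Complex.exp (k*u)) (k*Complex.exp (k*u)) u := by
    intro u
    have := (((hasDerivAt_id (u:ℂ)).const_mul k).cexp).comp_ofReal
    refine this.congr_deriv ?_
    simp; ring
  have dl : ∀ u : ℝ, HasDerivAt (fun u : ℝ => (u:ℂ)) 1 u := fun u => (hasDerivAt_id (u:ℂ)).comp_ofReal
  have i1 : ∫ u in (-1:ℝ)..0, g u = (1/k - 1/k^2) + Complex.exp (-k)/k^2 := by
    rw [intervalIntegral.integral_eq_sub_of_hasDerivAt (f := fun u : ℝ => ((1+(u:ℂ))/k - 1/k^2) * Complex.exp (k*u))]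
    · push_cast; simp; ring
    · intro u hu
      rw [Set.uIcc_of_le (by norm_num)] at hu
      refine (((((dl u).const_add 1).div_const k).sub_const _).mul (de u)).congr_deriv ?_
      have : fj u = 1+u := by
        unfold fj; rw [abs_of_nonpos hu.2, max_eq_right (by linarith [hu.1])]; ring
      simp only [hg, this]; push_cast
      field_simp; ring
    · exact gcont.intervalIntegrable _ _
  have i2 : ∫ u in (0:ℝ)..1, g u = Complex.exp k/k^2 - 1/k - 1/k^2 := by
    rw [intervalIntegral.integral_eq_sub_of_hasDerivAt (f := fun u : ℝ => ((1-(u:ℂ))/k + 1/k^2) * Complex.exp (k*u))]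
    · push_cast; simp; ring
    · intro u hu
      rw [Set.uIcc_of_le (by norm_num)] at hu
      refine (((((dl u).const_sub 1).div_const k).add_const _).mul (de u)).congr_deriv ?_
      have : fj u = 1-u := by
        unfold fj; rw [abs_of_nonneg hu.1, max_eq_right (by linarith [hu.2])]
      simp only [hg, this]; push_cast
      field_simp; ring
    · exact gcont.intervalIntegrable _ _
  rw [e1, ← intervalIntegral.integral_add_adjacent_intervals (b := 0) (gcont.intervalIntegrable _ _) (gcont.intervalIntegrable _ _), i1, i2, ww_eq h]
  have hcos : Complex.exp k + Complex.exp (-k) = ((2*Real.cos (2*(π*ξ)) : ℝ):ℂ) := by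
    push_cast
    rw [Complex.two_cos, hk, add_comm]
    congr 2 <;> (push_cast; ring)
  have hk2 : k^2 = ((-(4*π^2*ξ^2):ℝ):ℂ) := by
    rw [hk, mul_pow, Complex.I_sq]; push_cast; ring
  have e3 : 1 / k - 1 / k ^ 2 + Complex.exp (-k) / k ^ 2 + (Complex.exp k / k ^ 2 - 1 / k - 1 / k ^ 2) = (Complex.exp k + Complex.exp (-k) - 2)/k^2 := by
    ring
  rw [e3, hcos, hk2]
  have : (Real.sin (π*ξ))^2 = (1 - Real.cos (2*(π*ξ)))/2 := by
    rw [Real.cos_two_mul, ← Real.sin_sq_add_cos_sq (π*ξ)]; ring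
  rw [this]
  norm_cast
  have := Real.pi_ne_zero
  field_simp
  ring

lemma ww_fourier (y : ℝ) : ∫ ξ : ℝ, (ww ξ : ℂ) * Complex.exp (((2*π*ξ*y : ℝ):ℂ)*Complex.I) = (fj y : ℂ) := by
  set f : ℝ → ℂ := fun u => ((fj u:ℝ):ℂ) with hf
  have hae : FourierTransform.fourier f =ᵐ[volume] fun ξ => (ww ξ:ℂ) := by
    have : ∀ᵐ ξ : ℝ, ξ ≠ 0 := by simp [ae_iff]
    filter_upwards [this] with ξ hξ
    rw [Real.fourier_real_eq_integral_exp_smul]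
    exact fj_fourier hξ
  have hintg : Integrable (FourierTransform.fourier f) := (ww_int.ofReal (𝕜 := ℂ)).congr hae.symm
  have inv := congrFun (Continuous.fourierInv_fourier_eq (f := f) (Complex.continuous_ofReal.comp fj_cont) fj_int hintg) y
  rw [Real.fourierInv_eq'] at inv
  rw [hf] at inv
  rw [← show _ = (fj y:ℂ) from inv]
  refine integral_congr_ae ?_
  filter_upwards [hae] with ξ hξ
  rw [← hf, hξ, smul_eq_mul, mul_comm]
  congr 3
  simp; ring

lemma exp_norm1 (r : ℝ) : ‖Complex.exp ((r:ℂ)*Complex.I)‖ = 1 := Complex.norm_exp_ofReal_mul_I r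

lemma ww_exp_int (t U l : ℝ) : Integrable (fun ξ : ℝ => (ww ξ:ℂ) * Complex.exp ((((t+2*π*U*ξ)*l:ℝ):ℂ)*Complex.I)) := by
  refine (ww_int.ofReal (𝕜 := ℂ)).mul_bdd (c := 1) ?_ ?_
  · apply Continuous.aestronglyMeasurable; fun_prop
  · exact Filter.Eventually.of_forall fun ξ => (exp_norm1 _).le

lemma ww_exp (t U l : ℝ) : ∫ ξ : ℝ, (ww ξ:ℂ) * Complex.exp ((((t+2*π*U*ξ)*l:ℝ):ℂ)*Complex.I)
    = (fj (U*l):ℂ) * Complex.exp (((t*l:ℝ):ℂ)*Complex.I) := by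
  rw [← ww_fourier, ← integral_mul_const]
  refine integral_congr_ae (Filter.Eventually.of_forall fun ξ => ?_)
  beta_reduce
  rw [mul_assoc (ww ξ:ℂ), ← Complex.exp_add]
  congr 2; push_cast; ring

lemma ww_one : ∫ ξ : ℝ, ww ξ = 1 := by
  have := ww_fourier 0
  simp only [mul_zero, Complex.ofReal_zero, zero_mul, Complex.exp_zero, mul_one] at this
  rw [integral_complex_ofReal] at this
  have h2 : fj 0 = 1 := by simp [fj]
  rw [h2] at this
  exact_mod_cast this

noncomputable def gg (t U : ℝ) (a b : ℕ) : ℂ :=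
  (((√(a:ℝ))⁻¹ * (√(b:ℝ))⁻¹ * fj (U*(Real.log b - Real.log a)) : ℝ):ℂ) * Complex.exp (((t*(Real.log b - Real.log a):ℝ):ℂ)*Complex.I)

noncomputable def DA (A : Finset ℕ) (τ : ℝ) : ℂ := ∑ n ∈ A, (n:ℂ)^(-(sc τ))

lemma pow_form {n : ℕ} (hn : 0 < n) (τ : ℝ) :
    (n:ℂ)^(-(sc τ)) = (((√(n:ℝ))⁻¹:ℝ):ℂ) * Complex.exp (((-(τ*Real.log n):ℝ):ℂ)*Complex.I) := by
  have h0 : (0:ℝ) < n := by exact_mod_cast hn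
  have := cpow_split (-(1/2)) τ h0
  rw [rph h0] at this
  rw [← this]
  congr 1; simp [sc]; ring

lemma DA_bound (A : Finset ℕ) (hA : ∀ n ∈ A, 0 < n) (τ : ℝ) : ‖DA A τ‖ ≤ A.card := by
  unfold DA
  refine (norm_sum_le_of_le (f := fun n : ℕ => (n:ℂ)^(-(sc τ))) A (n := fun _ => (1:ℝ)) ?_).trans (by simp)
  intro n hn
  obtain ⟨k, rfl⟩ : ∃ k, n = k+1 := ⟨n-1, by have := hA n hn; omega⟩
  exact term_le_one k τ

lemma DA_cont (A : Finset ℕ) (hA : ∀ n ∈ A, 0 < n) : Continuous (DA A) := by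
  unfold DA
  refine continuous_finsetSum _ fun n hn => ?_
  simp only [pow_form (hA n hn)]
  fun_prop

lemma DA_int (A : Finset ℕ) (hA : ∀ n ∈ A, 0 < n) (t U : ℝ) :
    Integrable (fun ξ => ww ξ * ‖DA A (t+2*π*U*ξ)‖^2) := by
  refine ww_int.mul_bdd (c := (A.card:ℝ)^2) ?_ ?_
  · apply Continuous.aestronglyMeasurable
    have := DA_cont A hA
    fun_prop
  · refine Filter.Eventually.of_forall fun ξ => ?_
    rw [Real.norm_of_nonneg (by positivity)]
    have := DA_bound A hA (t+2*π*U*ξ)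
    gcongr

lemma quad_int (A : Finset ℕ) (hA : ∀ n ∈ A, 0 < n) (t U : ℝ) :
    ((∫ ξ : ℝ, ww ξ * ‖DA A (t+2*π*U*ξ)‖^2 : ℝ):ℂ) = ∑ a ∈ A, ∑ b ∈ A, gg t U a b := by
  rw [← integral_complex_ofReal]
  have e : ∀ ξ : ℝ, ((ww ξ * ‖DA A (t+2*π*U*ξ)‖^2 : ℝ):ℂ) = ∑ a ∈ A, ∑ b ∈ A,
      (((√(a:ℝ))⁻¹ * (√(b:ℝ))⁻¹:ℝ):ℂ) * ((ww ξ:ℂ) * Complex.exp ((((t+2*π*U*ξ)*(Real.log b - Real.log a):ℝ):ℂ)*Complex.I)) := by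
    intro ξ
    have h1 : ((‖DA A (t+2*π*U*ξ)‖^2 : ℝ):ℂ) = DA A (t+2*π*U*ξ) * (starRingEnd ℂ) (DA A (t+2*π*U*ξ)) := by
      rw [Complex.mul_conj, Complex.normSq_eq_norm_sq]
    rw [Complex.ofReal_mul, h1]
    unfold DA
    rw [map_sum, Finset.sum_mul_sum, Finset.mul_sum]
    refine Finset.sum_congr rfl fun a ha => ?_
    rw [Finset.mul_sum]
    refine Finset.sum_congr rfl fun b hb => ?_
    rw [pow_form (hA a ha), pow_form (hA b hb), map_mul, Complex.conj_ofReal, ← Complex.exp_conj, map_mul, Complex.conj_I, Complex.conj_ofReal]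
    have : Complex.exp ((((t+2*π*U*ξ)*(Real.log b - Real.log a):ℝ):ℂ)*Complex.I) = Complex.exp (((-((t+2*π*U*ξ)*Real.log a):ℝ):ℂ)*Complex.I) * Complex.exp (((-((t+2*π*U*ξ)*Real.log b):ℝ):ℂ)*(-Complex.I)) := by
      rw [← Complex.exp_add]; congr 1; push_cast; ring
    rw [this]; push_cast; ring
  refine (integral_congr_ae (Filter.Eventually.of_forall e)).trans ?_
  rw [integral_finsetSum _ fun a ha => integrable_finsetSum _ fun b hb => (ww_exp_int t U _).const_mul _]
  refine Finset.sum_congr rfl fun a ha => ?_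
  rw [integral_finsetSum _ fun b hb => (ww_exp_int t U _).const_mul _]
  refine Finset.sum_congr rfl fun b hb => ?_
  rw [integral_const_mul, ww_exp]
  unfold gg; push_cast; ring

lemma gg_conj (t U : ℝ) (a b : ℕ) : gg t U a b = (starRingEnd ℂ) (gg t U b a) := by
  unfold gg
  rw [map_mul, Complex.conj_ofReal, ← Complex.exp_conj, map_mul, Complex.conj_I, Complex.conj_ofReal]
  have : fj (U*(Real.log a - Real.log b)) = fj (U*(Real.log b - Real.log a)) := by
    unfold fj; rw [← abs_neg]; congr 3; ring
  rw [this]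
  congr 1
  · push_cast; ring
  · congr 1; push_cast; ring

lemma gg_diag (t U : ℝ) {a : ℕ} (ha : 0 < a) : gg t U a a = ((1/(a:ℝ):ℝ):ℂ) := by
  unfold gg
  have h0 : (0:ℝ) < a := by exact_mod_cast ha
  have : fj 0 = 1 := by simp [fj]
  simp only [sub_self, mul_zero, this, Complex.ofReal_zero, zero_mul, Complex.exp_zero, mul_one]
  rw [← mul_inv, Real.mul_self_sqrt h0.le, one_div]

lemma DN_eq_DA (N : ℕ) (τ : ℝ) : DN N τ = DA (Finset.Ioc 0 N) τ := by
  unfold DN DA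
  refine Finset.sum_nbij' (fun n => n+1) (fun n => n-1) ?_ ?_ ?_ ?_ ?_
  · intro n hn; simp at hn ⊢; omega
  · intro n hn; simp at hn ⊢; omega
  · intro n hn; simp
  · intro n hn; simp at hn ⊢; omega
  · intro n hn; rfl

def SP (N r : ℕ) : Finset ℕ := (Finset.Ioc 0 N).filter (fun n => n % 2 = r)

lemma SP_pos (N r : ℕ) : ∀ n ∈ SP N r, 0 < n := by
  intro n hn; simp [SP] at hn; omega

lemma DN_sq (N : ℕ) (τ : ℝ) : ‖DN N τ‖^2 ≤ 2*(‖DA (SP N 0) τ‖^2 + ‖DA (SP N 1) τ‖^2) := by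
  have e : DN N τ = DA (SP N 0) τ + DA (SP N 1) τ := by
    rw [DN_eq_DA]
    unfold DA SP
    rw [Finset.sum_filter, Finset.sum_filter, ← Finset.sum_add_distrib]
    refine Finset.sum_congr rfl fun n _ => ?_
    rcases Nat.mod_two_eq_zero_or_one n with h | h <;> simp [h]
  rw [e]
  have h := norm_add_le (DA (SP N 0) τ) (DA (SP N 1) τ)
  have h0 := norm_nonneg (DA (SP N 0) τ + DA (SP N 1) τ)
  nlinarith [sq_nonneg (‖DA (SP N 0) τ‖ - ‖DA (SP N 1) τ‖)]

noncomputable def VV (t U : ℝ) (N : ℕ) : ℂ :=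
  ∑ m ∈ Finset.Ioc 0 N, ∑ h ∈ Finset.Ioc 0 N, if h < m ∧ m + h ≤ N then gg t U (m-h) (m+h) else 0

lemma VV_eq (t U : ℝ) (N : ℕ) : ∑ a ∈ Finset.Ioc 0 N, ∑ b ∈ Finset.Ioc 0 N, (if a % 2 = b % 2 ∧ a < b then gg t U a b else 0) = VV t U N := by
  unfold VV
  rw [← Finset.sum_product', ← Finset.sum_product', ← Finset.sum_filter, ← Finset.sum_filter]
  refine Finset.sum_nbij' (fun p => ((p.1+p.2)/2, (p.2-p.1)/2)) (fun p => (p.1-p.2, p.1+p.2)) ?_ ?_ ?_ ?_ ?_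
  · rintro ⟨a, b⟩ hp
    simp at hp ⊢; omega
  · rintro ⟨a, b⟩ hp
    simp at hp ⊢; omega
  · rintro ⟨a, b⟩ hp
    simp at hp ⊢; omega
  · rintro ⟨a, b⟩ hp
    simp at hp ⊢; omega
  · rintro ⟨a, b⟩ hp
    simp at hp
    simp only
    congr 1 <;> omega

lemma parity_bound (t U : ℝ) (N : ℕ) :
    (∫ ξ : ℝ, ww ξ * ‖DA (SP N 0) (t+2*π*U*ξ)‖^2) + (∫ ξ : ℝ, ww ξ * ‖DA (SP N 1) (t+2*π*U*ξ)‖^2)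
      ≤ ∑ a ∈ Finset.Ioc 0 N, 1/(a:ℝ) + 2*‖VV t U N‖ := by
  set Q := (∫ ξ : ℝ, ww ξ * ‖DA (SP N 0) (t+2*π*U*ξ)‖^2) + (∫ ξ : ℝ, ww ξ * ‖DA (SP N 1) (t+2*π*U*ξ)‖^2) with hQ
  have e : (Q:ℂ) = ((∑ a ∈ Finset.Ioc 0 N, 1/(a:ℝ) : ℝ):ℂ) + VV t U N + (starRingEnd ℂ) (VV t U N) := by
    rw [hQ, Complex.ofReal_add, quad_int _ (SP_pos N 0), quad_int _ (SP_pos N 1)]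
    have hc : (starRingEnd ℂ) (VV t U N) = ∑ a ∈ Finset.Ioc 0 N, ∑ b ∈ Finset.Ioc 0 N, (if b % 2 = a % 2 ∧ b < a then gg t U a b else 0) := by
      rw [← VV_eq, map_sum]
      simp only [map_sum]
      rw [Finset.sum_comm]
      refine Finset.sum_congr rfl fun a _ => ?_
      refine Finset.sum_congr rfl fun b _ => ?_
      rw [apply_ite (starRingEnd ℂ), map_zero, ← gg_conj]
    have hd : ((∑ a ∈ Finset.Ioc 0 N, 1/(a:ℝ) : ℝ):ℂ) = ∑ a ∈ Finset.Ioc 0 N, ∑ b ∈ Finset.Ioc 0 N, (if a = b then gg t U a b else 0) := by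
      rw [Complex.ofReal_sum]
      refine Finset.sum_congr rfl fun a ha => ?_
      rw [Finset.sum_ite_eq, if_pos ha, gg_diag _ _ (Finset.mem_Ioc.1 ha).1]
    rw [hc, hd, ← VV_eq]
    unfold SP
    simp only [Finset.sum_filter]
    rw [← Finset.sum_add_distrib, ← Finset.sum_add_distrib, ← Finset.sum_add_distrib]
    refine Finset.sum_congr rfl fun a _ => ?_
    rw [← Finset.sum_add_distrib, ← Finset.sum_add_distrib]
    rcases Nat.mod_two_eq_zero_or_one a with h | h
    · rw [if_pos h, if_neg (by omega), add_zero]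
      refine Finset.sum_congr rfl fun b _ => ?_
      rcases Nat.mod_two_eq_zero_or_one b with h' | h'
      · rcases lt_trichotomy a b with h2 | h2 | h2
        · simp [h, h', h2, h2.ne, h2.not_gt]
        · subst h2; simp [h]
        · simp [h, h', h2, h2.ne', h2.not_gt]
      · have : a ≠ b := by intro hab; omega
        simp [h, h', this]
    · rw [if_neg (by omega), if_pos h, zero_add]
      refine Finset.sum_congr rfl fun b _ => ?_
      rcases Nat.mod_two_eq_zero_or_one b with h' | h'
      · have : a ≠ b := by intro hab; omega
        simp [h, h', this]
      · rcases lt_trichotomy a b with h2 | h2 | h2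
        · simp [h, h', h2, h2.ne, h2.not_gt]
        · subst h2; simp [h]
        · simp [h, h', h2, h2.ne', h2.not_gt]
  have h1 : Q ≤ ‖(Q:ℂ)‖ := by rw [Complex.norm_real]; exact le_abs_self _
  rw [e] at h1
  refine h1.trans ?_
  refine (norm_add_le _ _).trans ?_
  rw [Complex.norm_conj]
  have h2 := norm_add_le ((∑ a ∈ Finset.Ioc 0 N, 1/(a:ℝ) : ℝ):ℂ) (VV t U N)
  rw [Complex.norm_real, Real.norm_of_nonneg (Finset.sum_nonneg fun a _ => by positivity)] at h2
  linarith

lemma harm_log (N : ℕ) : ∑ a ∈ Finset.Ioc 0 N, 1/(a:ℝ) ≤ 1 + Real.log N := by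
  have := harmonic_le_one_add_log N
  rw [harmonic_eq_sum_Icc] at this
  push_cast at this
  refine le_trans (le_of_eq ?_) this
  refine Finset.sum_congr ?_ fun a _ => by rw [one_div]
  ext a; simp; omega

noncomputable def LL (m h : ℕ) : ℝ := Real.log (((m:ℝ)+h)/((m:ℝ)-h))
noncomputable def vv (t U : ℝ) (m h : ℕ) : ℂ := (fj (U*LL m h):ℂ) * Complex.exp (((t*LL m h:ℝ):ℂ)*Complex.I)
noncomputable def VP (t U : ℝ) (N : ℕ) : ℂ :=
  ∑ m ∈ Finset.Ioc 0 N, ∑ h ∈ Finset.Ioc 0 N, if h < m then ((1/(m:ℝ):ℝ):ℂ) * vv t U m h else 0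

lemma fj_nonneg (u : ℝ) : 0 ≤ fj u := le_max_left _ _
lemma fj_le_one (u : ℝ) : fj u ≤ 1 := by
  unfold fj; exact max_le (by norm_num) (by linarith [abs_nonneg u])

lemma vv_norm (t U : ℝ) (m h : ℕ) : ‖vv t U m h‖ ≤ 1 := by
  unfold vv
  rw [norm_mul, exp_norm1, mul_one, Complex.norm_real, Real.norm_of_nonneg (fj_nonneg _)]
  exact fj_le_one _

lemma gg_vv (t U : ℝ) {m h : ℕ} (hm : h < m) :
    gg t U (m-h) (m+h) = (((√((m:ℝ)-h))⁻¹ * (√((m:ℝ)+h))⁻¹:ℝ):ℂ) * vv t U m h := by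
  have h1 : (h:ℝ) < m := by exact_mod_cast hm
  have h0 : (0:ℝ) ≤ h := by positivity
  unfold gg vv LL
  rw [Real.log_div (by linarith) (by linarith), Nat.cast_sub hm.le]
  push_cast; ring

lemma LL_supp {t U : ℝ} {m h : ℕ} (hv : vv t U m h ≠ 0) :
    U * LL m h < 1 := by
  by_contra hc
  push Not at hc
  apply hv
  unfold vv
  rw [fj_zero (hc.trans (le_abs_self _))]; simp

lemma LL_ge {m h : ℕ} (hm : h < m) : (h:ℝ)/m ≤ LL m h := by
  have h1 : (h:ℝ) < m := by exact_mod_cast hm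
  have h0 : (0:ℝ) ≤ h := by positivity
  unfold LL
  have := Real.one_sub_inv_le_log_of_pos (x := ((m:ℝ)+h)/((m:ℝ)-h)) (div_pos (by linarith) (by linarith))
  refine le_trans ?_ this
  rw [inv_div, one_sub_div (by linarith), div_le_div_iff₀ (by linarith) (by linarith)]
  nlinarith

lemma supp1 {t U : ℝ} {m h : ℕ} (hU : 0 < U) (hm : h < m) (hv : vv t U m h ≠ 0) : U*h ≤ m := by
  have a := LL_supp hv
  have b := LL_ge hm
  have hm0 : (0:ℝ) < m := by exact_mod_cast (Nat.zero_le h).trans_lt hm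
  have : U*((h:ℝ)/m) ≤ 1 := by nlinarith
  rw [mul_div_assoc', div_le_one hm0] at this
  exact this

lemma diff_bd {t U : ℝ} {N m h : ℕ} (hU : 4 ≤ U) (hm : h < m) (hmN : m ≤ N) :
    ‖(if m+h ≤ N then gg t U (m-h) (m+h) else 0) - ((1/(m:ℝ):ℝ):ℂ) * vv t U m h‖
      ≤ if h ≤ ⌊(N:ℝ)/U⌋₊ then 2/(U^2) * (1/(m:ℝ)) + (if N < m+h then 2/(N:ℝ) else 0) else 0 := by
  have h1 : (h:ℝ) < m := by exact_mod_cast hm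
  have h0 : (0:ℝ) ≤ h := by positivity
  have hm0 : (0:ℝ) < m := by linarith
  have hN0 : (m:ℝ) ≤ N := by exact_mod_cast hmN
  have hrhs : 0 ≤ (if h ≤ ⌊(N:ℝ)/U⌋₊ then 2/(U^2) * (1/(m:ℝ)) + (if N < m+h then 2/(N:ℝ) else 0) else 0) := by
    split_ifs <;> positivity
  by_cases hv : vv t U m h = 0
  · have : ‖(if m+h ≤ N then gg t U (m-h) (m+h) else 0) - ((1/(m:ℝ):ℝ):ℂ) * vv t U m h‖ = 0 := by
      rw [gg_vv t U hm, hv]; simp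
    rw [this]; exact hrhs
  have hs := supp1 (by linarith) hm hv
  have hK : h ≤ ⌊(N:ℝ)/U⌋₊ := by
    apply Nat.le_floor
    rw [le_div_iff₀ (by linarith)]; linarith
  rw [if_pos hK]
  have hn := vv_norm t U m h
  by_cases hmh : m + h ≤ N
  · rw [if_pos hmh, if_neg (by omega), gg_vv t U hm, ← sub_mul, ← Complex.ofReal_sub, norm_mul, Complex.norm_real, add_zero]
    have key : |(√((m:ℝ)-h))⁻¹ * (√((m:ℝ)+h))⁻¹ - 1/(m:ℝ)| ≤ 2/(U^2) * (1/(m:ℝ)) := by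
      rw [← mul_inv, ← Real.sqrt_mul (by linarith)]
      have e : ((m:ℝ)-h)*(m+h) = m^2-h^2 := by ring
      rw [e]
      have hh : U^2*(h:ℝ)^2 ≤ m^2 := by rw [← mul_pow]; gcongr
      have hU16 : 16 ≤ U^2 := by nlinarith
      have h16 : 16*(h:ℝ)^2 ≤ m^2 := le_trans (mul_le_mul_of_nonneg_right hU16 (sq_nonneg (h:ℝ))) hh
      have hpos : 0 < (m:ℝ)^2-h^2 := by nlinarith
      have hle : √((m:ℝ)^2-h^2) ≤ m := by rw [Real.sqrt_le_left hm0.le]; nlinarith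
      have hge : (m:ℝ) - h^2/m ≤ √((m:ℝ)^2-h^2) := by
        apply Real.le_sqrt_of_sq_le
        have : (m:ℝ)*(h^2/m) = h^2 := by field_simp
        have h2 : ((h:ℝ)^2/m)^2 ≤ h^2 := by
          rw [div_pow, div_le_iff₀ (by positivity)]; nlinarith [sq_nonneg (h:ℝ)]
        nlinarith
      have hsp := Real.sqrt_pos.2 hpos
      rw [abs_of_nonneg (by rw [one_div, sub_nonneg]; gcongr)]
      have hhalf : (m:ℝ)/2 ≤ √((m:ℝ)^2-h^2) := by
        apply Real.le_sqrt_of_sq_le; nlinarith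
      have e2 : (√((m:ℝ)^2-h^2))⁻¹ - 1/m = (m - √((m:ℝ)^2-h^2))/(√((m:ℝ)^2-h^2)*m) := by
        field_simp
      rw [e2]
      calc (m - √((m:ℝ)^2-h^2))/(√((m:ℝ)^2-h^2)*m) ≤ ((h:ℝ)^2/m)/((m/2)*m) := by
            gcongr
            linarith
        _ = 2*((h:ℝ)^2)/(m^2) * (1/m) := by field_simp
        _ ≤ _ := by
            gcongr ?_ * _
            rw [div_le_div_iff₀ (by positivity) (by positivity)]
            linarith
    rw [Real.norm_eq_abs]
    have := abs_nonneg ((√((m:ℝ)-h))⁻¹ * (√((m:ℝ)+h))⁻¹ - 1/(m:ℝ))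
    nlinarith [norm_nonneg (vv t U m h)]
  · rw [if_neg hmh, if_pos (by omega), zero_sub, norm_neg, norm_mul, Complex.norm_real, Real.norm_of_nonneg (by positivity)]
    have hN' : (N:ℝ) < m + h := by exact_mod_cast (not_le.1 hmh)
    have h3 : (N:ℝ) ≤ 2*m := by nlinarith
    have h4 : 1/(m:ℝ) ≤ 2/N := by
      rw [div_le_div_iff₀ hm0 (by linarith)]; linarith
    have h5 : 0 ≤ 2/(U^2) * (1/(m:ℝ)) := by positivity
    have h6 : 0 ≤ 1/(m:ℝ) := by positivity
    nlinarith [norm_nonneg (vv t U m h)]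

lemma stepA {t U : ℝ} {N : ℕ} (hU : 4 ≤ U) (hN : 1 ≤ N) (hNU : (N:ℝ) ≤ U^2) :
    ‖VV t U N‖ ≤ ‖VP t U N‖ + 2*(1+Real.log N) + 2 := by
  have hN0 : (0:ℝ) < N := by exact_mod_cast hN
  set K := ⌊(N:ℝ)/U⌋₊ with hKdef
  have hKle : (K:ℝ) ≤ N/U := Nat.floor_le (by positivity)
  have hKN : K ≤ N := by
    have : (K:ℝ) ≤ N := hKle.trans (div_le_self hN0.le (by linarith))
    exact_mod_cast this
  have hd : ‖VV t U N - VP t U N‖ ≤ 2*(1+Real.log N) + 2 := by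
    unfold VV VP
    rw [← Finset.sum_sub_distrib]
    calc _ ≤ ∑ m ∈ Finset.Ioc 0 N, ∑ h ∈ Finset.Ioc 0 N, (if h ≤ K then 2/(U^2) * (1/(m:ℝ)) + (if N < m+h then 2/(N:ℝ) else 0) else 0) := by
          refine norm_sum_le_of_le _ fun m hm => ?_
          rw [← Finset.sum_sub_distrib]
          refine norm_sum_le_of_le _ fun h hh => ?_
          by_cases hlt : h < m
          · have := diff_bd (t := t) (N := N) hU hlt (Finset.mem_Ioc.1 hm).2
            simpa [hlt] using this
          · simp only [hlt, false_and, if_false, sub_zero, norm_zero]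
            split_ifs <;> positivity
      _ = ∑ m ∈ Finset.Ioc 0 N, ∑ h ∈ Finset.Ioc 0 K, (2/(U^2) * (1/(m:ℝ)) + (if N < m+h then 2/(N:ℝ) else 0)) := by
          refine Finset.sum_congr rfl fun m _ => ?_
          rw [← Finset.sum_filter]
          congr 1
          ext h; simp; omega
      _ = (∑ m ∈ Finset.Ioc 0 N, K * (2/(U^2) * (1/(m:ℝ)))) + ∑ h ∈ Finset.Ioc 0 K, ∑ m ∈ Finset.Ioc 0 N, (if N < m+h then 2/(N:ℝ) else 0) := by
          rw [Finset.sum_comm (s := Finset.Ioc 0 K), ← Finset.sum_add_distrib]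
          refine Finset.sum_congr rfl fun m _ => ?_
          rw [Finset.sum_add_distrib]; simp
      _ ≤ 2*(1+Real.log N) + 2 := by
          have hU0 : 0 < U := by linarith
          have hsum := harm_log N
          have hsum0 : 0 ≤ ∑ a ∈ Finset.Ioc 0 N, 1/(a:ℝ) := Finset.sum_nonneg fun a _ => by positivity
          apply add_le_add
          · have e : ∑ m ∈ Finset.Ioc 0 N, K * (2/(U^2) * (1/(m:ℝ))) = (K*(2/U^2)) * ∑ m ∈ Finset.Ioc 0 N, 1/(m:ℝ) := by
              rw [Finset.mul_sum]; refine Finset.sum_congr rfl fun m _ => by ring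
            rw [e]
            have hc : (K:ℝ)*(2/U^2) ≤ 2 := by
              have : (K:ℝ) ≤ U^2 := hKle.trans ((div_le_self hN0.le (by linarith)).trans hNU)
              rw [mul_div_assoc', div_le_iff₀ (by positivity)]; linarith
            calc _ ≤ 2 * ∑ m ∈ Finset.Ioc 0 N, 1/(m:ℝ) := by gcongr
              _ ≤ _ := by linarith
          · calc ∑ h ∈ Finset.Ioc 0 K, ∑ m ∈ Finset.Ioc 0 N, (if N < m+h then 2/(N:ℝ) else 0)
                ≤ ∑ h ∈ Finset.Ioc 0 K, (K:ℝ)*(2/N) := by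
                  refine Finset.sum_le_sum fun h hh => ?_
                  have hhK := (Finset.mem_Ioc.1 hh).2
                  rw [← Finset.sum_filter, Finset.sum_const, nsmul_eq_mul]
                  have hcard : ((Finset.Ioc 0 N).filter (fun m => N < m+h)).card ≤ K := by
                    have hsub : (Finset.Ioc 0 N).filter (fun m => N < m+h) ⊆ Finset.Ioc (N-h) N := by
                      intro m; simp; omega
                    refine (Finset.card_le_card hsub).trans ?_
                    simp; omega
                  have : (((Finset.Ioc 0 N).filter (fun m => N < m+h)).card:ℝ) ≤ K := by exact_mod_cast hcard
                  gcongr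
              _ = K*K*(2/N) := by simp; ring
              _ ≤ (N/U)*(N/U)*(2/N) := by gcongr
              _ = 2*(N/U^2) := by field_simp
              _ ≤ 2*1 := by
                  gcongr
                  rw [div_le_one (by positivity)]; exact hNU
              _ = 2 := by norm_num
  have e : VV t U N = (VV t U N - VP t U N) + VP t U N := by ring
  have := norm_add_le (VV t U N - VP t U N) (VP t U N)
  rw [← e] at this
  linarith

noncomputable def HH (U M : ℝ) : ℕ := ⌊(Real.exp (1/U) - 1) * M / 2⌋₊
noncomputable def ss (U M τ : ℝ) (m : ℕ) : ℂ :=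
  ∑ h ∈ Finset.Ioc 0 (HH U M), Complex.exp (((τ*LL m h:ℝ):ℂ)*Complex.I)
noncomputable def PM (U M τ : ℝ) : ℂ :=
  ∑ m ∈ Finset.Ioc ⌊M/2⌋₊ ⌊M⌋₊, ((1/(m:ℝ):ℝ):ℂ) * ss U M τ m

lemma Sstar_eq (T U M M₁ : ℝ) : Sstar T U M M₁ = ∑ m ∈ Finset.Ioc ⌊M₁⌋₊ ⌊M⌋₊, ss U M (2*π*T) m := by
  unfold Sstar ss HH LL
  rw [Finset.sum_comm]
  refine Finset.sum_congr rfl fun m _ => Finset.sum_congr rfl fun h _ => ?_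
  congr 1; push_cast; ring

lemma abel (s : ℕ → ℂ) (c : ℕ → ℝ) (hc : Antitone c) (B : ℝ) (b n : ℕ) :
    ∀ a, a + n = b → (∀ k, a ≤ k → k ≤ b → ‖∑ m ∈ Finset.Ioc k b, s m‖ ≤ B) →
    ‖∑ m ∈ Finset.Ioc a b, (c m:ℂ) * s m - c a * ∑ m ∈ Finset.Ioc a b, s m‖ ≤ (c a - c b)*B := by
  induction n with
  | zero => intro a hab _; have : a = b := by omega
            subst this; simp
  | succ n ih =>
    intro a hab hB
    have h1 := ih (a+1) (by omega) (fun k hk hkb => hB k (by omega) hkb)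
    have hs : ∀ f : ℕ → ℂ, ∑ m ∈ Finset.Ioc a b, f m = f (a+1) + ∑ m ∈ Finset.Ioc (a+1) b, f m := by
      intro f
      rw [← Finset.sum_Ioc_consecutive f (Nat.le_succ a) (show a+1 ≤ b by omega)]
      simp
    have e : ∑ m ∈ Finset.Ioc a b, (c m:ℂ) * s m - c a * ∑ m ∈ Finset.Ioc a b, s m =
        (∑ m ∈ Finset.Ioc (a+1) b, (c m:ℂ) * s m - c (a+1) * ∑ m ∈ Finset.Ioc (a+1) b, s m) - ((c a - c (a+1) : ℝ):ℂ) * ∑ m ∈ Finset.Ioc a b, s m := by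
      rw [hs (fun m => (c m:ℂ) * s m), hs s]; push_cast; ring
    rw [e]
    refine (norm_sub_le _ _).trans ?_
    rw [norm_mul, Complex.norm_real, Real.norm_of_nonneg (sub_nonneg.2 (hc (Nat.le_succ a)))]
    have := hB a le_rfl (by omega)
    have h2 : 0 ≤ c a - c (a+1) := sub_nonneg.2 (hc (Nat.le_succ a))
    nlinarith

lemma PM_abel {U M τ ε : ℝ} (hM : 1 ≤ M)
    (hS : ∀ M₁ : ℝ, M/2 ≤ M₁ → M₁ ≤ M → ‖∑ m ∈ Finset.Ioc ⌊M₁⌋₊ ⌊M⌋₊, ss U M τ m‖ ≤ ε*M) :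
    ‖PM U M τ‖ ≤ 8*ε := by
  set a := ⌊M/2⌋₊ with ha
  set b := ⌊M⌋₊ with hb
  have hab : a ≤ b := Nat.floor_mono (by linarith)
  have haM : M/2 < a + 1 := Nat.lt_floor_add_one _
  have hbM : (b:ℝ) ≤ M := Nat.floor_le (by linarith)
  have htail : ∀ k, a ≤ k → k ≤ b → ‖∑ m ∈ Finset.Ioc k b, ss U M τ m‖ ≤ ε*M := by
    intro k hk hkb
    rcases hk.eq_or_lt with h | h
    · rw [← h]; exact hS (M/2) le_rfl (by linarith)
    · have h1 : (a:ℝ)+1 ≤ k := by exact_mod_cast h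
      have h2 : (k:ℝ) ≤ b := by exact_mod_cast hkb
      have := hS k (by linarith) (by linarith)
      rwa [Nat.floor_natCast] at this
  set c : ℕ → ℝ := fun m => (max (m:ℝ) 1)⁻¹ with hc
  have hca : Antitone c := by
    intro i j hij
    simp only [hc]
    have : (i:ℝ) ≤ j := by exact_mod_cast hij
    gcongr
  have h := abel (ss U M τ) c hca (ε*M) b (b-a) a (by omega) htail
  have e : ∑ m ∈ Finset.Ioc a b, (c m:ℂ) * ss U M τ m = PM U M τ := by
    unfold PM
    refine Finset.sum_congr rfl fun m hm => ?_
    have : (1:ℝ) ≤ m := by exact_mod_cast (Nat.zero_le a).trans_lt (Finset.mem_Ioc.1 hm).1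
    simp only [hc]; rw [max_eq_left this, one_div]
  rw [e] at h
  have hεM : 0 ≤ ε*M := (norm_nonneg _).trans (htail a le_rfl hab)
  have hε : 0 ≤ ε := nonneg_of_mul_nonneg_left hεM (by linarith)
  have hcb : 0 ≤ c b := by simp only [hc]; positivity
  have hca0 : 0 ≤ c a := by simp only [hc]; positivity
  have hcM : c a * M ≤ 4 := by
    simp only [hc]
    rw [inv_mul_le_iff₀ (by positivity)]
    rcases Nat.eq_zero_or_pos a with h0 | h0
    · rw [h0]; rw [h0] at haM; norm_num at haM ⊢; linarith
    · have : (1:ℝ) ≤ a := by exact_mod_cast h0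
      rw [max_eq_left this]; linarith
  have h3 : ‖(c a:ℂ) * ∑ m ∈ Finset.Ioc a b, ss U M τ m‖ ≤ c a * (ε*M) := by
    rw [norm_mul, Complex.norm_real, Real.norm_of_nonneg hca0]
    gcongr
    exact htail a le_rfl hab
  have e2 : PM U M τ = (PM U M τ - (c a:ℂ) * ∑ m ∈ Finset.Ioc a b, ss U M τ m) + (c a:ℂ) * ∑ m ∈ Finset.Ioc a b, ss U M τ m := by ring
  rw [e2]
  refine (norm_add_le _ _).trans ?_
  nlinarith

lemma exp_bd {U : ℝ} (hU : 4 ≤ U) : Real.exp (1/U) - 1 ≤ 2/U := by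
  have h1 : |1/U| ≤ 1 := by
    rw [abs_of_pos (by positivity), div_le_one (by linarith)]; linarith
  have := Real.abs_exp_sub_one_le h1
  rw [abs_of_pos (by positivity : 0 < 1/U)] at this
  have := (le_abs_self _).trans this
  rw [mul_one_div] at this; exact this

lemma HH_le {U M : ℝ} (hU : 4 ≤ U) (hM : 1 ≤ M) : (HH U M:ℝ) ≤ M/U := by
  have h1 := exp_bd hU
  have h2 : 0 ≤ Real.exp (1/U) - 1 := by
    have := Real.add_one_le_exp (1/U); have : 0 < 1/U := by positivity
    linarith
  refine (Nat.floor_le (by positivity)).trans ?_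
  calc (Real.exp (1/U) - 1)*M/2 ≤ (2/U)*M/2 := by gcongr
    _ = M/U := by ring

lemma PM_triv {U M τ : ℝ} (hU : 4 ≤ U) (hM : 1 ≤ M) : ‖PM U M τ‖ ≤ 2*M/U := by
  have hH := HH_le hU hM
  have hs : ∀ m, ‖ss U M τ m‖ ≤ M/U := by
    intro m
    unfold ss
    refine (norm_sum_le_of_le _ (n := fun _ => (1:ℝ)) (fun h _ => (exp_norm1 _).le)).trans ?_
    simpa using hH
  have hbM : (⌊M⌋₊:ℝ) ≤ M := Nat.floor_le (by linarith)
  have haM : M/2 < ⌊M/2⌋₊ + 1 := Nat.lt_floor_add_one _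
  unfold PM
  calc _ ≤ ∑ m ∈ Finset.Ioc ⌊M/2⌋₊ ⌊M⌋₊, (2/M)*(M/U) := by
        refine norm_sum_le_of_le _ fun m hm => ?_
        have h1 : ((⌊M/2⌋₊:ℕ):ℝ)+1 ≤ m := by exact_mod_cast (Finset.mem_Ioc.1 hm).1
        rw [norm_mul, Complex.norm_real, Real.norm_of_nonneg (by positivity)]
        have : 1/(m:ℝ) ≤ 2/M := by
          rw [div_le_div_iff₀ (by linarith) (by linarith)]; linarith
        gcongr
        exact hs m
    _ = ((⌊M⌋₊ - ⌊M/2⌋₊:ℕ):ℝ)*((2/M)*(M/U)) := by simp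
    _ ≤ M*((2/M)*(M/U)) := by
        gcongr
        refine le_trans ?_ hbM
        exact_mod_cast Nat.sub_le _ _
    _ = _ := by field_simp

lemma blk_row {t U M : ℝ} {N m : ℕ} (hU : 4 ≤ U) (hM : 1 ≤ M) (hMN : M ≤ N) (hm : m ∈ Finset.Ioc ⌊M/2⌋₊ ⌊M⌋₊) :
    (∑ h ∈ Finset.Ioc 0 N, if h < m then ((1/(m:ℝ):ℝ):ℂ) * vv t U m h else 0) =
      ((1/(m:ℝ):ℝ):ℂ) * ∑ h ∈ Finset.Ioc 0 (HH U M), vv t U m h := by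
  have hbM : (⌊M⌋₊:ℝ) ≤ M := Nat.floor_le (by linarith)
  have haM : M/2 < ⌊M/2⌋₊ + 1 := Nat.lt_floor_add_one _
  have h1 : ((⌊M/2⌋₊:ℕ):ℝ)+1 ≤ m := by exact_mod_cast (Finset.mem_Ioc.1 hm).1
  have h2 : (m:ℝ) ≤ ⌊M⌋₊ := by exact_mod_cast (Finset.mem_Ioc.1 hm).2
  have hH := HH_le hU hM
  have hHm : HH U M < m := by
    have : (HH U M:ℝ) < m := by
      have : M/U ≤ M/2 := by gcongr; linarith
      linarith
    exact_mod_cast this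
  have hHN : HH U M ≤ N := by
    have : (m:ℝ) ≤ N := by linarith
    have : m ≤ N := by exact_mod_cast this
    omega
  rw [Finset.mul_sum]
  symm
  have : ∀ h ∈ Finset.Ioc 0 (HH U M), ((1/(m:ℝ):ℝ):ℂ) * vv t U m h = if h < m then ((1/(m:ℝ):ℝ):ℂ) * vv t U m h else 0 := by
    intro h hh
    rw [if_pos]; have := (Finset.mem_Ioc.1 hh).2; omega
  rw [Finset.sum_congr rfl this]
  refine Finset.sum_subset (Finset.Ioc_subset_Ioc_right hHN) fun h hh hnot => ?_
  by_cases hlt : h < m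
  · rw [if_pos hlt]
    by_contra hne
    have hv : vv t U m h ≠ 0 := fun h0 => hne (by rw [h0, mul_zero])
    apply hnot
    rw [Finset.mem_Ioc]
    refine ⟨(Finset.mem_Ioc.1 hh).1, ?_⟩
    apply Nat.le_floor
    have hL := LL_supp hv
    have hlt' : (h:ℝ) < m := by exact_mod_cast hlt
    have hh0 : (0:ℝ) ≤ h := by positivity
    have hL2 : LL m h < 1/U := by rw [lt_div_iff₀ (by linarith)]; linarith
    unfold LL at hL2
    rw [Real.log_lt_iff_lt_exp (div_pos (by linarith) (by linarith)), div_lt_iff₀ (by linarith)] at hL2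
    have hE : 1 ≤ Real.exp (1/U) := Real.one_le_exp (by positivity)
    have hmM : (m:ℝ) ≤ M := by linarith
    nlinarith
  · rw [if_neg hlt]

lemma blk_int {t U M : ℝ} : ∑ m ∈ Finset.Ioc ⌊M/2⌋₊ ⌊M⌋₊, ((1/(m:ℝ):ℝ):ℂ) * ∑ h ∈ Finset.Ioc 0 (HH U M), vv t U m h
     = ∫ ξ : ℝ, (ww ξ:ℂ) * PM U M (t+2*π*U*ξ) := by
  have e : ∀ ξ : ℝ, (ww ξ:ℂ) * PM U M (t+2*π*U*ξ) = ∑ m ∈ Finset.Ioc ⌊M/2⌋₊ ⌊M⌋₊, ∑ h ∈ Finset.Ioc 0 (HH U M),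
      ((1/(m:ℝ):ℝ):ℂ) * ((ww ξ:ℂ) * Complex.exp ((((t+2*π*U*ξ)*LL m h:ℝ):ℂ)*Complex.I)) := by
    intro ξ
    unfold PM ss
    rw [Finset.mul_sum]
    refine Finset.sum_congr rfl fun m _ => ?_
    rw [Finset.mul_sum, Finset.mul_sum]
    refine Finset.sum_congr rfl fun h _ => by ring
  simp only [e]
  rw [integral_finsetSum _ fun m hm => integrable_finsetSum _ fun h hh => (ww_exp_int t U _).const_mul _]
  refine Finset.sum_congr rfl fun m _ => ?_
  rw [integral_finsetSum _ fun h hh => (ww_exp_int t U _).const_mul _, Finset.mul_sum]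
  refine Finset.sum_congr rfl fun h _ => ?_
  rw [integral_const_mul, ww_exp]
  rfl

lemma blk_bound {t U M ε : ℝ} (ht : 0 < t) (hU : 4 ≤ U) (hM : 1 ≤ M)
    (hε : 0 ≤ ε)
    (hS : ∀ T : ℝ, t/(4*π) ≤ T → T ≤ 3*t/(4*π) → ∀ M₁ : ℝ, M/2 ≤ M₁ → M₁ ≤ M → ‖Sstar T U M M₁‖ ≤ ε*M) :
    ‖∫ ξ : ℝ, (ww ξ:ℂ) * PM U M (t+2*π*U*ξ)‖ ≤ 8*ε + 16*π^2*M/t := by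
  have hpi := Real.pi_pos
  have hU0 : 0 < U := by linarith
  set R := t/(4*π*U) with hR
  have hR0 : 0 < R := by positivity
  have hmain : ∀ ξ : ℝ, ‖(ww ξ:ℂ) * PM U M (t+2*π*U*ξ)‖ ≤ 8*ε*ww ξ + (2*M/U)*(2/R^2 * (1+(ξ/R)^2)⁻¹) := by
    intro ξ
    rw [norm_mul, Complex.norm_real, Real.norm_of_nonneg (ww_nonneg ξ)]
    have hw := ww_nonneg ξ
    by_cases h : R ≤ |ξ|
    · have h1 := ww_tail hR0 ξ h
      have h2 := PM_triv (τ := t+2*π*U*ξ) hU hM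
      have : ww ξ * ‖PM U M (t+2*π*U*ξ)‖ ≤ (2/R^2 * (1+(ξ/R)^2)⁻¹) * (2*M/U) := by gcongr
      have : 0 ≤ 8*ε*ww ξ := by positivity
      linarith
    · push Not at h
      have h3 : 0 ≤ (2*M/U)*(2/R^2 * (1+(ξ/R)^2)⁻¹) := by positivity
      have habs := abs_lt.1 h
      have hRU : 2*U*R = t/(2*π) := by rw [hR]; field_simp; norm_num
      have h4 : ‖PM U M (t+2*π*U*ξ)‖ ≤ 8*ε := by
        apply PM_abel hM
        intro M₁ ha hb
        have := hS (t/(2*π) + U*ξ) (by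
          have e1 : t/(4*π) = t/(2*π) - U*R := by rw [hR]; field_simp; norm_num
          rw [e1]; nlinarith) (by
          have e1 : 3*t/(4*π) = t/(2*π) + U*R := by rw [hR]; field_simp; norm_num
          rw [e1]; nlinarith) M₁ ha hb
        rw [Sstar_eq] at this
        have e2 : 2*π*(t/(2*π)+U*ξ) = t+2*π*U*ξ := by field_simp
        rwa [e2] at this
      nlinarith
  have hi : Integrable (fun ξ : ℝ => 8*ε*ww ξ + (2*M/U)*(2/R^2 * (1+(ξ/R)^2)⁻¹)) :=
    (ww_int.const_mul _).add ((tail_int hR0).const_mul _)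
  refine (norm_integral_le_of_norm_le hi (Filter.Eventually.of_forall hmain)).trans (le_of_eq ?_)
  rw [integral_add (ww_int.const_mul _) ((tail_int hR0).const_mul _), integral_const_mul, integral_const_mul, ww_one, tail_val hR0, hR]
  field_simp
  ring

lemma dyad_split (N : ℕ) (f : ℕ → ℂ) (J : ℕ) :
    ∑ m ∈ Finset.Ioc ⌊(N:ℝ)/2^J⌋₊ N, f m =
      ∑ j ∈ Finset.range J, ∑ m ∈ Finset.Ioc ⌊((N:ℝ)/2^j)/2⌋₊ ⌊(N:ℝ)/2^j⌋₊, f m := by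
  induction J with
  | zero => simp
  | succ J ih =>
    rw [Finset.sum_range_succ, ← ih]
    have e : ((N:ℝ)/2^J)/2 = (N:ℝ)/2^(J+1) := by rw [pow_succ]; field_simp
    rw [e, add_comm (∑ m ∈ Finset.Ioc ⌊(N:ℝ)/2^J⌋₊ N, f m)]
    rw [Finset.sum_Ioc_consecutive]
    · apply Nat.floor_le_floor
      rw [← e]
      have : (0:ℝ) ≤ (N:ℝ)/2^J := by positivity
      linarith
    · apply Nat.floor_le_of_le
      apply div_le_self (by positivity)
      exact one_le_pow₀ (by norm_num)

lemma VP_bound {t U ε : ℝ} {N : ℕ} (ht : 0 < t) (hU : 4 ≤ U) (hN : 1 ≤ N) (hε : 0 ≤ ε)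
    (hS : ∀ M : ℝ, 1 ≤ M → M ≤ N → ∀ T : ℝ, t/(4*π) ≤ T → T ≤ 3*t/(4*π) → ∀ M₁ : ℝ, M/2 ≤ M₁ → M₁ ≤ M →
      ‖Sstar T U M M₁‖ ≤ ε*M) :
    ‖VP t U N‖ ≤ ((Nat.log 2 N + 1 : ℕ):ℝ) * (8*ε + 16*π^2*N/t) := by
  have h0 : ⌊(N:ℝ)/2^(Nat.log 2 N + 1)⌋₊ = 0 := by
    rw [Nat.floor_eq_zero, div_lt_one (by positivity)]
    exact_mod_cast Nat.lt_pow_succ_log_self (by norm_num) N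
  have h1 := dyad_split N (fun m => ∑ h ∈ Finset.Ioc 0 N, if h < m then ((1/(m:ℝ):ℝ):ℂ) * vv t U m h else 0) (Nat.log 2 N + 1)
  rw [h0] at h1
  unfold VP
  rw [h1]
  refine (norm_sum_le _ _).trans ?_
  rw [← nsmul_eq_mul]
  refine (Finset.sum_le_card_nsmul _ _ (8*ε + 16*π^2*N/t) ?_).trans (by simp)
  intro j hj
  have hj' : j ≤ Nat.log 2 N := by have := Finset.mem_range.1 hj; omega
  have hp : (2:ℝ)^j ≤ N := by
    exact_mod_cast (Nat.pow_le_pow_right (by norm_num) hj').trans (Nat.pow_log_le_self 2 (by omega))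
  have hM1 : 1 ≤ (N:ℝ)/2^j := (one_le_div (by positivity)).2 hp
  have hMN : (N:ℝ)/2^j ≤ N := div_le_self (by positivity) (one_le_pow₀ (by norm_num))
  have e : ∑ m ∈ Finset.Ioc ⌊((N:ℝ)/2^j)/2⌋₊ ⌊(N:ℝ)/2^j⌋₊, (∑ h ∈ Finset.Ioc 0 N, if h < m then ((1/(m:ℝ):ℝ):ℂ) * vv t U m h else 0)
      = ∑ m ∈ Finset.Ioc ⌊((N:ℝ)/2^j)/2⌋₊ ⌊(N:ℝ)/2^j⌋₊, ((1/(m:ℝ):ℝ):ℂ) * ∑ h ∈ Finset.Ioc 0 (HH U ((N:ℝ)/2^j)), vv t U m h :=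
    Finset.sum_congr rfl fun m hm => blk_row hU hM1 hMN hm
  rw [e, blk_int]
  refine (blk_bound ht hU hM1 hε (hS _ hM1 hMN)).trans ?_
  gcongr

lemma meansq {C t U : ℝ} {N : ℕ} (hC : 0 < C) (hU : 0 < U)
    (h : ∀ ξ : ℝ, |2*π*ξ| ≤ 1 → ‖riemannZeta (sc (t+2*π*U*ξ))‖ ≤ C*(‖DN N (t+2*π*U*ξ)‖+1)) :
    (1 / (2*U)) * ∫ τ in (t - U)..(t + U), ‖riemannZeta (1/2 + τ * Complex.I)‖ ^ 2 ≤
      4*π*C^2*(1 + 2*(∑ a ∈ Finset.Ioc 0 N, 1/(a:ℝ) + 2*‖VV t U N‖)) := by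
  have hpi := Real.pi_pos
  have hsub := intervalIntegral.integral_comp_add_mul (a := -(1/(2*π))) (b := 1/(2*π))
    (fun τ : ℝ => ‖riemannZeta (sc τ)‖^2) (c := 2*π*U) (by positivity) t
  have e1 : t + 2*π*U*(-(1/(2*π))) = t - U := by field_simp; ring
  have e2 : t + 2*π*U*(1/(2*π)) = t + U := by field_simp
  rw [e1, e2, smul_eq_mul] at hsub
  set I0 := ∫ τ in (t - U)..(t + U), ‖riemannZeta (sc τ)‖^2 with hI0
  change 1/(2*U) * I0 ≤ _
  have e3 : 1/(2*U)*I0 = π * ((2*π*U)⁻¹*I0) := by field_simp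
  rw [e3, ← hsub]
  set g : ℝ → ℝ := fun ξ => 4*C^2*(ww ξ + 2*(ww ξ * ‖DA (SP N 0) (t+2*π*U*ξ)‖^2 + ww ξ * ‖DA (SP N 1) (t+2*π*U*ξ)‖^2)) with hg
  have i0 := DA_int (SP N 0) (SP_pos N 0) t U
  have i1 := DA_int (SP N 1) (SP_pos N 1) t U
  have ig : Integrable g := (ww_int.add ((i0.add i1).const_mul 2)).const_mul _
  have vg : ∫ ξ, g ξ = 4*C^2*(1 + 2*((∫ ξ, ww ξ * ‖DA (SP N 0) (t+2*π*U*ξ)‖^2) + ∫ ξ, ww ξ * ‖DA (SP N 1) (t+2*π*U*ξ)‖^2)) := by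
    have i2 : Integrable (fun ξ => 2*(ww ξ * ‖DA (SP N 0) (t+2*π*U*ξ)‖^2 + ww ξ * ‖DA (SP N 1) (t+2*π*U*ξ)‖^2)) :=
      (i0.add i1).const_mul 2
    rw [hg, integral_const_mul, integral_add ww_int i2, integral_const_mul, integral_add i0 i1, ww_one]
  have gnn : ∀ ξ, 0 ≤ g ξ := by
    intro ξ
    have := ww_nonneg ξ
    simp only [hg]; positivity
  have key : (∫ ξ in (-(1/(2*π)))..(1/(2*π)), ‖riemannZeta (sc (t+2*π*U*ξ))‖^2) ≤ ∫ ξ, g ξ := by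
    have hab : -(1/(2*π)) ≤ 1/(2*π) := by
      have : 0 < 1/(2*π) := by positivity
      linarith
    rw [intervalIntegral.integral_of_le hab]
    refine le_trans ?_ (setIntegral_le_integral (s := Set.Ioc (-(1/(2*π))) (1/(2*π))) ig (Filter.Eventually.of_forall gnn))
    apply integral_mono_of_nonneg (Filter.Eventually.of_forall fun ξ => by positivity) ig.integrableOn
    refine (ae_restrict_iff' measurableSet_Ioc).2 (Filter.Eventually.of_forall fun ξ hξ => ?_)
    have hx : |2*π*ξ| ≤ 1 := by
      have e4 : 2*π*(1/(2*π)) = 1 := by field_simp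
      rw [abs_le]
      constructor
      · nlinarith [hξ.1]
      · nlinarith [hξ.2]
    have h1 := h ξ hx
    have h2 := ww_ge hx
    have h3 := DN_sq N (t+2*π*U*ξ)
    set d := ‖DN N (t+2*π*U*ξ)‖
    set A := ‖DA (SP N 0) (t+2*π*U*ξ)‖^2
    set B := ‖DA (SP N 1) (t+2*π*U*ξ)‖^2
    have hA : 0 ≤ A := by positivity
    have hB : 0 ≤ B := by positivity
    calc ‖riemannZeta (sc (t+2*π*U*ξ))‖^2 ≤ (C*(d+1))^2 := by gcongr
      _ ≤ C^2 * (2*(d^2+1)) := by rw [mul_pow]; gcongr; nlinarith [sq_nonneg (d-1)]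
      _ ≤ C^2 * (2*(2*(A+B)+1)) := by gcongr
      _ = 4*C^2*((1/2)*(2*(A+B)+1)) := by ring
      _ ≤ 4*C^2*(ww ξ*(2*(A+B)+1)) := by gcongr
      _ = _ := by simp only [hg]; ring
  have hp := parity_bound t U N
  calc _ ≤ π * ∫ ξ, g ξ := by gcongr
    _ = 4*π*C^2*(1 + 2*((∫ ξ, ww ξ * ‖DA (SP N 0) (t+2*π*U*ξ)‖^2) + ∫ ξ, ww ξ * ‖DA (SP N 1) (t+2*π*U*ξ)‖^2)) := by rw [vg]; ring
    _ ≤ _ := by gcongr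

lemma params {t U : ℝ} (ht : 0 < t) (hU : 0 < U) (h1 : √(π*t) ≤ U^2) (h2 : U^2 ≤ t/(2*π)) :
    ∃ N : ℕ, 4 ≤ N ∧ 4 ≤ U ∧ 100 ≤ t ∧ (N:ℝ) ≤ U^2 ∧ (N:ℝ) ≤ √(t/(2*π)) ∧ (N:ℝ) ≤ t ∧ 16*π^2*N/t ≤ 7 ∧
      ∀ ξ : ℝ, |2*π*ξ| ≤ 1 → xh N*((N:ℝ)-1) ≤ t/(2*π) + U*ξ ∧ t/(2*π) + U*ξ ≤ xh N*((N:ℝ)+2) := by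
  have hpi := Real.pi_gt_three
  have hpi2 := Real.pi_lt_d2
  -- R0 is the square root of t over two pi
  set R := √(t/(2*π)) with hR
  have hR0 : 0 < R := Real.sqrt_pos.2 (by positivity)
  have hR2 : R^2 = t/(2*π) := Real.sq_sqrt (by positivity)
  have htR : t = 2*π*R^2 := by rw [hR2]; field_simp
  set S := √(π*t) with hS
  have hS0 : 0 < S := Real.sqrt_pos.2 (by positivity)
  have hS2 : S^2 = π*t := Real.sq_sqrt (by positivity)
  have hSR : S ≤ R^2 := by rw [hR2]; linarith
  have a1 : S^2 ≤ (R^2)^2 := by gcongr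
  have a2 : 2*π^2 ≤ R^2 := by
    rw [hS2, htR] at a1
    have : 0 < R^2 := by positivity
    by_contra hc
    push Not at hc
    nlinarith
  have hR4 : 4 ≤ R := by nlinarith
  have hRS : R ≤ S := by
    refine (pow_le_pow_iff_left₀ (by positivity) hS0.le two_ne_zero).1 ?_
    rw [hS2, htR]; nlinarith [sq_nonneg R]
  have hU4 : 4 ≤ U := by
    have : 4*R ≤ S := by
      refine (pow_le_pow_iff_left₀ (by positivity) hS0.le two_ne_zero).1 ?_
      rw [hS2, htR]
      nlinarith [sq_nonneg R]
    nlinarith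
  have hUR : U ≤ R := by
    refine (pow_le_pow_iff_left₀ (by positivity) hR0.le two_ne_zero).1 ?_
    rw [hR2]; exact h2
  have hN1 : (⌊R⌋₊:ℝ) ≤ R := Nat.floor_le hR0.le
  have hN2 : R < (⌊R⌋₊:ℝ)+1 := Nat.lt_floor_add_one R
  have hN4 : 4 ≤ ⌊R⌋₊ := Nat.le_floor (by exact_mod_cast hR4)
  have hN4' : (4:ℝ) ≤ (⌊R⌋₊:ℝ) := by exact_mod_cast hN4
  refine ⟨⌊R⌋₊, hN4, hU4, ?_, by linarith, hN1, ?_, ?_, ?_⟩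
  · rw [htR]; nlinarith
  · rw [htR]; nlinarith
  · rw [div_le_iff₀ ht, htR]
    have : 16*π^2*(⌊R⌋₊:ℝ) ≤ 16*π^2*R := by gcongr
    have : 8*π*R ≤ 7*R^2 := by nlinarith
    nlinarith
  · intro ξ hξ
    have hUx : |U*ξ| ≤ R/6 := by
      rw [abs_mul, abs_of_pos hU]
      rw [abs_mul, abs_of_pos (by positivity)] at hξ
      have : |ξ| ≤ 1/6 := by nlinarith [abs_nonneg ξ]
      nlinarith [abs_nonneg ξ]
    have hx := abs_le.1 hUx
    rw [← hR2]
    unfold xh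
    have p1 : 0 ≤ (R-⌊R⌋₊)*(R+⌊R⌋₊-1/6) := mul_nonneg (by linarith) (by linarith)
    have p2 : 0 ≤ ((⌊R⌋₊:ℝ)+1-R)*(R+⌊R⌋₊+1+1/6) := mul_nonneg (by linarith) (by linarith)
    constructor
    · linarith [hx.1]
    · linarith [hx.2]

lemma log_J {t : ℝ} {N : ℕ} (hN : 4 ≤ N) (ht : 100 ≤ t) (hNt : (N:ℝ) ≤ t) :
    1 ≤ Real.log t ∧ Real.log N ≤ Real.log t ∧ ((Nat.log 2 N + 1 : ℕ):ℝ) ≤ 3*Real.log t := by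
  have h1 : 1 ≤ Real.log t := by
    rw [Real.le_log_iff_exp_le (by linarith)]
    linarith [Real.exp_one_lt_d9]
  have hN0 : (0:ℝ) < N := by exact_mod_cast (by omega : 0 < N)
  have h2 : Real.log N ≤ Real.log t := Real.log_le_log hN0 hNt
  refine ⟨h1, h2, ?_⟩
  have h3 : (2:ℝ)^(Nat.log 2 N) ≤ N := by exact_mod_cast Nat.pow_log_le_self 2 (by omega)
  have h4 := Real.log_le_log (by positivity) h3
  rw [Real.log_pow] at h4
  push_cast
  have : (0:ℝ) ≤ (Nat.log 2 N : ℝ) := by positivity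
  nlinarith [Real.log_two_gt_d9]

/-- Lemma 13.2. -/
theorem lemma13_2 :
    ∃ C₁ > (0:ℝ), ∃ c₂ > (0:ℝ), ∀ t U : ℝ, 0 < t → 0 < U →
      Real.sqrt (Real.pi * t) ≤ U^2 → U^2 ≤ t / (2 * Real.pi) →
      ((1 / (2*U)) * ∫ τ in (t - U)..(t + U),
          ‖riemannZeta (1/2 + τ * Complex.I)‖ ^ 2 ≤ C₁ * Real.log t) ∨
      (∃ T M M₁ : ℝ,
        t / (4 * Real.pi) ≤ T ∧ T ≤ 3 * t / (4 * Real.pi) ∧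
        1 ≤ M ∧ M ≤ Real.sqrt (2 * T) ∧ M/2 ≤ M₁ ∧ M₁ ≤ M ∧
        c₂ * ((1 / (2*U)) * ∫ τ in (t - U)..(t + U),
                ‖riemannZeta (1/2 + τ * Complex.I)‖ ^ 2) / Real.log t ≤
          ‖Sstar T U M M₁‖ / M) := by
  obtain ⟨C, hC, hafe⟩ := afe
  have hpi := Real.pi_pos
  set K := 4*π*C^2 with hK
  have hK0 : 0 < K := by positivity
  refine ⟨2*(K*117), by positivity, 1/(2*(96*K)), by positivity, ?_⟩
  intro t U ht hU h1 h2
  obtain ⟨N, hN4, hU4, ht100, hNU, hNR, hNt, h7, hξ⟩ := params ht hU h1 h2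
  obtain ⟨hl1, hlN, hJ⟩ := log_J hN4 ht100 hNt
  by_cases hii : (∃ T M M₁ : ℝ,
        t / (4 * Real.pi) ≤ T ∧ T ≤ 3 * t / (4 * Real.pi) ∧
        1 ≤ M ∧ M ≤ Real.sqrt (2 * T) ∧ M/2 ≤ M₁ ∧ M₁ ≤ M ∧
        1/(2*(96*K)) * ((1 / (2*U)) * ∫ τ in (t - U)..(t + U),
                ‖riemannZeta (1/2 + τ * Complex.I)‖ ^ 2) / Real.log t ≤
          ‖Sstar T U M M₁‖ / M)
  · exact Or.inr hii
  left
  push Not at hii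
  have hms := meansq (N := N) (t := t) hC hU (by
    intro ξ hx
    have e : t + 2*π*U*ξ = 2*π*(t/(2*π)+U*ξ) := by field_simp
    rw [e]
    exact hafe N _ hN4 (hξ ξ hx).1 (hξ ξ hx).2)
  rw [← hK] at hms
  have hI0 : 0 ≤ (1 / (2*U)) * ∫ τ in (t - U)..(t + U), ‖riemannZeta (1/2 + τ * Complex.I)‖ ^ 2 := by
    apply mul_nonneg (by positivity)
    exact intervalIntegral.integral_nonneg (by linarith) fun x _ => by positivity
  set I := (1 / (2*U)) * ∫ τ in (t - U)..(t + U), ‖riemannZeta (1/2 + τ * Complex.I)‖ ^ 2 with hI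
  set L := Real.log t with hL
  set ε := 1/(2*(96*K))*I/L with hε
  have hε0 : 0 ≤ ε := by positivity
  have hVP := VP_bound (N := N) (U := U) (ε := ε) ht hU4 (by omega) hε0 (by
    intro M hM1 hMN T hT1 hT2 M₁ hm1 hm2
    have hMT : M ≤ √(2*T) := by
      refine hMN.trans (hNR.trans (Real.sqrt_le_sqrt ?_))
      have : t/(2*π) = 2*(t/(4*π)) := by field_simp; norm_num
      linarith
    have := hii T M M₁ hT1 hT2 hM1 hMT hm1 hm2
    exact ((div_lt_iff₀ (by linarith)).1 this).le)
  have hA := stepA (t := t) hU4 (by omega : 1 ≤ N) hNU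
  have hH := harm_log N
  have hεL : ε*L = I/(2*(96*K)) := by rw [hε]; field_simp
  have hVP2 : ‖VP t U N‖ ≤ 3*L*(8*ε+7) := by
    refine hVP.trans ?_
    gcongr
  have hVP3 : ‖VP t U N‖ ≤ 24*(I/(2*(96*K))) + 21*L := by rw [← hεL]; linarith
  have hb : 1 + 2*(∑ a ∈ Finset.Ioc 0 N, 1/(a:ℝ) + 2*‖VV t U N‖) ≤ 96*(I/(2*(96*K))) + 117*L := by
    linarith
  have hfin : I ≤ K*(96*(I/(2*(96*K))) + 117*L) := hms.trans (by gcongr)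
  have e5 : K*(96*(I/(2*(96*K))) + 117*L) = I/2 + K*117*L := by field_simp
  rw [e5] at hfin
  linarith
end
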